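/- arXiv:2212.08521 — 3 statements merged into one kernel-verified Lean document; each statement's English description precedes it below -/
import Mathlib

section
/- Let n ≥ 2 and let D ⊆ ℂⁿ be a nonempty open convex set. Then there exists a holomorphic function f : D → ℂ such that for every divergent path γ : [0,1) → D of finite length, the real part of f is unbounded above along γ, i.e., sup_{t ∈ [0,1)} Re f(γ(t)) = +∞. (Globevnik's theorem on holomorphic functions whose real part blows up along every divergent path of finite length; convex domains are pseudoconvex.) -/
open Set Metric
open scoped ENNReal

noncomputable section

/-- A path `γ : [0,1) → E` is a divergent path in the open set `Ω` if it is continuous on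
`[0,1)`, takes values in `Ω`, and eventually leaves every compact subset of `Ω`. -/
def DivergentPathIn {E : Type*} [TopologicalSpace E] (Ω : Set E) (γ : ℝ → E) : Prop :=
  ContinuousOn γ (Set.Ico 0 1) ∧
  (∀ t ∈ Set.Ico (0 : ℝ) 1, γ t ∈ Ω) ∧
  ∀ K : Set E, K ⊆ Ω → IsCompact K →
    ∃ t₀ ∈ Set.Ico (0 : ℝ) 1, ∀ t ∈ Set.Ico t₀ 1, γ t ∉ K

/-- If the resolvent of `x` is bounded by `1 / δ` at the points of the imaginary axis where it
exists, then it exists on the whole imaginary axis. -/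
theorem I_mul_notMem_spectrum_of_norm_resolvent_le {A : Type*} [NormedRing A] [NormedAlgebra ℂ A]
    [CompleteSpace A] [NormOneClass A] (x : A) {δ : ℝ} (hδ : 0 < δ)
    (h : ∀ (y : ℝ) (u : Aˣ), (u : A) = algebraMap ℂ A (Complex.I * y) - x →
      ‖(↑u⁻¹ : A)‖ ≤ 1 / δ) (y : ℝ) :
    Complex.I * y ∉ spectrum ℂ x := by
  revert y
  by_contra! hne
  let S : Set ℝ := {y | Complex.I * y ∈ spectrum ℂ x}
  have hSne : S.Nonempty := hne
  have hcl : IsClosed S := (spectrum.isCompact x).isClosed.preimage (by fun_prop)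
  have hbd : S ⊆ closedBall 0 ‖x‖ := fun y hy => by
    have := spectrum.norm_le_norm_of_mem (k := Complex.I * y) hy
    simpa using this
  have hcomp : IsCompact S := (isCompact_closedBall (0 : ℝ) ‖x‖).of_isClosed_subset hcl hbd
  obtain ⟨y, hy, hmax⟩ := hcomp.exists_isGreatest hSne
  have hnot : Complex.I * ((y + δ / 2 : ℝ) : ℂ) ∉ spectrum ℂ x := fun h => by
    have := hmax (show y + δ / 2 ∈ S from h)
    linarith
  rw [spectrum.notMem_iff] at hnot
  obtain ⟨u, hu⟩ := hnot
  have hnorm := h _ u hu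
  have hlt : ‖(Complex.I * ((δ / 2 : ℝ) : ℂ)) • (↑u⁻¹ : A)‖ < 1 := by
    have h0 : ‖(Complex.I * ((δ / 2 : ℝ) : ℂ))‖ = δ / 2 := by
      rw [norm_mul, Complex.norm_I, Complex.norm_real, one_mul, Real.norm_of_nonneg (by positivity)]
    rw [norm_smul, h0]
    calc δ / 2 * ‖((↑u⁻¹ : A))‖ ≤ δ / 2 * (1 / δ) := by gcongr
      _ < 1 := by field_simp; norm_num
  have hunit := u.isUnit.mul (isUnit_one_sub_of_norm_lt_one hlt)
  refine (spectrum.mem_iff.1 (show Complex.I * (y : ℂ) ∈ spectrum ℂ x from hy)) ?_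
  convert hunit using 1
  rw [mul_sub, mul_one, mul_smul_comm, u.mul_inv, hu, ← Algebra.algebraMap_eq_smul_one]
  rw [sub_right_comm, ← map_sub]
  congr 2
  push_cast
  ring

open Polynomial in
/-- On a compact set of the plane that stays at distance `δ` from the imaginary axis, a closed
algebra of continuous functions that contains the coordinate contains the inverse of every
polynomial whose zeros lie on the imaginary axis. -/
theorem exists_inverse_mem_of_isClosed {K : Set ℂ} [CompactSpace K] [Nonempty K]
    {δ : ℝ} (hδ : 0 < δ) (hK : ∀ z ∈ K, δ ≤ |z.re|) (B : Subalgebra ℂ C(K, ℂ))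
    (hBc : IsClosed (B : Set C(K, ℂ))) (hXB : X.toContinuousMapOn K ∈ B) (Q : ℂ[X])
    (hQ : ∀ z, Q.eval z = 0 → z.re = 0) :
    ∃ u ∈ B, ∀ z : K, Q.eval (z : ℂ) * u z = 1 := by
  have : CompleteSpace B := hBc.completeSpace_coe
  have : NormOneClass B := ⟨norm_one (α := C(K, ℂ))⟩
  let x : B := ⟨X.toContinuousMapOn K, hXB⟩
  have hx : ∀ z : K, (x : C(K, ℂ)) z = z := fun z => by simp [x]
  have key : ∀ y : ℝ, Complex.I * y ∉ spectrum ℂ x := by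
    refine I_mul_notMem_spectrum_of_norm_resolvent_le x hδ fun y u hu => ?_
    have huv : ∀ z : K, (Complex.I * y - z) * ((↑u⁻¹ : B) : C(K, ℂ)) z = 1 := by
      intro z
      have h1 : ((u : B) * (↑u⁻¹ : B)) = 1 := u.mul_inv
      rw [hu] at h1
      have h2 := congrArg (fun b : B => (b : C(K, ℂ)) z) h1
      simpa [Algebra.algebraMap_eq_smul_one, hx] using h2
    change ‖((↑u⁻¹ : B) : C(K, ℂ))‖ ≤ 1 / δ
    rw [ContinuousMap.norm_le _ (by positivity)]
    intro z
    have h1 := congrArg norm (huv z)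
    rw [norm_mul, norm_one] at h1
    have h2 : δ ≤ ‖Complex.I * y - z‖ := by
      refine (hK z z.2).trans ?_
      have := Complex.abs_re_le_norm (Complex.I * y - z)
      simpa using this
    rw [le_div_iff₀ hδ]
    nlinarith [norm_nonneg (((↑u⁻¹ : B) : C(K, ℂ)) z)]
  have hunit : IsUnit (aeval x Q) := by
    rw [← spectrum.zero_notMem_iff ℂ, spectrum.map_polynomial_aeval]
    rintro ⟨z, hz, hz0⟩
    refine key z.im ?_
    have := hQ z hz0
    convert hz using 1
    apply Complex.ext <;> simp [this]
  obtain ⟨u, hu⟩ := hunit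
  refine ⟨((↑u⁻¹ : B) : C(K, ℂ)), (↑u⁻¹ : B).2, fun z => ?_⟩
  have h1 : ((u : B) * (↑u⁻¹ : B)) = 1 := u.mul_inv
  have h2 := congrArg (fun b : B => (b : C(K, ℂ)) z) h1
  have h3 : ((aeval x Q : B) : C(K, ℂ)) z = Q.eval (z : ℂ) := by
    have : ((aeval x Q : B) : C(K, ℂ)) = aeval (x : C(K, ℂ)) Q := by
      simp
    rw [this, aeval_continuousMap_apply, hx]
  rw [hu] at h2
  simpa [h3] using h2

open Polynomial in
/-- Approximation of the indicator function of the right half-plane by polynomials. -/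
theorem exists_polynomial_approx_indicator_halfPlane (R : ℝ) {δ ε : ℝ} (hδ : 0 < δ) (hε : 0 < ε) :
    ∃ p : ℂ[X], (∀ z : ℂ, ‖z‖ ≤ R → z.re ≤ -δ → ‖p.eval z‖ < ε) ∧
      ∀ z : ℂ, ‖z‖ ≤ R → δ ≤ z.re → ‖p.eval z - 1‖ < ε := by
  let T := |R| + δ
  have hRT : R ≤ T := (le_abs_self R).trans (by simp [T, hδ.le])
  have hT : 0 < T := by positivity
  let K : Set ℂ := {z | ‖z‖ ≤ T ∧ δ ≤ |z.re|}
  have hKc : IsCompact K := by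
    refine (isCompact_closedBall (0 : ℂ) T).of_isClosed_subset ?_ fun z hz => by simpa using hz.1
    exact (isClosed_le continuous_norm continuous_const).inter
      (isClosed_le continuous_const (Complex.continuous_re.abs))
  have : CompactSpace K := isCompact_iff_compactSpace.1 hKc
  have : Nonempty K := ⟨⟨(δ : ℂ), by
    simp [abs_of_pos hδ, T], by simp [abs_of_pos hδ]⟩⟩
  let θ : ℝ := 1 - 4 * δ / (1 + T) ^ 2
  have hθ1 : θ < 1 := by simp only [θ]; linarith [show 0 < 4 * δ / (1 + T) ^ 2 by positivity]
  have hθ0 : 0 ≤ θ := by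
    have hδT : δ ≤ T := by simp [T]
    have : 4 * δ / (1 + T) ^ 2 ≤ 1 := by
      rw [div_le_one (by positivity)]
      nlinarith [sq_nonneg (1 - T)]
    simp only [θ]; linarith
  obtain ⟨N, hN⟩ := exists_pow_lt_of_lt_one (show 0 < min (1 / 2) (ε / 4) by positivity) hθ1
  set s := θ ^ N with hs
  have hs0 : 0 ≤ s := pow_nonneg hθ0 _
  have hs1 : s < 1 / 2 := hN.trans_le (min_le_left _ _)
  have hs2 : s < ε / 4 := hN.trans_le (min_le_right _ _)
  have hN0 : N ≠ 0 := by rintro rfl; norm_num [hs] at hs1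
  have hsq : ∀ z : ℂ, ‖1 - z‖ ^ 2 = ‖1 + z‖ ^ 2 - 4 * z.re := fun z => by
    rw [← Complex.normSq_eq_norm_sq, ← Complex.normSq_eq_norm_sq, Complex.normSq_apply,
      Complex.normSq_apply]
    simp
    ring
  have hratio : ∀ z : ℂ, ‖z‖ ≤ T → δ ≤ z.re → ‖1 - z‖ ^ (2 * N) ≤ s * ‖1 + z‖ ^ (2 * N) := by
    intro z hz hzr
    rw [pow_mul, pow_mul, hs, ← mul_pow]
    refine pow_le_pow_left₀ (by positivity) ?_ N
    rw [hsq z]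
    have h1 : ‖1 + z‖ ^ 2 ≤ (1 + T) ^ 2 := by
      refine pow_le_pow_left₀ (by positivity) ((norm_add_le _ _).trans ?_) 2
      simpa using hz
    have h2 : 4 * δ / (1 + T) ^ 2 * ‖1 + z‖ ^ 2 ≤ 4 * δ := by
      rw [div_mul_eq_mul_div, div_le_iff₀ (by positivity)]
      gcongr
    simp only [θ]
    linarith
  have hpos : ∀ z : ℂ, δ ≤ z.re → 0 < ‖1 + z‖ := by
    intro z hz
    rw [norm_pos_iff]
    intro h
    have := congrArg Complex.re h
    simp at this
    linarith
  have hbound : ∀ a b w : ℂ, 0 < ‖a‖ → ‖b‖ ^ (2 * N) ≤ s * ‖a‖ ^ (2 * N) →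
      (a ^ (2 * N) + b ^ (2 * N)) * w = 1 → ‖b ^ (2 * N) * w‖ ≤ 2 * s := by
    intro a b w ha hab hw
    have h1 := congrArg norm hw
    rw [norm_mul, norm_one] at h1
    have h2 : (1 - s) * ‖a‖ ^ (2 * N) ≤ ‖a ^ (2 * N) + b ^ (2 * N)‖ := by
      have := norm_sub_le_norm_add (a ^ (2 * N)) (b ^ (2 * N))
      rw [norm_pow, norm_pow] at this
      linarith
    have h3 : 0 < ‖a‖ ^ (2 * N) := by positivity
    have h4 : (1 - s) * ‖a‖ ^ (2 * N) * ‖w‖ ≤ 1 := by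
      
      exact (mul_le_mul_of_nonneg_right h2 (norm_nonneg w)).trans_eq h1
    have h5 : ‖a‖ ^ (2 * N) * ‖w‖ ≤ 2 := by nlinarith [mul_nonneg h3.le (norm_nonneg w)]
    rw [norm_mul, norm_pow]
    calc ‖b‖ ^ (2 * N) * ‖w‖ ≤ s * ‖a‖ ^ (2 * N) * ‖w‖ := by gcongr
      _ = s * (‖a‖ ^ (2 * N) * ‖w‖) := by ring
      _ ≤ s * 2 := by gcongr
      _ = 2 * s := by ring
  obtain ⟨u, huB, hu⟩ := exists_inverse_mem_of_isClosed (K := K) hδ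
    (fun z hz => hz.2) _ (Subalgebra.isClosed_topologicalClosure (polynomialFunctions K))
    (Subalgebra.le_topologicalClosure _ ⟨X, by simp, rfl⟩) ((1 + X) ^ (2 * N) + (1 - X) ^ (2 * N)) (by
      intro z hz
      simp only [eval_add, eval_pow, eval_one, eval_X, eval_sub] at hz
      have h1 : ‖1 + z‖ ^ (2 * N) = ‖1 - z‖ ^ (2 * N) := by
        rw [← norm_pow, ← norm_pow, eq_neg_of_add_eq_zero_left hz, norm_neg]
      have h2 := (pow_left_inj₀ (norm_nonneg _) (norm_nonneg _) (by omega)).1 h1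
      have h3 := hsq z
      rw [h2] at h3
      linarith)
  simp only [eval_add, eval_pow, eval_one, eval_X, eval_sub] at hu
  have hr : ((1 + X : ℂ[X]) ^ (2 * N)).toContinuousMapOn K * u
      ∈ (polynomialFunctions K).topologicalClosure :=
    mul_mem (Subalgebra.le_topologicalClosure _ ⟨_, by simp, rfl⟩) huB
  obtain ⟨q, ⟨p, -, rfl⟩, hp⟩ := Metric.mem_closure_iff.1 hr (ε / 2) (by positivity)
  have happ : ∀ z (hz : z ∈ K), ‖p.eval z - (1 + z) ^ (2 * N) * u ⟨z, hz⟩‖ < ε / 2 := by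
    intro z hz
    have := (ContinuousMap.dist_apply_le_dist (⟨z, hz⟩ : K)).trans_lt hp
    rw [dist_comm, dist_eq_norm] at this
    simpa using this
  refine ⟨p, fun z hz hzr => ?_, fun z hz hzr => ?_⟩
  · have hzK : z ∈ K := ⟨hz.trans hRT, by rw [abs_of_neg] <;> linarith⟩
    have hn : δ ≤ (-z).re := by simpa using by linarith
    have h1 := hbound (1 - z) (1 + z) (u ⟨z, hzK⟩) (by simpa [sub_eq_add_neg] using hpos (-z) hn)
      (by simpa [sub_eq_add_neg] using hratio (-z) (by simpa using hz.trans hRT) hn)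
      (by linear_combination hu ⟨z, hzK⟩)
    calc ‖p.eval z‖ = ‖(p.eval z - (1 + z) ^ (2 * N) * u ⟨z, hzK⟩)
          + (1 + z) ^ (2 * N) * u ⟨z, hzK⟩‖ := by congr 1; ring
      _ ≤ _ := norm_add_le _ _
      _ < ε := by linarith [happ z hzK]
  · have hzK : z ∈ K := ⟨hz.trans hRT, by rw [abs_of_pos] <;> linarith⟩
    have h1 := hbound (1 + z) (1 - z) (u ⟨z, hzK⟩) (hpos z hzr) (hratio z (hz.trans hRT) hzr)
      (hu ⟨z, hzK⟩)
    calc ‖p.eval z - 1‖ = ‖(p.eval z - (1 + z) ^ (2 * N) * u ⟨z, hzK⟩)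
          - (1 - z) ^ (2 * N) * u ⟨z, hzK⟩‖ := by 
            congr 1; linear_combination hu ⟨z, hzK⟩
      _ ≤ _ := norm_sub_le _ _
      _ < ε := by linarith [happ z hzK]

/-- `L` can be lifted over `K` if some entire functions are uniformly small on `K` and have
arbitrarily large real part on `L`. -/
def Liftable {E : Type*} [NormedAddCommGroup E] [NormedSpace ℂ E] (K L : Set E) : Prop :=
  ∀ ε > 0, ∀ M : ℝ, ∃ g : E → ℂ, Differentiable ℂ g ∧ (∀ z ∈ K, ‖g z‖ < ε) ∧
    ∀ z ∈ L, M < (g z).re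

/-- The empty set can be lifted over every set. -/
theorem Liftable.empty {E : Type*} [NormedAddCommGroup E] [NormedSpace ℂ E] (K : Set E) :
    Liftable K ∅ := fun ε hε _ =>
  ⟨fun _ => 0, differentiable_const _, fun z _ => by simpa using hε, fun z hz => hz.elim⟩

/-- A compact set that a complex linear form separates from `K ∪ L` can be added to a set `L` that
can be lifted over `K`. -/
theorem Liftable.union_of_separated {E : Type*} [NormedAddCommGroup E] [NormedSpace ℂ E]
    {K L L' : Set E} (h : Liftable K L) (hK : IsCompact K) (hL : IsCompact L)
    (hL' : IsCompact L') (Λ : E →L[ℂ] ℂ) (a : ℝ) (hlt : ∀ z ∈ K ∪ L, (Λ z).re < a)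
    (hge : ∀ z ∈ L', a ≤ (Λ z).re) : Liftable K (L ∪ L') := by
  intro ε hε M
  obtain ⟨δ, hδ, hδK⟩ : ∃ δ > 0, ∀ z ∈ K ∪ L, (Λ z).re ≤ a - 2 * δ := by
    rcases (K ∪ L).eq_empty_or_nonempty with h0 | h0
    · exact ⟨1, one_pos, by simp [h0]⟩
    · obtain ⟨z₀, hz₀, hmax⟩ := (hK.union hL).exists_isMaxOn h0
        (f := fun z => (Λ z).re) (by fun_prop)
      refine ⟨(a - (Λ z₀).re) / 2, by linarith [hlt z₀ hz₀], fun z hz => ?_⟩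
      have : (Λ z).re ≤ (Λ z₀).re := hmax hz
      linarith
  obtain ⟨R, hR⟩ := ((hK.union hL).union hL').exists_bound_of_continuousOn
    (f := fun z => Λ z - ((a - δ : ℝ) : ℂ)) (by fun_prop)
  obtain ⟨g, hg, hgK, hgL⟩ := h (ε / 2) (by positivity) (M + 1)
  obtain ⟨S, hS⟩ := hL'.exists_bound_of_continuousOn (f := g) hg.continuous.continuousOn
  let c : ℝ := 2 * (|M| + |S| + 1)
  have hc : 0 < c := by positivity
  obtain ⟨p, hp0, hp1⟩ := exists_polynomial_approx_indicator_halfPlane R hδ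
    (show 0 < min (1 / 2) (min (ε / 2) 1 / c) by positivity)
  refine ⟨fun z => g z + c * p.eval (Λ z - ((a - δ : ℝ) : ℂ)), ?_, fun z hz => ?_, ?_⟩
  · refine hg.add (Differentiable.const_mul ?_ _)
    exact p.differentiable.comp (Λ.differentiable.sub_const _)
  · have h1 := hp0 _ (hR z (Or.inl (Or.inl hz))) (by
      have := hδK z (Or.inl hz)
      simp only [Complex.sub_re, Complex.ofReal_re]; linarith)
    have h2 := (lt_div_iff₀' hc).1 (h1.trans_le (min_le_right _ _))
    refine (norm_add_le _ _).trans_lt ?_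
    rw [norm_mul, Complex.norm_real, Real.norm_of_nonneg hc.le]
    linarith [hgK z hz, min_le_left (ε / 2) (1 : ℝ)]
  · rintro z (hz | hz)
    · have h1 := hp0 _ (hR z (Or.inl (Or.inr hz))) (by
        have := hδK z (Or.inr hz)
        simp only [Complex.sub_re, Complex.ofReal_re]; linarith)
      have h2 := (lt_div_iff₀' hc).1 (h1.trans_le (min_le_right _ _))
      have h3 := (abs_le.1 (Complex.abs_re_le_norm
        (p.eval (Λ z - ((a - δ : ℝ) : ℂ))))).1
      rw [Complex.add_re, Complex.re_ofReal_mul]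
      have h4 := mul_le_mul_of_nonneg_left h3 hc.le
      linarith [hgL z hz, min_le_right (ε / 2) (1 : ℝ)]
    · have h1 := hp1 _ (hR z (Or.inr hz)) (by
        have := hge z hz
        simp only [Complex.sub_re, Complex.ofReal_re]; linarith)
      have h2 := h1.trans_le (min_le_left _ _)
      have h3 := (abs_lt.1 ((Complex.abs_re_le_norm _).trans_lt h2)).1
      rw [Complex.sub_re, Complex.one_re] at h3
      have h4 := (abs_le.1 ((Complex.abs_re_le_norm _).trans (hS z hz))).1
      rw [Complex.add_re, Complex.re_ofReal_mul]
      have h5 : c * (1 / 2) < c * (p.eval (Λ z - ((a - δ : ℝ) : ℂ))).re :=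
        mul_lt_mul_of_pos_left (by linarith) hc
      have h6 : c * (1 / 2) = |M| + |S| + 1 := by simp only [c]; ring
      linarith [le_abs_self M, le_abs_self S]

/-- The squared distance to a convex set, perturbed by a multiple of the squared norm, is pinched
between two paraboloids at every point. -/
theorem exists_paraboloid_pinching {F : Type*} [NormedAddCommGroup F] [InnerProductSpace ℝ F]
    {K : Set F} (hne : K.Nonempty) (hcomp : IsComplete K) (hconv : Convex ℝ K) {ε : ℝ} (x : F) :
    ∃ p : F, ∀ z : F,
      inner ℝ p (z - x) + ε * ‖z - x‖ ^ 2 ≤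
        (infDist z K ^ 2 + ε * ‖z‖ ^ 2) - (infDist x K ^ 2 + ε * ‖x‖ ^ 2) ∧
      (infDist z K ^ 2 + ε * ‖z‖ ^ 2) - (infDist x K ^ 2 + ε * ‖x‖ ^ 2) ≤
        inner ℝ p (z - x) + (1 + ε) * ‖z - x‖ ^ 2 := by
  have hproj : ∀ y : F, ∃ v ∈ K, infDist y K = ‖y - v‖ ∧ ∀ w ∈ K, inner ℝ (y - v) (w - v) ≤ 0 := by
    intro y
    obtain ⟨v, hv, h2⟩ := exists_norm_eq_iInf_of_complete_convex hne hcomp hconv y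
    refine ⟨v, hv, ?_, (norm_eq_iInf_iff_real_inner_le_zero hconv hv).1 h2⟩
    rw [h2, infDist_eq_iInf]
    simp [dist_eq_norm]
  obtain ⟨v, hv, hxv, hv0⟩ := hproj x
  refine ⟨(2 : ℝ) • (x - v) + (2 * ε) • x, fun z => ?_⟩
  obtain ⟨w, hw, hzw, -⟩ := hproj z
  have hz : ‖z‖ ^ 2 = ‖x‖ ^ 2 + 2 * inner ℝ x (z - x) + ‖z - x‖ ^ 2 := by
    rw [← norm_add_sq_real]; simp
  have hp : inner ℝ ((2 : ℝ) • (x - v) + (2 * ε) • x) (z - x)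
      = 2 * inner ℝ (x - v) (z - x) + 2 * ε * inner ℝ x (z - x) := by
    rw [inner_add_left, real_inner_smul_left, real_inner_smul_left]
  rw [hp, hz]
  constructor
  · have h1 : ‖z - w‖ ^ 2 = ‖x - v‖ ^ 2 + 2 * inner ℝ (x - v) ((z - w) - (x - v))
        + ‖(z - w) - (x - v)‖ ^ 2 := by
      rw [← norm_add_sq_real]; simp
    have h2 : inner ℝ (x - v) ((z - w) - (x - v))
        = inner ℝ (x - v) (z - x) - inner ℝ (x - v) (w - v) := by
      rw [← inner_sub_right]; congr 1; abel
    rw [hxv, hzw, h1, h2]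
    nlinarith [hv0 w hw, sq_nonneg ‖(z - w) - (x - v)‖]
  · have h1 : infDist z K ≤ ‖z - v‖ := by
      rw [← dist_eq_norm]; exact infDist_le_dist_of_mem hv
    have h2 : ‖z - v‖ ^ 2 = ‖x - v‖ ^ 2 + 2 * inner ℝ (x - v) (z - x) + ‖z - x‖ ^ 2 := by
      rw [← norm_add_sq_real]; simp
    have h3 : infDist z K ^ 2 ≤ ‖z - v‖ ^ 2 := pow_le_pow_left₀ infDist_nonneg h1 2
    rw [hxv]
    nlinarith

/-- Nets of mesh `h` in a ball of `ℂⁿ`, with a number of colours that does not depend on `h`,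
such that points of the same colour are far apart at scale `h`. -/
theorem exists_colored_net (n : ℕ) (M : ℝ) : ∃ q : ℕ, 0 < q ∧ ∀ h > 0, ∀ R : ℝ,
    ∃ (ι : Type) (_ : Finite ι) (g : ι → EuclideanSpace ℂ (Fin n)) (col : ι → Fin q),
      (∀ y, ‖y‖ ≤ R → ∃ k, ‖y - g k‖ ≤ h) ∧
      ∀ k k', k ≠ k' → col k = col k' → M * h ≤ ‖g k - g k'‖ := by
  obtain ⟨m, hm⟩ := exists_nat_gt (max 0 (2 * (n + 1) * M))
  have hm0 : 0 < m := by exact_mod_cast (le_max_left _ _).trans_lt hm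
  have hmM := (le_max_right _ _).trans_lt hm
  have : NeZero m := ⟨hm0.ne'⟩
  refine ⟨Fintype.card (Fin n → ZMod m × ZMod m), Fintype.card_pos, fun h hh R => ?_⟩
  let d : ℝ := h / (2 * (n + 1))
  have hd : 0 < d := by positivity
  obtain ⟨T, hT⟩ := exists_nat_gt (R / d + 1)
  let S : Set (Fin n → ℤ × ℤ) := Set.pi univ fun _ => Icc (-(T : ℤ)) T ×ˢ Icc (-(T : ℤ)) T
  let pt : (Fin n → ℤ × ℤ) → EuclideanSpace ℂ (Fin n) := fun k =>
    WithLp.toLp 2 fun i => (⟨d * (k i).1, d * (k i).2⟩ : ℂ)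
  refine ⟨S, ?_, fun k => pt k,
    fun k => Fintype.equivFin _ fun i => (((k : Fin n → ℤ × ℤ) i).1, ((k : Fin n → ℤ × ℤ) i).2),
    fun y hy => ?_, fun k k' hne hcol => ?_⟩
  · exact (Set.Finite.pi' fun _ => (finite_Icc _ _).prod (finite_Icc _ _)).subset
      (fun k hk i => hk i (mem_univ i))
  · have hfl : ∀ t : ℝ, |t| ≤ R → ⌊t / d⌋ ∈ Icc (-(T : ℤ)) T := by
      intro t ht
      have h1 := abs_le.1 ht
      have h2 : t / d ≤ R / d := by gcongr; exact h1.2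
      have h3 : -(R / d) ≤ t / d := by rw [← neg_div]; gcongr; exact h1.1
      constructor
      · rw [Int.le_floor]; push_cast; linarith
      · have := Int.floor_le (t / d)
        exact_mod_cast this.trans (by linarith : t / d ≤ (T : ℝ))
    have hfd : ∀ t : ℝ, |t - d * ⌊t / d⌋| ≤ d := by
      intro t
      have h1 := Int.floor_le (t / d)
      have h2 := (Int.lt_floor_add_one (t / d)).le
      rw [le_div_iff₀' hd] at h1
      rw [div_le_iff₀' hd] at h2
      rw [abs_le]
      constructor <;> linarith
    have hyi : ∀ i, ‖y i‖ ≤ R := fun i => (PiLp.norm_apply_le y i).trans hy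
    refine ⟨⟨fun i => (⌊(y i).re / d⌋, ⌊(y i).im / d⌋), fun i _ =>
      ⟨hfl _ ((Complex.abs_re_le_norm _).trans (hyi i)),
        hfl _ ((Complex.abs_im_le_norm _).trans (hyi i))⟩⟩, ?_⟩
    rw [EuclideanSpace.norm_eq]
    refine Real.sqrt_le_iff.2 ⟨hh.le, ?_⟩
    calc _ ≤ ∑ _i : Fin n, (2 * d) ^ 2 := by
          refine Finset.sum_le_sum fun i _ => pow_le_pow_left₀ (norm_nonneg _) ?_ 2
          refine (Complex.norm_le_abs_re_add_abs_im _).trans ?_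
          have h1 := hfd (y i).re
          have h2 := hfd (y i).im
          simp only [PiLp.sub_apply, Complex.sub_re, Complex.sub_im, pt]
          linarith
      _ = n * (h / (n + 1)) ^ 2 := by
          simp only [Finset.sum_const, Finset.card_univ, Fintype.card_fin, nsmul_eq_mul, d]
          field_simp
      _ ≤ h ^ 2 := by
          rw [div_pow, mul_div_assoc', div_le_iff₀ (by positivity), mul_comm]
          gcongr
          nlinarith [(Nat.cast_nonneg n : (0 : ℝ) ≤ n)]
  · have hcol' := (Fintype.equivFin _).injective hcol
    obtain ⟨i, hi⟩ : ∃ i, (k : Fin n → ℤ × ℤ) i ≠ (k' : Fin n → ℤ × ℤ) i := by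
      by_contra! hcon
      exact hne (Subtype.ext (funext hcon))
    have hci := congrFun hcol' i
    simp only [Prod.mk.injEq] at hci
    have hint : ∀ a b : ℤ, (a : ZMod m) = b → a ≠ b → M * h ≤ |d * a - d * b| := by
      intro a b hab hne
      rw [← sub_eq_zero, ← Int.cast_sub, ZMod.intCast_zmod_eq_zero_iff_dvd] at hab
      have h1 : (m : ℤ) ≤ |a - b| := Int.le_of_dvd (abs_pos.2 (sub_ne_zero.2 hne))
        ((dvd_abs _ _).2 hab)
      have h2 : (m : ℝ) ≤ |(a : ℝ) - b| := by exact_mod_cast h1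
      rw [← mul_sub, abs_mul, abs_of_pos hd]
      calc M * h = d * (2 * (n + 1) * M) := by simp only [d]; field_simp
        _ ≤ d * |(a : ℝ) - b| := by gcongr; linarith
    have hnorm : ‖(pt k - pt k') i‖ ≤ ‖pt k - pt k'‖ := PiLp.norm_apply_le _ i
    refine le_trans ?_ hnorm
    by_cases h1 : ((k : Fin n → ℤ × ℤ) i).1 = ((k' : Fin n → ℤ × ℤ) i).1
    · have h2 : ((k : Fin n → ℤ × ℤ) i).2 ≠ ((k' : Fin n → ℤ × ℤ) i).2 :=
        fun h2 => hi (Prod.ext h1 h2)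
      exact (hint _ _ hci.2 h2).trans (Complex.abs_im_le_norm ((pt k - pt k') i))
    · exact (hint _ _ hci.1 h1).trans (Complex.abs_re_le_norm ((pt k - pt k') i))

/-- Finitely many layers of separated pieces of tangent planes to the level sets of `φ`, placed at
sufficiently spaced levels above `K`, can be lifted over `K`. -/
theorem Liftable.iUnion_layers {n : ℕ} {ι : Type} [Finite ι] {K : Set (EuclideanSpace ℂ (Fin n))}
    (hK : IsCompact K) {φ : EuclideanSpace ℂ (Fin n) → ℝ}
    {p : EuclideanSpace ℂ (Fin n) → EuclideanSpace ℂ (Fin n)} {c C r : ℝ} (hc : 0 ≤ c)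
    (hC : 0 ≤ C)
    (hlow : ∀ x z, inner ℝ (p x) (z - x) + c * ‖z - x‖ ^ 2 ≤ φ z - φ x)
    (hup : ∀ x z, φ z - φ x ≤ inner ℝ (p x) (z - x) + C * ‖z - x‖ ^ 2)
    {t : ℕ → ℝ} (hKt : ∀ z ∈ K, φ z < t 0) (ht : ∀ i, t i + C * r ^ 2 < t (i + 1))
    {x : ℕ → ι → EuclideanSpace ℂ (Fin n)} {P : ℕ → ι → Set (EuclideanSpace ℂ (Fin n))}
    (hPc : ∀ i k, IsCompact (P i k)) (hφx : ∀ i k, (P i k).Nonempty → φ (x i k) = t i)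
    (hPr : ∀ i k, ∀ z ∈ P i k, ‖z - x i k‖ ≤ r)
    (hPp : ∀ i k, ∀ z ∈ P i k, inner ℝ (p (x i k)) (z - x i k) = 0)
    (hsep : ∀ i k k', k ≠ k' → (P i k').Nonempty → ∀ z ∈ P i k,
      C * r ^ 2 < c * ‖z - x i k'‖ ^ 2) (m : ℕ) :
    IsCompact (⋃ i < m, ⋃ k, P i k) ∧ Liftable K (⋃ i < m, ⋃ k, P i k) ∧
      ∀ z ∈ ⋃ i < m, ⋃ k, P i k, φ z < t m := by
  have hPφ : ∀ i k, ∀ z ∈ P i k, φ z ≤ t i + C * r ^ 2 := by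
    intro i k z hz
    have h1 := hup (x i k) z
    rw [hφx i k ⟨z, hz⟩, hPp i k z hz] at h1
    have h2 : C * ‖z - x i k‖ ^ 2 ≤ C * r ^ 2 := by
      gcongr; exact hPr i k z hz
    linarith
  have htm : Monotone t := monotone_nat_of_le_succ fun i => by
    have := ht i
    have h2 : 0 ≤ C * r ^ 2 := by positivity
    linarith
  induction m with
  | zero => simp [Liftable.empty]
  | succ m ih =>
    obtain ⟨hcomp, hlift, hlt⟩ := ih
    have hKm : ∀ z ∈ K, φ z < t m := fun z hz => (hKt z hz).trans_le (htm (Nat.zero_le m))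
    have hunion : (⋃ i < m + 1, ⋃ k, P i k) = (⋃ i < m, ⋃ k, P i k) ∪ ⋃ k, P m k :=
      biUnion_lt_succ (fun i => ⋃ k, P i k) m
    have key : ∀ s : Set ι, Liftable K ((⋃ i < m, ⋃ k, P i k) ∪ ⋃ k ∈ s, P m k) := by
      intro s
      induction s, s.toFinite using Set.Finite.induction_on with
      | empty => simpa using hlift
      | @insert k s hks hs ih =>
        rw [biUnion_insert, union_comm (P m k), ← union_assoc]
        rcases (P m k).eq_empty_or_nonempty with h0 | h0
        · rw [h0, union_empty]; exact ih
        have hre : ∀ z, (innerSL ℂ (p (x m k)) z).re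
            = inner ℝ (p (x m k)) (z - x m k) + inner ℝ (p (x m k)) (x m k) := by
          intro z
          rw [← inner_add_right, sub_add_cancel, innerSL_apply_apply]
          simp [PiLp.inner_apply, Complex.inner]
        refine ih.union_of_separated hK (hcomp.union (hs.isCompact_biUnion fun k' _ => hPc m k'))
          (hPc m k) (innerSL ℂ (p (x m k))) (inner ℝ (p (x m k)) (x m k)) ?_ ?_
        · have hneg : ∀ z, φ z < t m + c * ‖z - x m k‖ ^ 2 →
              (innerSL ℂ (p (x m k)) z).re < inner ℝ (p (x m k)) (x m k) := by
            intro z hz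
            have h1 := hlow (x m k) z
            rw [hφx m k h0] at h1
            rw [hre z]
            linarith
          have hneg' : ∀ z, φ z < t m →
              (innerSL ℂ (p (x m k)) z).re < inner ℝ (p (x m k)) (x m k) := by
            intro z hz
            refine hneg z (hz.trans_le ?_)
            have : 0 ≤ c * ‖z - x m k‖ ^ 2 := by positivity
            linarith
          rintro z (hz | hz | hz)
          · exact hneg' z (hKm z hz)
          · exact hneg' z (hlt z hz)
          · simp only [mem_iUnion] at hz
            obtain ⟨k', hk's, hz⟩ := hz
            refine hneg z ?_
            have h1 := hsep m k' k (fun h => hks (h ▸ hk's)) h0 z hz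
            linarith [hPφ m k' z hz]
        · intro z hz
          rw [hre z, hPp m k z hz, zero_add]
    rw [hunion]
    refine ⟨hcomp.union (isCompact_iUnion fun k => hPc m k), ?_, ?_⟩
    · simpa using key univ
    · rintro z (hz | hz)
      · exact (hlt z hz).trans_le (htm (Nat.le_succ m))
      · obtain ⟨k, hk⟩ := mem_iUnion.1 hz
        exact (hPφ m k z hk).trans_lt (ht m)

/-- If a path needs variation at least `κ` between any two consecutive levels of `u`, then it needs
variation at least `G * κ` to cross `G` levels. -/
theorem nsmul_le_eVariationOn_of_levels {E : Type*} [PseudoEMetricSpace E] {γ : ℝ → E} {u : ℝ → ℝ}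
    {a b : ℝ} (hab : a ≤ b) (hu : ContinuousOn u (Icc a b)) {T : ℕ → ℝ} (hT : Monotone T) {G : ℕ}
    (ha : u a ≤ T 0) (hb : T G ≤ u b) {κ : ℝ≥0∞}
    (hstep : ∀ g < G, ∀ τ τ', a ≤ τ → τ ≤ τ' → τ' ≤ b → u τ = T g → u τ' = T (g + 1) →
      κ ≤ eVariationOn γ (Icc τ τ')) : G • κ ≤ eVariationOn γ (Icc a b) := by
  have key : ∀ g ≤ G, ∃ τ ∈ Icc a b, u τ = T g ∧ g • κ ≤ eVariationOn γ (Icc a τ) := by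
    intro g
    induction g with
    | zero =>
      intro _
      obtain ⟨τ, hτ, h⟩ := intermediate_value_Icc hab hu ⟨ha, (hT (Nat.zero_le G)).trans hb⟩
      exact ⟨τ, hτ, h, by simp⟩
    | succ g ih =>
      intro hg
      obtain ⟨τ, hτ, h, hv⟩ := ih (by omega)
      obtain ⟨τ', hτ', h'⟩ := intermediate_value_Icc hτ.2
        (hu.mono (Icc_subset_Icc_left hτ.1)) ⟨h.trans_le (hT (Nat.le_succ g)), (hT hg).trans hb⟩
      refine ⟨τ', ⟨hτ.1.trans hτ'.1, hτ'.2⟩, h', ?_⟩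
      have h1 := eVariationOn.Icc_add_Icc γ (s := univ) hτ.1 hτ'.1 (mem_univ τ)
      simp only [univ_inter] at h1
      rw [← h1, succ_nsmul]
      exact add_le_add hv (hstep g hg τ τ' hτ.1 hτ'.1 hτ'.2 h h')
  obtain ⟨τ, hτ, -, hv⟩ := key G le_rfl
  exact hv.trans (eVariationOn.mono γ (Icc_subset_Icc_right hτ.2))

/-- A path that stays near `x` and climbs from the level of `x` to a sufficiently higher level
crosses the hyperplane through `x` which is tangent to the level set. -/
theorem exists_inner_eq_zero_of_pinched {F : Type*} [NormedAddCommGroup F] [InnerProductSpace ℝ F]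
    {φ : F → ℝ} {p x : F} {c C r : ℝ} (hc : 0 ≤ c) (hC : 0 ≤ C)
    (hlow : ∀ z, inner ℝ p (z - x) + c * ‖z - x‖ ^ 2 ≤ φ z - φ x)
    (hup : ∀ z, φ z - φ x ≤ inner ℝ p (z - x) + C * ‖z - x‖ ^ 2)
    {γ : ℝ → F} {a b : ℝ} (hab : a ≤ b) (hγ : ContinuousOn γ (Icc a b)) (ha : φ (γ a) ≤ φ x)
    (hb : φ x + C * r ^ 2 ≤ φ (γ b)) (hr : ‖γ b - x‖ ≤ r) :
    ∃ s ∈ Icc a b, inner ℝ p (γ s - x) = 0 := by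
  have hcont : ContinuousOn (fun s => inner ℝ p (γ s - x)) (Icc a b) :=
    (innerSL ℝ p).continuous.comp_continuousOn (hγ.sub continuousOn_const)
  have h1 : inner ℝ p (γ a - x) ≤ 0 := by
    have := hlow (γ a)
    have : 0 ≤ c * ‖γ a - x‖ ^ 2 := by positivity
    linarith
  have h2 : 0 ≤ inner ℝ p (γ b - x) := by
    have := hup (γ b)
    have : C * ‖γ b - x‖ ^ 2 ≤ C * r ^ 2 := by gcongr
    linarith
  obtain ⟨s, hs, hs'⟩ := intermediate_value_Icc hab hcont ⟨h1, h2⟩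
  exact ⟨s, hs, hs'⟩

/-- A short path which climbs far enough passes through one of the tangent discs based near the
points of a net. -/
theorem exists_crossed_disc {F ι : Type*} [NormedAddCommGroup F] [InnerProductSpace ℝ F]
    {φ : F → ℝ} (hφ : Continuous φ) {p : F → F} {c C r : ℝ} (hc : 0 ≤ c) (hC : 0 ≤ C)
    (hlow : ∀ x z, inner ℝ (p x) (z - x) + c * ‖z - x‖ ^ 2 ≤ φ z - φ x)
    (hup : ∀ x z, φ z - φ x ≤ inner ℝ (p x) (z - x) + C * ‖z - x‖ ^ 2)
    (hr : 0 < r) {q : ℕ} {g : ι → F} {col : ι → Fin q}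
    {γ : ℝ → F} {a b : ℝ} (hab : a ≤ b) (hγ : ContinuousOn γ (Icc a b))
    (hg : ∃ k, ‖γ a - g k‖ ≤ r / 4)
    (hb : φ (γ b) = φ (γ a) + q * (2 * C * r ^ 2))
    (hvar : eVariationOn γ (Icc a b) < ENNReal.ofReal (r / 4)) :
    ∃ k, (∃ x, ‖x - g k‖ ≤ r / 2 ∧ φ x = φ (γ a) + col k * (2 * C * r ^ 2)) ∧
      ∀ x, ‖x - g k‖ ≤ r / 2 → φ x = φ (γ a) + col k * (2 * C * r ^ 2) →
        ∃ s ∈ Icc a b, ‖γ s - x‖ ≤ r ∧ inner ℝ (p x) (γ s - x) = 0 := by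
  obtain ⟨k, hk⟩ := hg
  have hσ : 0 ≤ C * r ^ 2 := by positivity
  have hnear : ∀ s ∈ Icc a b, ‖γ s - g k‖ ≤ r / 2 := by
    intro s hs
    have h1 := (eVariationOn.edist_le γ hs (left_mem_Icc.2 hab)).trans_lt hvar
    rw [edist_dist, ENNReal.ofReal_lt_ofReal_iff (by positivity), dist_eq_norm] at h1
    calc ‖γ s - g k‖ = ‖(γ s - γ a) + (γ a - g k)‖ := by congr 1; abel
      _ ≤ _ := norm_add_le _ _
      _ ≤ _ := by linarith
  have hcol : ((col k : ℕ) : ℝ) + 1 ≤ q := by exact_mod_cast (col k).2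
  have hcol0 : (0 : ℝ) ≤ ((col k : ℕ) : ℝ) := by positivity
  refine ⟨k, ?_, ?_⟩
  · obtain ⟨s, hs, hs'⟩ := intermediate_value_Icc hab (hφ.comp_continuousOn hγ)
      (show φ (γ a) + col k * (2 * C * r ^ 2) ∈ Icc (φ (γ a)) (φ (γ b)) from
        ⟨by nlinarith, by rw [hb]; nlinarith⟩)
    exact ⟨γ s, hnear s hs, hs'⟩
  · intro x hx hφx
    have hd : ∀ s ∈ Icc a b, ‖γ s - x‖ ≤ r := by
      intro s hs
      calc ‖γ s - x‖ = ‖(γ s - g k) - (x - g k)‖ := by congr 1; abel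
        _ ≤ _ := norm_sub_le _ _
        _ ≤ r := by linarith [hnear s hs]
    obtain ⟨s, hs, hs'⟩ := exists_inner_eq_zero_of_pinched hc hC (hlow x) (hup x) hab hγ
      (by nlinarith) (show φ x + C * r ^ 2 ≤ φ (γ b) by rw [hb, hφx]; nlinarith)
      (hd b (right_mem_Icc.2 hab))
    exact ⟨s, hs, hd s hs, hs'⟩

/-- A path which leaves a neighbourhood of a set crosses its boundary for a first time. -/
theorem exists_first_infDist_eq {X : Type*} [PseudoMetricSpace X] {K : Set X} {γ : ℝ → X}
    {a b η : ℝ} (hab : a ≤ b) (hγ : ContinuousOn γ (Icc a b)) (hη : 0 ≤ η) (ha : γ a ∈ K)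
    (hb : η ≤ infDist (γ b) K) :
    ∃ b' ∈ Icc a b, infDist (γ b') K = η ∧ ∀ s ∈ Icc a b', infDist (γ s) K ≤ η := by
  have hcont : ContinuousOn (fun s => infDist (γ s) K) (Icc a b) :=
    (continuous_infDist_pt K).comp_continuousOn hγ
  have hcpt : IsCompact (Icc a b ∩ (fun s => infDist (γ s) K) ⁻¹' {η}) :=
    isCompact_Icc.of_isClosed_subset
      (hcont.preimage_isClosed_of_isClosed isClosed_Icc isClosed_singleton) inter_subset_left
  have hne : (Icc a b ∩ (fun s => infDist (γ s) K) ⁻¹' {η}).Nonempty := by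
    obtain ⟨s, hs, hs'⟩ := intermediate_value_Icc hab hcont
      (show η ∈ Icc _ _ from ⟨by simpa [infDist_zero_of_mem ha] using hη, hb⟩)
    exact ⟨s, hs, hs'⟩
  obtain ⟨b', hb', hmin⟩ := hcpt.exists_isLeast hne
  refine ⟨b', hb'.1, hb'.2, fun s hs => ?_⟩
  by_contra! hlt
  obtain ⟨s', hs', hs''⟩ := intermediate_value_Icc hs.1
    (hcont.mono (Icc_subset_Icc_right (hs.2.trans hb'.1.2)))
    (show η ∈ Icc _ _ from ⟨by simpa [infDist_zero_of_mem ha] using hη, hlt.le⟩)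
  have h1 : b' ≤ s' := hmin ⟨⟨hs'.1, hs'.2.trans (hs.2.trans hb'.1.2)⟩, hs''⟩
  have h2 : s = b' := le_antisymm hs.2 (h1.trans hs'.2)
  subst h2
  exact hlt.ne' hb'.2

/-- Around a compact convex set there is a compact set over which large real parts can be lifted
and which every path crossing the given collar must meet unless it is long. -/
theorem exists_labyrinth {n : ℕ} {K : Set (EuclideanSpace ℂ (Fin n))} (hK : IsCompact K)
    (hne : K.Nonempty) (hconv : Convex ℝ K) {η A : ℝ} (hη : 0 < η) (hA : 0 ≤ A) :
    ∃ L : Set (EuclideanSpace ℂ (Fin n)), IsCompact L ∧ (∀ z ∈ L, infDist z K ≤ η) ∧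
      Liftable K L ∧ ∀ (γ : ℝ → EuclideanSpace ℂ (Fin n)) (a b : ℝ), a ≤ b →
        ContinuousOn γ (Icc a b) → γ a ∈ K → η ≤ infDist (γ b) K →
        (∀ s ∈ Icc a b, γ s ∉ L) → ENNReal.ofReal A ≤ eVariationOn γ (Icc a b) := by
  obtain ⟨R, hR⟩ := hK.isBounded.exists_norm_le
  set c : ℝ := η ^ 2 / (4 * (R ^ 2 + 1)) with hc_def
  have hc : 0 < c := by positivity
  have hcR : c * (R ^ 2 + 1) = η ^ 2 / 4 := by rw [hc_def]; field_simp
  set C : ℝ := 1 + c with hC_def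
  have hC : 0 < C := by positivity
  set φ : EuclideanSpace ℂ (Fin n) → ℝ := fun z => infDist z K ^ 2 + c * ‖z‖ ^ 2 with hφ_def
  have hφ : Continuous φ := by
    have := continuous_infDist_pt K
    fun_prop
  choose p hp using fun x => exists_paraboloid_pinching hne hK.isComplete hconv (ε := c) x
  have hlow : ∀ x z, inner ℝ (p x) (z - x) + c * ‖z - x‖ ^ 2 ≤ φ z - φ x := fun x z => (hp x z).1
  have hup : ∀ x z, φ z - φ x ≤ inner ℝ (p x) (z - x) + C * ‖z - x‖ ^ 2 := fun x z => (hp x z).2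
  have hφK : ∀ z ∈ K, φ z < η ^ 2 / 2 := by
    intro z hz
    have h1 : ‖z‖ ^ 2 ≤ R ^ 2 := pow_le_pow_left₀ (norm_nonneg _) (hR z hz) 2
    have h2 : c * ‖z‖ ^ 2 ≤ c * (R ^ 2 + 1) := by gcongr; linarith
    have h3 : 0 < η ^ 2 := by positivity
    simp only [hφ_def, infDist_zero_of_mem hz]
    linarith
  have hWR : ∀ z, infDist z K ≤ η → ‖z‖ ≤ R + η := by
    intro z hz
    obtain ⟨y, hy, hzy⟩ := hK.exists_infDist_eq_dist hne z
    rw [hzy, dist_eq_norm] at hz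
    calc ‖z‖ = ‖y + (z - y)‖ := by congr 1; abel
      _ ≤ _ := norm_add_le _ _
      _ ≤ _ := by linarith [hR y hy]
  have hWc : IsClosed {z : EuclideanSpace ℂ (Fin n) | infDist z K ≤ η} :=
    isClosed_le (continuous_infDist_pt K) continuous_const
  have hW : IsCompact {z : EuclideanSpace ℂ (Fin n) | infDist z K ≤ η} :=
    (isCompact_closedBall (0 : EuclideanSpace ℂ (Fin n)) (R + η)).of_isClosed_subset hWc
      fun z hz => by simpa using hWR z hz
  obtain ⟨q, hq, hnet⟩ := exists_colored_net n (8 + 4 * (1 + C / c))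
  have hq' : (0 : ℝ) < q := by exact_mod_cast hq
  set r : ℝ := (η ^ 2 / 2) / (2 * C * q * (4 * A + 1) + η ^ 2 / 2) with hr_def
  have hr : 0 < r := by positivity
  have hrD : r * (2 * C * q * (4 * A + 1)) + r * (η ^ 2 / 2) = η ^ 2 / 2 := by
    rw [← mul_add, hr_def]; field_simp
  have hr1 : r ≤ 1 := by
    rw [hr_def, div_le_one (by positivity)]
    linarith [show 0 ≤ 2 * C * q * (4 * A + 1) by positivity]
  obtain ⟨ι, _, g, col, hg, hcol⟩ := hnet (r / 4) (by positivity) (R + η)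
  set G : ℕ := ⌈4 * A / r⌉₊ with hG_def
  have hGA : A ≤ G * (r / 4) := by
    have := Nat.le_ceil (4 * A / r)
    rw [div_le_iff₀ hr] at this
    linarith
  have hGr : G * r ≤ 4 * A + 1 := by
    have h1 := (Nat.ceil_lt_add_one (show 0 ≤ 4 * A / r by positivity)).le
    have h2 : G * r ≤ (4 * A / r + 1) * r := by gcongr
    rw [add_mul, div_mul_cancel₀ _ hr.ne'] at h2
    linarith
  set σ : ℝ := 2 * C * r ^ 2 with hσ_def
  have hσ : 0 < σ := by positivity
  set t : ℕ → ℝ := fun i => η ^ 2 / 2 + i * σ with ht_def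
  have htG : t (G * q) ≤ η ^ 2 := by
    have h1 : G * r * (r * (2 * C * q)) ≤ (4 * A + 1) * (r * (2 * C * q)) := by gcongr
    have h2 : 0 < r * (η ^ 2 / 2) := by positivity
    simp only [ht_def, hσ_def]
    push_cast
    linarith
  set Q : ℕ → ι → EuclideanSpace ℂ (Fin n) → Prop :=
    fun i k x => ‖x - g k‖ ≤ r / 2 ∧ φ x = t i with hQ_def
  set x : ℕ → ι → EuclideanSpace ℂ (Fin n) := fun i k => Classical.epsilon (Q i k) with hx_def
  have hx : ∀ i k, (∃ y, Q i k y) → Q i k (x i k) := fun i k h => Classical.epsilon_spec h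
  set P : ℕ → ι → Set (EuclideanSpace ℂ (Fin n)) := fun i k =>
    {z | infDist z K ≤ η} ∩ {z | ((col k : ℕ) = i % q ∧ ∃ y, Q i k y) ∧
      ‖z - x i k‖ ≤ r ∧ inner ℝ (p (x i k)) (z - x i k) = 0} with hP_def
  have hPc : ∀ i k, IsCompact (P i k) := by
    intro i k
    refine hW.inter_right (isClosed_const.inter (IsClosed.inter ?_ ?_))
    · exact isClosed_le (continuous_id.sub continuous_const).norm continuous_const
    · exact isClosed_eq ((innerSL ℝ (p (x i k))).continuous.comp
        (continuous_id.sub continuous_const)) continuous_const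
  obtain ⟨hLc, hLl, -⟩ := Liftable.iUnion_layers hK hc.le hC.le hlow hup (t := t) (r := r)
    (by simpa [ht_def] using hφK)
    (fun i => by
      have : 0 < C * r ^ 2 := by positivity
      simp only [ht_def, hσ_def]; push_cast; linarith) hPc
    (fun i k ⟨z, hz⟩ => (hx i k hz.2.1.2).2) (fun i k z hz => hz.2.2.1)
    (fun i k z hz => hz.2.2.2)
    (by
      rintro i k k' hkk ⟨z', hz'⟩ z hz
      have h1 := hcol k k' hkk (Fin.ext (hz.2.1.1.trans hz'.2.1.1.symm))
      have h2 := (hx i k hz.2.1.2).1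
      have h3 := (hx i k' hz'.2.1.2).1
      have h4 := hz.2.2.1
      have h5 : ‖g k - g k'‖ ≤ ‖z - x i k'‖ + ‖x i k' - g k'‖ + ‖z - x i k‖ + ‖x i k - g k‖ := by
        calc ‖g k - g k'‖ = ‖(z - x i k') + (x i k' - g k') - (z - x i k) - (x i k - g k)‖ := by
              congr 1; abel
          _ ≤ _ := (norm_sub_le _ _).trans
            (add_le_add_left ((norm_sub_le _ _).trans (add_le_add_left (norm_add_le _ _) _)) _)
      have h6 : (1 + C / c) * r ≤ ‖z - x i k'‖ := by linarith
      have h7 : c * (1 + C / c) = c + C := by field_simp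
      have h8 : 1 ≤ 1 + C / c := by linarith [show 0 < C / c by positivity]
      calc C * r ^ 2 < (c + C) * r ^ 2 := by gcongr; linarith
        _ ≤ (c + C) * (1 + C / c) * r ^ 2 := by
            gcongr; exact le_mul_of_one_le_right (by positivity) h8
        _ = c * ((1 + C / c) * r) ^ 2 := by rw [← h7]; ring
        _ ≤ _ := by gcongr) (G * q)
  refine ⟨⋃ i < G * q, ⋃ k, P i k, hLc, ?_, hLl, ?_⟩
  · simp only [mem_iUnion]
    rintro z ⟨i, -, k, hz⟩
    exact hz.1
  intro γ a b hab hγ ha hb hL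
  obtain ⟨b', hb', hbη, hW'⟩ := exists_first_infDist_eq hab hγ hη.le ha hb
  have hγ' : ContinuousOn γ (Icc a b') := hγ.mono (Icc_subset_Icc_right hb'.2)
  refine le_trans ?_ (eVariationOn.mono γ (Icc_subset_Icc_right hb'.2))
  refine le_trans ?_ (nsmul_le_eVariationOn_of_levels (G := G) (T := fun g => t (g * q))
    (κ := ENNReal.ofReal (r / 4)) hb'.1 (hφ.comp_continuousOn hγ') ?_ ?_ ?_ ?_)
  · rw [← ENNReal.ofReal_nsmul]
    exact ENNReal.ofReal_le_ofReal (by simpa using hGA)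
  · intro i j hij
    simp only [ht_def]
    gcongr
  · simpa [ht_def] using (hφK _ ha).le
  · refine htG.trans ?_
    simp only [hφ_def, Function.comp, hbη]
    linarith [show 0 ≤ c * ‖γ b'‖ ^ 2 by positivity]
  · intro j hj τ τ' h1 h2 h3 h4 h5
    simp only [Function.comp] at h4 h5
    by_contra! hlt
    have hmem : ∀ s ∈ Icc τ τ', s ∈ Icc a b' := fun s hs => ⟨h1.trans hs.1, hs.2.trans h3⟩
    obtain ⟨k, hk, hk'⟩ := exists_crossed_disc (col := col) hφ hc.le hC.le hlow hup hr h2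
      (hγ'.mono hmem) (hg _ (hWR _ (hW' τ (hmem _ (left_mem_Icc.2 h2)))))
      (by rw [h4, h5]; simp only [ht_def, hσ_def]; push_cast; ring) hlt
    have hti : φ (γ τ) + (col k : ℕ) * (2 * C * r ^ 2) = t (j * q + col k) := by
      rw [h4]; simp only [ht_def, hσ_def]; push_cast; ring
    rw [hti] at hk hk'
    obtain ⟨s, hs, hsr, hs0⟩ := hk' _ (hx _ k hk).1 (hx _ k hk).2
    refine hL s ⟨(hmem s hs).1, (hmem s hs).2.trans hb'.2⟩ ?_
    simp only [mem_iUnion]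
    refine ⟨j * q + col k, ?_, k, hW' s (hmem s hs), ⟨?_, hk⟩, hsr, hs0⟩
    · calc j * q + col k < j * q + q := by have := (col k).2; lia
        _ = (j + 1) * q := by ring
        _ ≤ G * q := Nat.mul_le_mul_right _ hj
    · rw [Nat.mul_add_mod_self_right, Nat.mod_eq_of_lt (col k).2]

/-- A nonempty open convex set has an exhaustion by compact convex sets, each of which contains a
uniform neighbourhood of the preceding one. -/
theorem exists_compact_convex_exhaustion {E : Type*} [NormedAddCommGroup E] [NormedSpace ℝ E]
    [ProperSpace E] {D : Set E} (hDo : IsOpen D) (hDc : Convex ℝ D) (hDne : D.Nonempty) :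
    ∃ (K : ℕ → Set E) (η : ℕ → ℝ), (∀ j, IsCompact (K j)) ∧ (∀ j, (K j).Nonempty) ∧
      (∀ j, Convex ℝ (K j)) ∧ (∀ j, K j ⊆ D) ∧ (∀ j, 0 < η j) ∧
      (∀ j z, infDist z (K j) ≤ η j → z ∈ K (j + 1)) ∧ ∀ z ∈ D, ∃ j, K j ∈ nhds z := by
  obtain ⟨x, hx⟩ := hDne
  obtain ⟨δ, hδ, hδD⟩ := Metric.isOpen_iff.1 hDo x hx
  set K : ℕ → Set E := fun j => closedBall x j ∩ {z | ∀ w ∉ D, δ / (j + 1) ≤ dist z w} with hK_def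
  have hKc : ∀ j, IsCompact (K j) := fun j => by
    refine (isCompact_closedBall x _).inter_right ?_
    simp only [ofPred_forall]
    exact isClosed_iInter fun w => isClosed_iInter fun _ =>
      isClosed_le continuous_const (continuous_id.dist continuous_const)
  have hKne : ∀ j, (K j).Nonempty := fun j => by
    refine ⟨x, mem_closedBall_self (by positivity), fun w hw => ?_⟩
    by_contra! hlt
    refine hw (hδD (mem_ball'.2 (hlt.trans_le (div_le_self hδ.le ?_))))
    linarith [show (0 : ℝ) ≤ j by positivity]
  refine ⟨K, fun j => min 1 (δ / (j + 1) - δ / (j + 2)), hKc, hKne, fun j => ?_, fun j z hz => ?_,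
    fun j => ?_, fun j z hz => ?_, fun z hz => ?_⟩
  · refine (convex_closedBall x _).inter fun y hy z hz a b ha hb hab => ?_
    intro w hw
    by_contra! hlt
    rw [dist_eq_norm'] at hlt
    set v := w - (a • y + b • z) with hv
    have key : ∀ y, (∀ w ∉ D, δ / (j + 1) ≤ dist y w) → y + v ∈ D := fun y hy => by
      by_contra hyD
      have := hy _ hyD
      rw [dist_self_add_right] at this
      linarith
    refine hw ?_
    have h1 := hDc (key y hy) (key z hz) ha hb hab
    have h2 : a • (y + v) + b • (z + v) = w := by
      rw [smul_add, smul_add, add_add_add_comm, ← add_smul, hab, one_smul, hv]; abel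
    rwa [h2] at h1
  · by_contra hzD
    have := hz.2 z hzD
    rw [dist_self] at this
    exact absurd this (not_le.2 (by positivity))
  · refine lt_min one_pos (sub_pos.2 ?_)
    gcongr
    norm_num
  · obtain ⟨y, hy, hyz⟩ := (hKc j).exists_infDist_eq_dist (hKne j) z
    rw [hyz, le_min_iff] at hz
    refine ⟨?_, fun w hw => ?_⟩
    · rw [mem_closedBall]
      have := mem_closedBall.1 hy.1
      push_cast
      linarith [dist_triangle z y x]
    · have := hy.2 w hw
      have h2 : ((j + 1 : ℕ) : ℝ) + 1 = j + 2 := by push_cast; ring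
      rw [h2]
      linarith [dist_triangle y z w, dist_comm y z]
  · obtain ⟨ρ, hρ, hρD⟩ := Metric.isOpen_iff.1 hDo z hz
    obtain ⟨j, hj⟩ := exists_nat_ge (max (dist z x + ρ) (δ / (ρ / 2)))
    refine ⟨j, Filter.mem_of_superset (ball_mem_nhds z (half_pos hρ)) fun y hy => ⟨?_, ?_⟩⟩
    · rw [mem_closedBall]
      rw [mem_ball] at hy
      linarith [dist_triangle y z x, (le_max_left _ _).trans hj]
    · intro w hw
      have h1 : ρ ≤ dist z w := by
        by_contra! hlt
        exact hw (hρD (mem_ball'.2 hlt))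
      have h2 := (le_max_right _ _).trans hj
      rw [div_le_iff₀ (half_pos hρ)] at h2
      have h3 : δ / (j + 1) ≤ ρ / 2 := by
        rw [div_le_iff₀ (by positivity)]
        linarith
      rw [mem_ball'] at hy
      linarith [dist_triangle z y w]

/-- Successive corrections of entire functions, small on `K j`, with large real part on `L j`. -/
theorem exists_seq_of_liftable {E : Type*} [NormedAddCommGroup E] [NormedSpace ℂ E]
    {K L : ℕ → Set E} (hL : ∀ j, IsCompact (L j)) (h : ∀ j, Liftable (K j) (L j)) :
    ∃ F : ℕ → E → ℂ, (∀ j, Differentiable ℂ (F j)) ∧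
      (∀ j, ∀ z ∈ K j, ‖F (j + 1) z - F j z‖ ≤ (1 / 2) ^ j) ∧
      ∀ j, ∀ z ∈ L j, (j + 2 : ℝ) < (F (j + 1) z).re := by
  have step : ∀ (j : ℕ) (f : {f : E → ℂ // Differentiable ℂ f}),
      ∃ f' : {f : E → ℂ // Differentiable ℂ f},
        (∀ z ∈ K j, ‖f'.1 z - f.1 z‖ ≤ (1 / 2) ^ j) ∧ ∀ z ∈ L j, (j + 2 : ℝ) < (f'.1 z).re := by
    rintro j ⟨f, hf⟩
    obtain ⟨B, hB⟩ := (hL j).exists_bound_of_continuousOn hf.continuous.continuousOn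
    obtain ⟨g, hg, hgK, hgL⟩ := h j ((1 / 2) ^ j) (by positivity) (j + 2 + B)
    refine ⟨⟨fun z => f z + g z, hf.add hg⟩, fun z hz => ?_, fun z hz => ?_⟩
    · simpa using (hgK z hz).le
    · have h1 := hgL z hz
      have h2 := (Complex.abs_re_le_norm (f z)).trans (hB z hz)
      simp only [Complex.add_re]
      linarith [neg_abs_le (f z).re]
  choose S hS1 hS2 using step
  exact ⟨fun j => (Nat.rec ⟨fun _ => 0, differentiable_const _⟩ S j :
      {f : E → ℂ // Differentiable ℂ f}).1, fun j => Subtype.prop _, fun j => hS1 j _,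
    fun j => hS2 j _⟩

/-- A sequence of entire functions with geometrically decaying differences on the members of an
exhaustion converges to a holomorphic function. -/
theorem exists_limit_of_geometric {E : Type*} [NormedAddCommGroup E] [NormedSpace ℂ E]
    {D : Set E} {K : ℕ → Set E} (hK : Monotone K) (hKD : ∀ z ∈ D, ∃ j, K j ∈ nhds z)
    {F : ℕ → E → ℂ} (hF : ∀ j, Differentiable ℂ (F j))
    (hFK : ∀ j, ∀ z ∈ K j, ‖F (j + 1) z - F j z‖ ≤ (1 / 2) ^ j) :
    ∃ f : E → ℂ, DifferentiableOn ℂ f D ∧ ∀ j, ∀ z ∈ K j, ‖f z - F j z‖ ≤ 2 * (1 / 2) ^ j := by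
  have hgeom : ∀ j, HasSum (fun m : ℕ => (1 / 2 : ℝ) ^ (m + j)) (2 * (1 / 2) ^ j) := fun j => by
    simpa only [pow_add] using hasSum_geometric_two.mul_right ((1 / 2 : ℝ) ^ j)
  have hbd : ∀ j, ∀ z ∈ K j, ∀ m, ‖F (m + j + 1) z - F (m + j) z‖ ≤ (1 / 2) ^ (m + j) :=
    fun j z hz m => hFK _ z (hK (Nat.le_add_left _ _) hz)
  have hsum : ∀ j, ∀ z ∈ K j, Summable fun m => F (m + j + 1) z - F (m + j) z :=
    fun j z hz => Summable.of_norm_bounded (hgeom j).summable (hbd j z hz)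
  have hsplit : ∀ j, ∀ z ∈ K j, F 0 z + ∑' m, (F (m + 1) z - F m z) =
      F j z + ∑' m, (F (m + j + 1) z - F (m + j) z) := by
    intro j z hz
    have h1 : Summable fun m => F (m + 1) z - F m z := (summable_nat_add_iff j).1 (hsum j z hz)
    rw [← h1.sum_add_tsum_nat_add j, Finset.sum_range_sub (fun m => F m z)]
    ring
  refine ⟨fun z => F 0 z + ∑' m, (F (m + 1) z - F m z), fun z hz => ?_, fun j z hz => ?_⟩
  · obtain ⟨j, hj⟩ := hKD z hz
    obtain ⟨ρ, hρ, hρK⟩ := Metric.mem_nhds_iff.1 hj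
    have hder : ∀ m, ∀ y ∈ ball z (ρ / 2),
        ‖fderiv ℂ (fun y => F (m + j + 1) y - F (m + j) y) y‖ ≤
          (1 / 2) ^ (m + j) * (2 / (ρ / 2)) := by
      intro m y hy
      rw [mul_div_assoc', mul_comm _ (2 : ℝ)]
      have hball : ∀ w ∈ ball y (ρ / 2), w ∈ K j := fun w hw => hρK (by
        rw [mem_ball] at *
        linarith [dist_triangle w y z])
      refine Complex.norm_fderiv_le_div_of_mapsTo_ball
        ((hF _).sub (hF _)).differentiableOn (fun w hw => ?_) (half_pos hρ)
      rw [mem_closedBall, dist_eq_norm]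
      have h1 := hbd j w (hball w hw) m
      have h2 := hbd j y (hball y (mem_ball_self (half_pos hρ))) m
      linarith [norm_sub_le (F (m + j + 1) w - F (m + j) w) (F (m + j + 1) y - F (m + j) y)]
    have hzK : z ∈ K j := mem_of_mem_nhds hj
    have hd := hasFDerivAt_tsum_of_isPreconnected
      ((hgeom j).summable.mul_right (2 / (ρ / 2))) isOpen_ball
      (isPreconnected_ball : IsPreconnected (ball z (ρ / 2)))
      (fun m y _ => (((hF (m + j + 1)).sub (hF (m + j))) y).hasFDerivAt) hder
      (mem_ball_self (half_pos hρ)) (hsum j z hzK) (mem_ball_self (half_pos hρ))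
    have hd' := ((hF j z).add hd.differentiableAt)
    refine (hd'.congr_of_eventuallyEq ?_).differentiableWithinAt
    filter_upwards [hj] with y hy
    exact hsplit j y hy
  · simp only [hsplit j z hz, add_sub_cancel_left]
    exact tsum_of_norm_bounded (hgeom j) (hbd j z hz)

/-- Globevnik: on every nonempty open convex domain `D ⊆ ℂⁿ` (`n ≥ 2`) there is a holomorphic
function whose real part is unbounded above on every divergent path of finite length. -/
theorem globevnik_unbounded_real_part (n : ℕ) (hn : 2 ≤ n)
    (D : Set (EuclideanSpace ℂ (Fin n))) (hDo : IsOpen D) (hDc : Convex ℝ D)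
    (hDne : D.Nonempty) :
    ∃ f : EuclideanSpace ℂ (Fin n) → ℂ,
      DifferentiableOn ℂ f D ∧
      ∀ γ : ℝ → EuclideanSpace ℂ (Fin n), DivergentPathIn D γ →
        eVariationOn γ (Set.Ico 0 1) ≠ ⊤ →
        ∀ M : ℝ, ∃ t ∈ Set.Ico (0 : ℝ) 1, M < (f (γ t)).re := by
  obtain ⟨K, η, hKc, hKne, hKconv, hKD, hη, hKη, hKnhds⟩ :=
    exists_compact_convex_exhaustion hDo hDc hDne
  have hmono : Monotone K := monotone_nat_of_le_succ fun j z hz =>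
    hKη j z (by simpa [infDist_zero_of_mem hz] using (hη j).le)
  choose L hLc hLη hLl hLlong using fun j : ℕ =>
    exists_labyrinth (hKc j) (hKne j) (hKconv j) (hη j) (A := j) (by positivity)
  obtain ⟨F, hF, hFK, hFL⟩ := exists_seq_of_liftable hLc hLl
  obtain ⟨f, hf, hfF⟩ := exists_limit_of_geometric hmono hKnhds hF hFK
  refine ⟨f, hf, fun γ ⟨hγc, hγD, hγdiv⟩ hfin M => ?_⟩
  by_contra! hM
  have h0 : (0 : ℝ) ∈ Ico (0 : ℝ) 1 := ⟨le_rfl, one_pos⟩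
  obtain ⟨j₀, hj₀⟩ := hKnhds _ (hγD 0 h0)
  obtain ⟨j₁, hj₁⟩ := exists_nat_ge (max M ((eVariationOn γ (Ico 0 1)).toReal + 1))
  set j := max j₀ j₁ with hj_def
  have hj : (j₁ : ℝ) ≤ j := by exact_mod_cast le_max_right _ _
  have hMj : M ≤ j := (le_max_left _ _).trans (hj₁.trans hj)
  have hVj : (eVariationOn γ (Ico 0 1)).toReal + 1 ≤ j := (le_max_right _ _).trans (hj₁.trans hj)
  obtain ⟨t, ht, htK⟩ := hγdiv (K (j + 1)) (hKD _) (hKc _)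
  have hsub : Icc 0 t ⊆ Ico (0 : ℝ) 1 := fun s hs => ⟨hs.1, hs.2.trans_lt ht.2⟩
  have hlong := hLlong j γ 0 t ht.1 (hγc.mono hsub)
    (hmono (le_max_left _ _) (mem_of_mem_nhds hj₀))
    (not_le.1 fun hle => htK t ⟨le_rfl, ht.2⟩ (hKη j _ hle)).le (fun s hs hsL => by
      have h1 := hFL j _ hsL
      have h2 := (Complex.abs_re_le_norm _).trans (hfF (j + 1) _ (hKη j _ (hLη j _ hsL)))
      have h3 : (1 / 2 : ℝ) ^ (j + 1) ≤ 1 := pow_le_one₀ (by norm_num) (by norm_num)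
      rw [Complex.sub_re] at h2
      linarith [hM s (hsub hs), neg_abs_le ((f (γ s)).re - (F (j + 1) (γ s)).re)])
  have h4 := ENNReal.toReal_mono hfin (hlong.trans (eVariationOn.mono γ hsub))
  rw [ENNReal.toReal_ofReal (by positivity)] at h4
  linarith
end
end

section
/- Let n ≥ 2. There exist a holomorphic function f : 𝔹ₙ → ℂ and a value c ∈ ℂ such that the level set f⁻¹(c) ⊆ 𝔹ₙ is nonempty, the derivative Df(z) is nonzero at every point z ∈ f⁻¹(c), and f⁻¹(c) is complete: every divergent path γ : [0,1) → 𝔹ₙ with f(γ(t)) = c for all t ∈ [0,1) has infinite length. (Globevnik: existence of a complete properly embedded complex hypersurface in the ball, realized as a smooth level set of a holomorphic function.) -/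
open Set Metric
open scoped ENNReal

noncomputable section

open Filter Topology

/-- **Weierstrass' theorem** in several complex variables, for one derivative: locally uniform
convergence of entire functions passes to the derivatives. -/
theorem differentiableOn_and_tendstoUniformlyOn_fderiv {E F : Type*}
    [NormedAddCommGroup E] [NormedSpace ℂ E] [NormedAddCommGroup F] [NormedSpace ℂ F]
    [CompleteSpace F] {S : ℕ → E → F} {f : E → F} {U : Set E}
    (hS : ∀ N, Differentiable ℂ (S N))
    (hf : ∀ z ∈ U, ∃ R > 0, TendstoUniformlyOn S f atTop (ball z R)) :
    DifferentiableOn ℂ f U ∧ ∀ z ∈ U, ∃ R > 0,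
      TendstoUniformlyOn (fun N => fderiv ℂ (S N)) (fderiv ℂ f) atTop (ball z R) := by
  have key : ∀ z ∈ U, ∃ R > 0, DifferentiableAt ℂ f z ∧
      TendstoUniformlyOn (fun N => fderiv ℂ (S N)) (fderiv ℂ f) atTop (ball z R) := by
    intro z hz
    obtain ⟨R', hR', hu⟩ := hf z hz
    obtain ⟨R, rfl⟩ : ∃ R, R' = 2 * R := ⟨R' / 2, by ring⟩
    have hR : 0 < R := by linarith
    have hcauchy : UniformCauchySeqOn (fun N => fderiv ℂ (S N)) atTop (ball z R) := by
      rw [Metric.uniformCauchySeqOn_iff]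
      intro ε hε
      obtain ⟨N, hN⟩ := Metric.uniformCauchySeqOn_iff.1 hu.uniformCauchySeqOn
        (ε * R / 4) (by positivity)
      refine ⟨N, fun m hm k hk w hw => ?_⟩
      have hsub : ball w R ⊆ ball z (2 * R) := by
        apply ball_subset_ball'
        have := mem_ball.1 hw
        linarith
      have h1 : ∀ x ∈ ball w R, ‖(S m - S k) x‖ ≤ ε * R / 4 := fun x hx => by
        have := hN m hm k hk x (hsub hx)
        rw [dist_eq_norm] at this
        exact this.le
      have h2 : ‖fderiv ℂ (S m - S k) w‖ ≤ (ε * R / 2) / R := by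
        refine Complex.norm_fderiv_le_div_of_mapsTo_ball
          ((hS m).sub (hS k)).differentiableOn (fun x hx => ?_) hR
        rw [mem_closedBall, dist_eq_norm]
        have h3 := h1 x hx
        have h4 := h1 w (mem_ball_self hR)
        have h5 := norm_sub_le ((S m - S k) x) ((S m - S k) w)
        linarith
      rw [fderiv_sub (hS m w) (hS k w)] at h2
      rw [dist_eq_norm]
      refine h2.trans_lt ?_
      rw [div_lt_iff₀ hR]
      nlinarith
    have hlim : ∀ w, ∃ G, w ∈ ball z R → Tendsto (fun N => fderiv ℂ (S N) w) atTop (𝓝 G) := by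
      intro w
      by_cases hw : w ∈ ball z R
      · obtain ⟨G, hG⟩ := cauchySeq_tendsto_of_complete (hcauchy.cauchySeq hw)
        exact ⟨G, fun _ => hG⟩
      · exact ⟨0, fun h => absurd h hw⟩
    choose G hG using hlim
    have hGu := hcauchy.tendstoUniformlyOn_of_tendsto hG
    have hRR : ball z R ⊆ ball z (2 * R) := ball_subset_ball (by linarith)
    have hd : ∀ w ∈ ball z R, HasFDerivAt f (G w) w := fun w hw =>
      hasFDerivAt_of_tendstoUniformlyOn isOpen_ball hGu
        (fun N x _ => (hS N x).hasFDerivAt)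
        (fun x hx => hu.tendsto_at (hRR hx)) hw
    exact ⟨R, hR, (hd z (mem_ball_self hR)).differentiableAt,
      hGu.congr_right fun w hw => (hd w hw).fderiv.symm⟩
  refine ⟨fun z hz => ?_, fun z hz => ?_⟩
  · obtain ⟨R, hR, hd, -⟩ := key z hz
    exact hd.differentiableWithinAt
  · obtain ⟨R, hR, -, ht⟩ := key z hz
    exact ⟨R, hR, ht⟩

/-- A locally uniform limit of entire functions is smooth. -/
theorem contDiffOn_of_tendstoUniformlyOn_ball {E F : Type}
    [NormedAddCommGroup E] [NormedSpace ℂ E] [NormedAddCommGroup F] [NormedSpace ℂ F]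
    [CompleteSpace F] {S : ℕ → E → F} {f : E → F} {U : Set E} (hU : IsOpen U) (n : ℕ)
    (hS : ∀ N, ContDiff ℂ (n + 1) (S N))
    (hf : ∀ z ∈ U, ∃ R > 0, TendstoUniformlyOn S f atTop (ball z R)) :
    ContDiffOn ℂ n f U := by
  induction n generalizing F with
  | zero =>
    have h := differentiableOn_and_tendstoUniformlyOn_fderiv
      (fun N => (hS N).differentiable (by simp)) hf
    exact contDiffOn_zero.2 h.1.continuousOn
  | succ n ih =>
    have h := differentiableOn_and_tendstoUniformlyOn_fderiv
      (fun N => (hS N).differentiable (by simp)) hf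
    push_cast
    rw [contDiffOn_succ_iff_fderiv_of_isOpen hU]
    refine ⟨h.1, by simp, ih (fun N => ?_) h.2⟩
    have := hS N
    push_cast at this
    exact (contDiff_succ_iff_fderiv.1 this).2.2

/-- A geometrically convergent sequence of entire functions on an exhaustion of the unit ball
by smaller balls has a smooth limit, with an explicit error bound. -/
theorem exists_limit_of_norm_sub_le {E : Type} [NormedAddCommGroup E] [NormedSpace ℂ E]
    {r : ℕ → ℝ} (hr : Monotone r) (hr1 : ∀ x < 1, ∃ l, x < r l)
    {S : ℕ → E → ℂ} (hS : ∀ N, ContDiff ℂ 3 (S N))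
    (hbd : ∀ l, ∀ z ∈ closedBall (0 : E) (r l), ‖S (l + 1) z - S l z‖ ≤ 1 / 2 / 2 ^ l) :
    ∃ f : E → ℂ, ContDiffOn ℂ 2 f (ball 0 1) ∧
      ∀ l, ∀ z ∈ closedBall (0 : E) (r l), ‖f z - S l z‖ ≤ 1 / 2 ^ l := by
  have hstep : ∀ l, ∀ z ∈ closedBall (0 : E) (r l), ∀ k,
      dist (S (l + k) z) (S (l + (k + 1)) z) ≤ (1 / 2 ^ l) / 2 / 2 ^ k := by
    intro l z hz k
    have := hbd (l + k) z (closedBall_subset_closedBall (hr (by omega)) hz)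
    rw [dist_comm, dist_eq_norm]
    refine this.trans_eq ?_
    rw [pow_add]
    field_simp
  have hlim : ∀ z, ∃ y, ∀ l, z ∈ closedBall (0 : E) (r l) →
      Tendsto (fun N => S N z) atTop (𝓝 y) := by
    intro z
    by_cases h : ∃ l, z ∈ closedBall (0 : E) (r l)
    · obtain ⟨l, hl⟩ := h
      obtain ⟨y, hy⟩ := cauchySeq_tendsto_of_complete
        (cauchySeq_of_le_geometric_two (hstep l z hl))
      refine ⟨y, fun _ _ => ?_⟩
      rw [← tendsto_add_atTop_iff_nat l]
      simpa only [add_comm] using hy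
    · exact ⟨0, fun l hl => absurd ⟨l, hl⟩ h⟩
  choose f hf using hlim
  have herr : ∀ l, ∀ z ∈ closedBall (0 : E) (r l), ‖f z - S l z‖ ≤ 1 / 2 ^ l := by
    intro l z hz
    rw [← dist_eq_norm, dist_comm]
    refine dist_le_of_le_geometric_two_of_tendsto₀ (hstep l z hz) ?_
    have := (tendsto_add_atTop_iff_nat l).2 (hf z l hz)
    simpa only [add_comm] using this
  refine ⟨f, ?_, herr⟩
  refine contDiffOn_of_tendstoUniformlyOn_ball isOpen_ball 2 (fun N => ?_) ?_
    (S := S)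
  · convert hS N using 1
    norm_num
  intro z hz
  rw [mem_ball_zero_iff] at hz
  obtain ⟨l, hl⟩ := hr1 _ hz
  have hsub : ball z (r l - ‖z‖) ⊆ ball 0 (r l) := ball_subset_ball' (by simp)
  refine ⟨r l - ‖z‖, sub_pos.2 hl, ?_⟩
  rw [Metric.tendstoUniformlyOn_iff]
  intro ε hε
  obtain ⟨m, hm⟩ := exists_pow_lt_of_lt_one hε (by norm_num : (1 / 2 : ℝ) < 1)
  filter_upwards [eventually_ge_atTop (max l m)] with N hN w hw
  rw [dist_eq_norm]
  refine (herr N w (closedBall_subset_closedBall (hr (le_of_max_le_left hN))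
    (ball_subset_closedBall (hsub hw)))).trans_lt (lt_of_le_of_lt ?_ hm)
  rw [one_div_pow]
  exact one_div_le_one_div_of_le (by positivity)
    (pow_le_pow_right₀ (by norm_num) (le_of_max_le_right hN))

/-- The slice of the closed ball of radius `R` by the real hyperplane `re ⟪p, z⟫ = s`. -/
def slice {E : Type*} [NormedAddCommGroup E] [InnerProductSpace ℂ E] (p : E) (s R : ℝ) : Set E :=
  {z | (inner ℂ p z).re = s ∧ ‖z‖ ≤ R}

theorem isCompact_slice {E : Type*} [NormedAddCommGroup E] [InnerProductSpace ℂ E]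
    [FiniteDimensional ℂ E] (p : E) (s R : ℝ) : IsCompact (slice p s R) := by
  have : ProperSpace E := FiniteDimensional.proper ℂ E
  have h : slice p s R = {z | (inner ℂ p z).re = s} ∩ closedBall 0 R := by
    ext z
    simp [slice]
  rw [h]
  refine (isCompact_closedBall _ _).inter_left (isClosed_eq ?_ continuous_const)
  fun_prop

/-- There is an entire function that is small on a given compact subset of an open real
half-space and has large constant modulus on the boundary hyperplane. -/
theorem exists_small_on_compact_large_on_hyperplane {E : Type*} [NormedAddCommGroup E]
    [InnerProductSpace ℂ E] {X : Set E} (hX : IsCompact X) {p : E} {s : ℝ}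
    (hs : ∀ z ∈ X, (inner ℂ p z).re < s) {C ε : ℝ} (hC : 0 < C) (hε : 0 < ε) :
    ∃ h : E → ℂ, ContDiff ℂ 3 h ∧ (∀ z ∈ X, ‖h z‖ ≤ ε) ∧
      ∀ z, (inner ℂ p z).re = s → ‖h z‖ = C := by
  obtain ⟨d, hd, hXd⟩ : ∃ d < s, ∀ z ∈ X, (inner ℂ p z).re ≤ d := by
    rcases X.eq_empty_or_nonempty with rfl | hne
    · exact ⟨s - 1, by linarith, by simp⟩
    · obtain ⟨x, hx, hmax⟩ := hX.exists_isMaxOn hne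
        (f := fun z => (inner ℂ p z).re) (by fun_prop)
      exact ⟨_, hs x hx, fun z hz => hmax hz⟩
  obtain ⟨N, hN⟩ : ∃ N : ℕ, C * Real.exp (d - s) ^ N < ε := by
    obtain ⟨N, hN⟩ := exists_pow_lt_of_lt_one (div_pos hε hC)
      (Real.exp_lt_one_iff.2 (sub_neg.2 hd))
    exact ⟨N, by rwa [lt_div_iff₀' hC] at hN⟩
  have hnorm : ∀ z : E, ‖(C : ℂ) * Complex.exp (N * (innerSL ℂ p z - s))‖ =
      C * Real.exp ((inner ℂ p z).re - s) ^ N := by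
    intro z
    rw [norm_mul, Complex.norm_exp, Complex.norm_real, Real.norm_of_nonneg hC.le,
      ← Real.exp_nat_mul]
    simp
  refine ⟨fun z => C * Complex.exp (N * (innerSL ℂ p z - s)), ?_, fun z hz => ?_, fun z hz => ?_⟩
  · fun_prop
  · rw [hnorm]
    refine le_trans ?_ hN.le
    have := hXd z hz
    gcongr
  · rw [hnorm, hz]
    simp

/-- Given finitely many slices, each strictly on one side of the hyperplane of every other, and a
smaller ball, any continuous function can be made large on all the slices by adding
an entire function that is small on the ball. -/
theorem exists_small_on_closedBall_large_on_slices {E : Type*} [NormedAddCommGroup E]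
    [InnerProductSpace ℂ E] [FiniteDimensional ℂ E] {r s R : ℝ} (hrs : r < s) (P : Finset E)
    (hP : ∀ p ∈ P, ‖p‖ = 1)
    (hsep : ∀ p ∈ P, ∀ q ∈ P, p ≠ q → ∀ z ∈ slice q s R, (inner ℂ p z).re < s)
    {φ : E → ℂ} (hφ : Continuous φ) (M : ℝ) {ε : ℝ} (hε : 0 < ε) :
    ∃ g : E → ℂ, ContDiff ℂ 3 g ∧ (∀ z ∈ closedBall (0 : E) r, ‖g z‖ ≤ ε) ∧
      ∀ p ∈ P, ∀ z ∈ slice p s R, M ≤ ‖φ z + g z‖ := by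
  classical
  have : ProperSpace E := FiniteDimensional.proper ℂ E
  induction P using Finset.induction_on generalizing M ε with
  | empty => exact ⟨fun _ => 0, contDiff_const, by simp [hε.le], by simp⟩
  | insert p P hpP ih =>
    obtain ⟨g, hg, hgε, hgM⟩ := ih (fun q hq => hP q (Finset.mem_insert_of_mem hq))
      (fun q hq q' hq' => hsep q (Finset.mem_insert_of_mem hq) q' (Finset.mem_insert_of_mem hq'))
      (M + 1) (half_pos hε)
    obtain ⟨B, hB⟩ := (isCompact_slice p s R).exists_bound_of_continuousOn
      (hφ.add hg.continuous).continuousOn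
    have hX : IsCompact (closedBall (0 : E) r ∪ ⋃ q ∈ P, slice q s R) :=
      (isCompact_closedBall _ _).union
        (P.isCompact_biUnion fun q _ => isCompact_slice q s R)
    obtain ⟨h, hh, hhX, hhp⟩ := exists_small_on_compact_large_on_hyperplane hX (p := p) (s := s)
      (C := max 1 (M + B)) (ε := min (ε / 2) 1) (by
        rintro z (hz | hz)
        · calc (inner ℂ p z).re ≤ ‖inner ℂ p z‖ := Complex.re_le_norm _
            _ ≤ ‖p‖ * ‖z‖ := norm_inner_le_norm _ _
            _ ≤ r := by rw [hP p (Finset.mem_insert_self _ _), one_mul]; simpa using hz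
            _ < s := hrs
        · simp only [mem_iUnion] at hz
          obtain ⟨q, hq, hz⟩ := hz
          exact hsep p (Finset.mem_insert_self _ _) q (Finset.mem_insert_of_mem hq)
            (fun h => hpP (h ▸ hq)) z hz)
      (by positivity) (by positivity)
    refine ⟨fun z => g z + h z, hg.add hh, fun z hz => ?_, fun q hq z hz => ?_⟩
    · have h1 := hgε z hz
      have h2 := (hhX z (Or.inl hz)).trans (min_le_left _ _)
      linarith [norm_add_le (g z) (h z)]
    · rw [← add_assoc]
      rcases Finset.mem_insert.1 hq with rfl | hq
      · have h1 := hB z hz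
        have h2 := hhp z hz.1
        have h3 := le_max_right 1 (M + B)
        have h4 := norm_sub_le (φ z + g z + h z) (φ z + g z)
        rw [add_sub_cancel_left] at h4
        simp only [Pi.add_apply] at h1
        linarith
      · have h1 := hgM q hq z hz
        have h2 := (hhX z (Or.inr (mem_iUnion₂.2 ⟨q, hq, hz⟩))).trans (min_le_right _ _)
        have h4 := norm_sub_le (φ z + g z + h z) (h z)
        rw [add_sub_cancel_right] at h4
        linarith

/-- There is a holomorphic function on the unit ball whose modulus tends to infinity along a
given sequence of layers of slices. -/
theorem exists_contDiffOn_large_on_slices {E : Type} [NormedAddCommGroup E]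
    [InnerProductSpace ℂ E] [FiniteDimensional ℂ E] {r s : ℕ → ℝ} (hr : Monotone r)
    (hr1 : ∀ x < 1, ∃ l, x < r l) (hrs : ∀ l, r l < s l) (P : ℕ → Finset E)
    (hP : ∀ l, ∀ p ∈ P l, ‖p‖ = 1)
    (hsep : ∀ l, ∀ p ∈ P l, ∀ q ∈ P l, p ≠ q →
      ∀ z ∈ slice q (s l) (r (l + 1)), (inner ℂ p z).re < s l) :
    ∃ f : E → ℂ, ContDiffOn ℂ 2 f (ball 0 1) ∧
      ∀ l : ℕ, ∀ p ∈ P l, ∀ z ∈ slice p (s l) (r (l + 1)), (l : ℝ) ≤ ‖f z‖ := by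
  have hstep : ∀ (l : ℕ) (φ : {φ : E → ℂ // ContDiff ℂ 3 φ}), ∃ ψ : {φ : E → ℂ // ContDiff ℂ 3 φ},
      (∀ z ∈ closedBall (0 : E) (r l), ‖ψ.1 z - φ.1 z‖ ≤ 1 / 2 / 2 ^ l) ∧
      ∀ p ∈ P l, ∀ z ∈ slice p (s l) (r (l + 1)), (l + 1 : ℝ) ≤ ‖ψ.1 z‖ := by
    rintro l ⟨φ, hφ⟩
    obtain ⟨g, hg, hgε, hgM⟩ := exists_small_on_closedBall_large_on_slices (hrs l) (P l) (hP l)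
      (hsep l) hφ.continuous (l + 1) (show (0 : ℝ) < 1 / 2 / 2 ^ l by positivity)
    exact ⟨⟨fun z => φ z + g z, hφ.add hg⟩, by simpa using hgε, hgM⟩
  choose ψ hψ hψM using hstep
  let S : ℕ → {φ : E → ℂ // ContDiff ℂ 3 φ} := fun l =>
    Nat.rec ⟨fun _ => 0, contDiff_const⟩ ψ l
  obtain ⟨f, hf, hfS⟩ := exists_limit_of_norm_sub_le hr hr1 (S := fun l => (S l).1)
    (fun l => (S l).2) (fun l => hψ l (S l))
  refine ⟨f, hf, fun l p hp z hz => ?_⟩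
  have h1 : (l + 1 : ℝ) ≤ ‖(S (l + 1)).1 z‖ := hψM l (S l) p hp z hz
  have h2 := hfS (l + 1) z (by simpa using hz.2)
  have h3 : (1 : ℝ) / 2 ^ (l + 1) ≤ 1 := by
    rw [div_le_one (by positivity)]
    exact one_le_pow₀ (by norm_num)
  have h4 := norm_sub_norm_le ((S (l + 1)).1 z) (f z)
  rw [norm_sub_rev] at h4
  linarith

/-- **Sard's lemma for affine perturbations**: a holomorphic function on the ball has a small linear
perturbation with a nonempty regular level set. -/
theorem exists_regular_level_of_linear_perturbation {E : Type} [NormedAddCommGroup E]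
    [NormedSpace ℂ E] [FiniteDimensional ℂ E] [Nontrivial E] {f : E → ℂ}
    (hf : ContDiffOn ℂ 2 f (ball 0 1)) :
    ∃ (a : E →L[ℂ] ℂ) (c : ℂ), ‖a‖ < 1 ∧ (∃ z ∈ ball (0 : E) 1, f z - a z = c) ∧
      ∀ z ∈ ball (0 : E) 1, f z - a z = c → fderiv ℂ f z ≠ a := by
  have h0 : ball (0 : E) 1 ∈ 𝓝 0 := ball_mem_nhds _ one_pos
  obtain ⟨a₀, ha₀, ha₀f⟩ : ∃ a₀ : E →L[ℂ] ℂ, ‖a₀‖ < 1 ∧ fderiv ℂ f 0 ≠ a₀ := by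
    by_cases h : fderiv ℂ f 0 = 0
    · obtain ⟨x, hx⟩ := exists_ne (0 : E)
      obtain ⟨g, hg, -⟩ := exists_dual_vector ℂ x (norm_ne_zero_iff.2 hx)
      refine ⟨(1 / 2 : ℂ) • g, ?_, ?_⟩
      · rw [norm_smul, hg]
        norm_num
      · rw [h]
        intro h'
        have := congrArg norm h'
        rw [norm_smul, hg] at this
        norm_num at this
    · exact ⟨0, by simp, h⟩
  have hfd : HasStrictFDerivAt f (fderiv ℂ f 0) 0 :=
    (hf.contDiffAt h0).hasStrictFDerivAt (by norm_num)
  let Φ : E × (E →L[ℂ] ℂ) → (E →L[ℂ] ℂ) × ℂ := fun x => (x.2, f x.1 - x.2 x.1)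
  have hΦ : map Φ (𝓝 (0, a₀)) = 𝓝 (a₀, f 0) := by
    have h1 : HasStrictFDerivAt (fun x : E × (E →L[ℂ] ℂ) => f x.1)
        ((fderiv ℂ f 0).comp (ContinuousLinearMap.fst ℂ E (E →L[ℂ] ℂ))) (0, a₀) :=
      HasStrictFDerivAt.comp (0, a₀) (g := f) hfd hasStrictFDerivAt_fst
    have h2 : HasStrictFDerivAt (fun x : E × (E →L[ℂ] ℂ) => x.2 x.1) _ (0, a₀) :=
      hasStrictFDerivAt_snd.clm_apply hasStrictFDerivAt_fst
    have h3 := (hasStrictFDerivAt_snd (𝕜 := ℂ) (E := E) (F := E →L[ℂ] ℂ)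
      (p := (0, a₀))).prodMk (h1.sub h2)
    have h4 := h3.map_nhds_eq_of_surj (by
      rw [LinearMap.range_eq_top]
      rintro ⟨b, y⟩
      obtain ⟨w, hw⟩ : ∃ w, (fderiv ℂ f 0 - a₀) w ≠ 0 := by
        by_contra! h
        exact ha₀f (sub_eq_zero.1 (ContinuousLinearMap.ext h))
      refine ⟨((y / (fderiv ℂ f 0 - a₀) w) • w, b), ?_⟩
      have : (y / (fderiv ℂ f 0 - a₀) w) * (fderiv ℂ f 0 - a₀) w = y := div_mul_cancel₀ _ hw
      simpa [mul_sub] using this)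
    simpa [Φ] using h4
  let Ψ : E → (E →L[ℂ] ℂ) × ℂ := fun z => (fderiv ℂ f z, f z - fderiv ℂ f z z)
  have hΨ : ContDiffOn ℝ 1 Ψ (ball 0 1) := by
    have h1 : ContDiffOn ℂ 1 (fderiv ℂ f) (ball 0 1) :=
      hf.fderiv_of_isOpen isOpen_ball (by norm_num)
    have h2 : ContDiffOn ℂ 1 Ψ (ball 0 1) :=
      h1.prodMk ((hf.of_le (by norm_num)).sub (h1.clm_apply contDiffOn_id))
    exact h2.restrict_scalars ℝ
  have hdense : Dense (Ψ '' ball 0 1)ᶜ := by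
    refine hΨ.dense_compl_image_of_dimH_lt_finrank (convex_ball _ _) Subset.rfl ?_
    rw [Real.dimH_of_mem_nhds h0]
    have h1 : Module.finrank ℂ (E →L[ℂ] ℂ) = Module.finrank ℂ E := by
      rw [← (LinearMap.toContinuousLinearMap (𝕜 := ℂ) (E := E) (F' := ℂ)).finrank_eq]
      exact Subspace.dual_finrank_eq
    rw [← Module.finrank_mul_finrank ℝ ℂ E, ← Module.finrank_mul_finrank ℝ ℂ (_ × ℂ),
      Complex.finrank_real_complex, Module.finrank_prod, h1, Module.finrank_self]
    exact_mod_cast by omega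
  have hnhds : Φ '' (ball 0 1 ×ˢ ball 0 1) ∈ 𝓝 (a₀, f 0) := by
    rw [← hΦ]
    exact image_mem_map (prod_mem_nhds h0 (isOpen_ball.mem_nhds (by simpa using ha₀)))
  obtain ⟨-, ⟨⟨z, a⟩, ⟨hz, ha⟩, rfl⟩, hbad⟩ := mem_closure_iff_nhds.1 (hdense (a₀, f 0)) _ hnhds
  refine ⟨a, f z - a z, by simpa using ha, ⟨z, hz, rfl⟩, fun w hw hwc hwd => hbad ⟨w, hw, ?_⟩⟩
  simp [Φ, Ψ, hwd, hwc]

/-- At every scale `ε`, the unit sphere of `ℂⁿ` has a finite `ε`-net which splits into a number of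
`32 ε`-separated families that does not depend on `ε`. -/
theorem exists_coloured_nets_of_unitSphere (n : ℕ) (hn : 0 < n) :
    ∃ K : ℕ, 0 < K ∧ ∀ ε > 0, ∃ P : Fin K → Finset (EuclideanSpace ℂ (Fin n)),
      (∀ i, ∀ p ∈ P i, ‖p‖ = 1) ∧ (∀ i, ∀ p ∈ P i, ∀ q ∈ P i, p ≠ q → 32 * ε < ‖p - q‖) ∧
      ∀ u, ‖u‖ = 1 → ∃ i, ∃ p ∈ P i, ‖u - p‖ ≤ ε := by
  classical
  let A : ℕ := 64 * n + 2
  have : NeZero A := ⟨by omega⟩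
  let κ := Fin n → ZMod A × ZMod A
  refine ⟨Fintype.card κ, Fintype.card_pos, fun ε hε => ?_⟩
  have hn' : (0 : ℝ) < n := by exact_mod_cast hn
  let δ : ℝ := ε / (2 * n)
  have hδ : 0 < δ := by positivity
  have hδε : 2 * n * δ = ε := by simp only [δ]; field_simp
  let cell : EuclideanSpace ℂ (Fin n) → (Fin n → ℤ × ℤ) :=
    fun z i => (⌊(z i).re / δ⌋, ⌊(z i).im / δ⌋)
  let sph : Set (EuclideanSpace ℂ (Fin n)) := {z | ‖z‖ = 1}
  have hfin : (cell '' sph).Finite := by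
    refine (Set.finite_Icc (fun _ => (⌊-1 / δ⌋, ⌊-1 / δ⌋)) (fun _ => (⌊1 / δ⌋, ⌊1 / δ⌋))).subset ?_
    rintro _ ⟨z, hz, rfl⟩
    have hz1 : ‖z‖ = 1 := hz
    have hre : ∀ i, |(z i).re| ≤ 1 := fun i =>
      (Complex.abs_re_le_norm _).trans ((PiLp.norm_apply_le z i).trans hz1.le)
    have him : ∀ i, |(z i).im| ≤ 1 := fun i =>
      (Complex.abs_im_le_norm _).trans ((PiLp.norm_apply_le z i).trans hz1.le)
    constructor
    · exact fun i => ⟨Int.floor_le_floor (by gcongr; exact (abs_le.1 (hre i)).1),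
        Int.floor_le_floor (by gcongr; exact (abs_le.1 (him i)).1)⟩
    · exact fun i => ⟨Int.floor_le_floor (by gcongr; exact (abs_le.1 (hre i)).2),
        Int.floor_le_floor (by gcongr; exact (abs_le.1 (him i)).2)⟩
  have hrep : ∀ c : Fin n → ℤ × ℤ, ∃ z, c ∈ cell '' sph → ‖z‖ = 1 ∧ cell z = c := by
    intro c
    by_cases hc : c ∈ cell '' sph
    · obtain ⟨z, hz, rfl⟩ := hc
      exact ⟨z, fun _ => ⟨hz, rfl⟩⟩
    · exact ⟨0, fun h => absurd h hc⟩
  choose rep hrep using hrep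
  let colour : (Fin n → ℤ × ℤ) → κ := fun c i => ((c i).1, (c i).2)
  let e := Fintype.equivFin κ
  refine ⟨fun i => {c ∈ hfin.toFinset | e (colour c) = i}.image rep, ?_, ?_, ?_⟩
  · intro i p hp
    simp only [Finset.mem_image, Finset.mem_filter, Set.Finite.mem_toFinset] at hp
    obtain ⟨c, ⟨hc, -⟩, rfl⟩ := hp
    exact (hrep c hc).1
  · have hfloor : ∀ x y : ℝ, ⌊x / δ⌋ ≠ ⌊y / δ⌋ → ((⌊x / δ⌋ : ℤ) : ZMod A) = (⌊y / δ⌋ : ℤ) →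
        32 * ε < |x - y| := by
      intro x y hne hmod
      rw [ZMod.intCast_eq_intCast_iff_dvd_sub] at hmod
      have h1 : (A : ℤ) ≤ |⌊y / δ⌋ - ⌊x / δ⌋| := by
        refine Int.le_of_dvd (abs_pos.2 (sub_ne_zero.2 hne.symm)) ((dvd_abs _ _).2 hmod)
      have h2 : (A : ℝ) ≤ |(⌊y / δ⌋ : ℝ) - ⌊x / δ⌋| := by exact_mod_cast h1
      have h3 : (A : ℝ) - 1 < |x / δ - y / δ| := by
        have := Int.floor_le (x / δ)
        have := Int.floor_le (y / δ)
        have := Int.lt_floor_add_one (x / δ)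
        have := Int.lt_floor_add_one (y / δ)
        rcases le_abs.1 h2 with h | h
        · exact lt_abs.2 (Or.inr (by linarith))
        · exact lt_abs.2 (Or.inl (by linarith))
      rw [← sub_div, abs_div, abs_of_pos hδ, lt_div_iff₀ hδ] at h3
      have h4 : (A : ℝ) = 64 * n + 2 := by simp [A]
      rw [h4] at h3
      nlinarith
    intro i p hp q hq hpq
    simp only [Finset.mem_image, Finset.mem_filter, Set.Finite.mem_toFinset] at hp hq
    obtain ⟨c, ⟨hc, hci⟩, rfl⟩ := hp
    obtain ⟨d, ⟨hd, hdi⟩, rfl⟩ := hq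
    have hcd : c ≠ d := fun h => hpq (h ▸ rfl)
    have hcol : colour c = colour d := e.injective (hci.trans hdi.symm)
    obtain ⟨j, hj⟩ := Function.ne_iff.1 hcd
    have hcj := congrFun hcol j
    simp only [colour, Prod.mk.injEq] at hcj
    refine lt_of_lt_of_le ?_ (PiLp.norm_apply_le (rep c - rep d) j)
    rw [← (hrep c hc).2, ← (hrep d hd).2] at hj hcj
    simp only [cell] at hj hcj
    by_cases h1 : ⌊(rep c j).re / δ⌋ = ⌊(rep d j).re / δ⌋
    · have h2 : ⌊(rep c j).im / δ⌋ ≠ ⌊(rep d j).im / δ⌋ := fun h => hj (Prod.ext h1 h)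
      exact (hfloor _ _ h2 hcj.2).trans_le (Complex.abs_im_le_norm (rep c j - rep d j))
    · exact (hfloor _ _ h1 hcj.1).trans_le (Complex.abs_re_le_norm (rep c j - rep d j))
  · intro u hu
    have hc : cell u ∈ cell '' sph := ⟨u, hu, rfl⟩
    refine ⟨e (colour (cell u)), rep (cell u), Finset.mem_image_of_mem _ (by simpa using hc), ?_⟩
    have hcell := (hrep _ hc).2
    have hfloor : ∀ x y : ℝ, ⌊x / δ⌋ = ⌊y / δ⌋ → |x - y| ≤ δ := by
      intro x y h
      have := (Int.abs_sub_lt_one_of_floor_eq_floor h).le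
      rwa [← sub_div, abs_div, abs_of_pos hδ, div_le_one hδ] at this
    have hcoord : ∀ i, ‖(u - rep (cell u)) i‖ ≤ 2 * δ := by
      intro i
      have hi := congrFun hcell i
      simp only [cell, Prod.mk.injEq] at hi
      refine (Complex.norm_le_abs_re_add_abs_im _).trans ?_
      have h1 := hfloor _ _ hi.1.symm
      have h2 := hfloor _ _ hi.2.symm
      simp only [PiLp.sub_apply, Complex.sub_re, Complex.sub_im]
      linarith
    rw [EuclideanSpace.norm_eq]
    refine Real.sqrt_le_iff.2 ⟨hε.le, ?_⟩
    calc ∑ i, ‖(u - rep (cell u)) i‖ ^ 2 ≤ ∑ _i : Fin n, (2 * δ) ^ 2 :=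
          Finset.sum_le_sum fun i _ => pow_le_pow_left₀ (norm_nonneg _) (hcoord i) 2
      _ = n * (2 * δ) ^ 2 := by simp
      _ ≤ (n * n) * (2 * δ) ^ 2 := by
          have : (1 : ℝ) ≤ n := by exact_mod_cast hn
          gcongr
          nlinarith
      _ = ε ^ 2 := by rw [← hδε]; ring

/-- Radii `R k` increasing to `1` whose increments are `K * e k ^ 2`, with `∑ e k = ∞`. -/
theorem exists_radii (K : ℕ) (hK : 0 < K) :
    ∃ R e : ℕ → ℝ, (∀ k, 0 < e k) ∧ (∀ k, K * e k ≤ 1 / 8) ∧ (∀ k, 1 / 2 ≤ R k) ∧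
      (∀ k, R (k + 1) = R k + K * e k ^ 2) ∧ (∀ k, R k < 1) ∧ (∀ x < 1, ∃ k, x < R k) ∧
      ¬ Summable e := by
  have hK' : (1 : ℝ) ≤ K := by exact_mod_cast hK
  have hpos : ∀ k : ℕ, (8 : ℝ) ≤ k + 8 * K := fun k => by
    have : (0 : ℝ) ≤ k := k.cast_nonneg
    linarith
  have hsq : ∀ k : ℕ, √(1 / (K * (k + 8 * K) * (k + 8 * K + 1))) ^ 2 =
      1 / (K * (k + 8 * K) * (k + 8 * K + 1)) := fun k => Real.sq_sqrt (by positivity)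
  refine ⟨fun k => 1 - 1 / (k + 8 * K), fun k => √(1 / (K * (k + 8 * K) * (k + 8 * K + 1))),
    fun k => ?_, fun k => ?_, fun k => ?_, fun k => ?_, fun k => ?_, fun x hx => ?_, fun hs => ?_⟩
  · have := hpos k
    positivity
  · have h := hpos k
    have hk : (0 : ℝ) ≤ k := k.cast_nonneg
    refine le_of_sq_le_sq ?_ (by norm_num)
    rw [mul_pow, hsq, mul_one_div, div_le_iff₀ (by positivity)]
    have h1 : 8 * K * 8 ≤ ((k : ℝ) + 8 * K) * (k + 8 * K + 1) :=
      mul_le_mul (by linarith) (by linarith) (by norm_num) (by linarith)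
    have h2 := mul_le_mul_of_nonneg_left h1 (by linarith : (0 : ℝ) ≤ K)
    linarith
  · have h := hpos k
    have : 1 / ((k : ℝ) + 8 * K) ≤ 1 / 8 := one_div_le_one_div_of_le (by norm_num) h
    linarith
  · have h := hpos k
    simp only [hsq]
    push_cast
    have h1 : (k : ℝ) + 8 * K ≠ 0 := by positivity
    have h2 : (k : ℝ) + 8 * K + 1 ≠ 0 := by positivity
    have h3 : (k : ℝ) + 1 + 8 * K ≠ 0 := by positivity
    field_simp
    ring
  · have h := hpos k
    have : 0 < 1 / ((k : ℝ) + 8 * K) := by positivity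
    simpa using this
  · obtain ⟨k, hk⟩ := exists_nat_one_div_lt (sub_pos.2 hx)
    refine ⟨k, ?_⟩
    have : 1 / ((k : ℝ) + 8 * K) ≤ 1 / (k + 1) :=
      one_div_le_one_div_of_le (by positivity) (by linarith)
    linarith
  · have h1 : Summable fun k : ℕ => 1 / (K : ℝ) * (1 / ((k + (8 * K + 1) : ℕ) : ℝ)) := by
      refine hs.of_nonneg_of_le (fun k => by positivity) fun k => ?_
      refine Real.le_sqrt_of_sq_le ?_
      have h := hpos k
      push_cast
      rw [div_mul_div_comm, div_pow, one_mul, one_pow]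
      refine one_div_le_one_div_of_le (by positivity) ?_
      calc (K : ℝ) * (k + 8 * K) * (k + 8 * K + 1)
          ≤ (K * K) * (k + 8 * K + 1) * (k + 8 * K + 1) := by
            refine mul_le_mul_of_nonneg_right (mul_le_mul ?_ ?_ ?_ ?_) (by linarith)
            · nlinarith
            · linarith
            · linarith
            · positivity
        _ = (K * (k + (8 * K + 1))) ^ 2 := by ring
    rw [summable_mul_left_iff (by positivity)] at h1
    exact Real.not_summable_one_div_natCast ((summable_nat_add_iff (8 * K + 1)).1 h1)

theorem norm_sub_smul_sq {E : Type*} [NormedAddCommGroup E] [InnerProductSpace ℂ E] {p : E}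
    (hp : ‖p‖ = 1) (z : E) (t : ℝ) :
    ‖z - (t : ℂ) • p‖ ^ 2 = ‖z‖ ^ 2 - 2 * t * (inner ℂ p z).re + t ^ 2 := by
  rw [norm_sub_sq (𝕜 := ℂ), inner_smul_right, norm_smul, hp, mul_one, Complex.norm_real,
    Real.norm_eq_abs, sq_abs]
  have h : (inner ℂ z p).re = (inner ℂ p z).re := by
    rw [← inner_conj_symm, Complex.conj_re]
  simp [h, mul_assoc]

/-- A slice lies strictly on one side of the hyperplane of a well-separated one. -/
theorem re_inner_lt_of_mem_slice {E : Type*} [NormedAddCommGroup E] [InnerProductSpace ℂ E]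
    {p q z : E} {r s e : ℝ} (hp : ‖p‖ = 1) (hq : ‖q‖ = 1) (he : 0 < e) (hpq : 4 * e < ‖p - q‖)
    (hs : 1 / 2 ≤ s) (hr : r ≤ 1) (hsr : r = s + e ^ 2 / 2) (hz : z ∈ slice q s r) :
    (inner ℂ p z).re < s := by
  by_contra! hcon
  obtain ⟨hz1, hz2⟩ := hz
  have hzr : ‖z‖ ^ 2 ≤ r ^ 2 := pow_le_pow_left₀ (norm_nonneg _) hz2 2
  have hrs : r ^ 2 - s ^ 2 ≤ e ^ 2 := by
    have : s ≤ 1 := by nlinarith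
    have h : r ^ 2 - s ^ 2 = (e ^ 2 / 2) * (r + s) := by rw [hsr]; ring
    rw [h]
    nlinarith
  have h1 : ‖z - (s : ℂ) • q‖ ≤ e := by
    refine le_of_sq_le_sq ?_ he.le
    rw [norm_sub_smul_sq hq, hz1]
    linarith
  have h2 : ‖z - (s : ℂ) • p‖ ≤ e := by
    refine le_of_sq_le_sq ?_ he.le
    rw [norm_sub_smul_sq hp]
    nlinarith
  have h3 : ‖(s : ℂ) • (p - q)‖ ≤ 2 * e := by
    have h : (s : ℂ) • (p - q) = (z - (s : ℂ) • q) - (z - (s : ℂ) • p) := by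
      rw [smul_sub]; abel
    rw [h]
    linarith [norm_sub_le (z - (s : ℂ) • q) (z - (s : ℂ) • p)]
  rw [norm_smul, Complex.norm_real, Real.norm_of_nonneg (by linarith)] at h3
  nlinarith

/-- First hitting time of a level by a continuous real function. -/
theorem exists_first_hitting_time {φ : ℝ → ℝ} (hφ : ContinuousOn φ (Ico 0 1)) {ρ : ℝ}
    (h0 : φ 0 ≤ ρ) (h1 : ∃ t ∈ Ico (0 : ℝ) 1, ρ ≤ φ t) :
    ∃ τ ∈ Ico (0 : ℝ) 1, φ τ = ρ ∧ ∀ t ∈ Icc 0 τ, φ t ≤ ρ := by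
  obtain ⟨b, hb, hbρ⟩ := h1
  have hsub : ∀ x < 1, Icc 0 x ⊆ Ico (0 : ℝ) 1 := fun x hx t ht => ⟨ht.1, ht.2.trans_lt hx⟩
  have hit : ∀ x ∈ Ico (0 : ℝ) 1, ρ ≤ φ x → ∃ t ∈ Icc 0 x, φ t = ρ := fun x hx hxρ =>
    intermediate_value_Icc hx.1 (hφ.mono (hsub x hx.2)) ⟨h0, hxρ⟩
  have hcomp : IsCompact (Icc 0 b ∩ φ ⁻¹' {ρ}) :=
    isCompact_Icc.of_isClosed_subset
      ((hφ.mono (hsub b hb.2)).preimage_isClosed_of_isClosed isClosed_Icc isClosed_singleton)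
      inter_subset_left
  obtain ⟨τ, ⟨hτ, hτρ⟩, hmin⟩ := hcomp.exists_isLeast
    (by obtain ⟨t, ht, htρ⟩ := hit b hb hbρ; exact ⟨t, ht, htρ⟩)
  have hτ1 := hsub b hb.2 hτ
  refine ⟨τ, hτ1, hτρ, fun t ht => ?_⟩
  by_contra! hlt
  obtain ⟨u, hu, huρ⟩ := hit t (hsub τ hτ1.2 ht) hlt.le
  have h2 : τ ≤ u := hmin ⟨⟨hu.1, (hu.2.trans ht.2).trans hτ.2⟩, huρ⟩
  have h3 : u = t := le_antisymm hu.2 (ht.2.trans h2)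
  rw [← huρ, h3] at hlt
  exact lt_irrefl _ hlt

/-- A path which starts below the hyperplane of a slice, stays in the ball of the slice and
avoids the slice remains below its hyperplane. -/
theorem re_inner_lt_of_avoids_slice {E : Type*} [NormedAddCommGroup E] [InnerProductSpace ℂ E]
    {γ : ℝ → E} {τ s r : ℝ} {p : E} (hτ : 0 ≤ τ) (hγ : ContinuousOn γ (Icc 0 τ)) (hp : ‖p‖ = 1)
    (h0 : ‖γ 0‖ < s) (hr : ∀ t ∈ Icc 0 τ, ‖γ t‖ ≤ r) (hav : ∀ t ∈ Icc 0 τ, γ t ∉ slice p s r) :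
    (inner ℂ p (γ τ)).re < s := by
  by_contra! hcon
  have h1 : (inner ℂ p (γ 0)).re ≤ s := by
    refine (Complex.re_le_norm _).trans ((norm_inner_le_norm _ _).trans ?_)
    rw [hp, one_mul]
    exact h0.le
  have hc : ContinuousOn (fun t => (inner ℂ p (γ t)).re) (Icc 0 τ) :=
    Complex.continuous_re.comp_continuousOn (continuousOn_const.inner hγ)
  obtain ⟨t, ht, hts⟩ := intermediate_value_Icc hτ hc ⟨h1, hcon⟩
  exact hav t ht ⟨hts, hr t ht⟩

/-- A divergent path in the unit ball which avoids all but finitely many layers of a labyrinth of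
slices has infinite length. -/
theorem eVariationOn_eq_top_of_avoids_slices {E : Type*} [NormedAddCommGroup E]
    [InnerProductSpace ℂ E] [FiniteDimensional ℂ E] {K : ℕ} (hK : 0 < K) {r e : ℕ → ℝ}
    (hr : StrictMono r) (hr0 : 1 / 2 ≤ r 0) (hr1 : ∀ l, r l < 1) (hrlim : ∀ x < 1, ∃ l, x < r l)
    (he : ∀ k, 0 < e k) (heK : ∀ k, K * e k ≤ 1 / 8) (hes : ¬ Summable e)
    (hstep : ∀ k, ∀ i ≤ K, r (K * k + i) = r (K * k) + i * e k ^ 2)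
    {P : ℕ → Finset E} (hP : ∀ l, ∀ p ∈ P l, ‖p‖ = 1)
    (hcover : ∀ k, ∀ u : E, ‖u‖ = 1 → ∃ i < K, ∃ p ∈ P (K * k + i), ‖u - p‖ ≤ e k / 8)
    {γ : ℝ → E} (hγ : DivergentPathIn (ball 0 1) γ) {m : ℕ}
    (hav : ∀ l ≥ m, ∀ p ∈ P l, ∀ t ∈ Ico (0 : ℝ) 1,
      γ t ∉ slice p ((r l + r (l + 1)) / 2) (r (l + 1))) :
    eVariationOn γ (Ico 0 1) = ⊤ := by
  have : ProperSpace E := FiniteDimensional.proper ℂ E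
  obtain ⟨hγc, hγb, hγd⟩ := hγ
  have hzero : (0 : ℝ) ∈ Ico (0 : ℝ) 1 := by simp
  obtain ⟨m', hm'⟩ := hrlim ‖γ 0‖ (by simpa using hγb 0 hzero)
  let M := max m m'
  have hγ0 : ∀ l ≥ M, ‖γ 0‖ < r l := fun l hl =>
    hm'.trans_le (hr.monotone ((le_max_right _ _).trans hl))
  have hhit : ∀ l, ∃ τ, M ≤ l → τ ∈ Ico (0 : ℝ) 1 ∧ ‖γ τ‖ = r l ∧ ∀ t ∈ Icc 0 τ, ‖γ t‖ ≤ r l := by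
    intro l
    by_cases hl : M ≤ l
    · obtain ⟨t₀, ht₀, ht⟩ := hγd (closedBall 0 (r l)) (closedBall_subset_ball (hr1 l))
        (isCompact_closedBall _ _)
      obtain ⟨τ, h⟩ := exists_first_hitting_time (φ := fun t => ‖γ t‖) hγc.norm (hγ0 l hl).le
        ⟨t₀, ht₀, by simpa using (not_le.1 (by simpa using ht t₀ ⟨le_rfl, ht₀.2⟩)).le⟩
      exact ⟨τ, fun _ => h⟩
    · exact ⟨0, fun h => absurd h hl⟩
  choose τ hτ using hhit
  have hτmono : ∀ l l', M ≤ l → l ≤ l' → τ l ≤ τ l' := by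
    intro l l' hl hll'
    rcases hll'.eq_or_lt with rfl | hlt
    · exact le_rfl
    by_contra! hcon
    have h1 := (hτ l hl).2.2 (τ l') ⟨(hτ l' (hl.trans hll')).1.1, hcon.le⟩
    rw [(hτ l' (hl.trans hll')).2.1] at h1
    exact (hr hlt).not_ge h1
  have hmove : ∀ k ≥ M, ∃ l, K * k ≤ l ∧ l ≤ K * (k + 1) ∧
      e k / 4 ≤ dist (γ (τ l)) (γ (τ (K * k))) := by
    intro k hk
    have hKk : M ≤ K * k := hk.trans (Nat.le_mul_of_pos_left k hK)
    obtain ⟨-, hx, -⟩ := hτ (K * k) hKk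
    set x := γ (τ (K * k)) with hxdef
    have hrk : 1 / 2 ≤ r (K * k) := hr0.trans (hr.monotone (Nat.zero_le _))
    have hrpos : 0 < r (K * k) := by linarith
    let u : E := ((r (K * k))⁻¹ : ℂ) • x
    have hxu : x = (r (K * k) : ℂ) • u := by
      simp only [u]
      rw [smul_smul, mul_inv_cancel₀ (by exact_mod_cast hrpos.ne'), one_smul]
    have hu : ‖u‖ = 1 := by
      simp only [u]
      rw [norm_smul, hx, norm_inv, Complex.norm_real, Real.norm_of_nonneg hrpos.le,
        inv_mul_cancel₀ hrpos.ne']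
    obtain ⟨i, hi, p, hp, hup⟩ := hcover k u hu
    have hl : M ≤ K * k + i + 1 := by omega
    refine ⟨K * k + i + 1, by omega, by rw [mul_add]; omega, ?_⟩
    obtain ⟨hτ1, hy, hyle⟩ := hτ (K * k + i + 1) hl
    set y := γ (τ (K * k + i + 1)) with hydef
    have hpn := hP _ p hp
    have hsubset : Icc 0 (τ (K * k + i + 1)) ⊆ Ico 0 1 := fun t ht => ⟨ht.1, ht.2.trans_lt hτ1.2⟩
    have hlt : (inner ℂ p y).re < (r (K * k + i) + r (K * k + i + 1)) / 2 := by
      refine re_inner_lt_of_avoids_slice hτ1.1 (hγc.mono hsubset) hpn ?_ hyle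
        (fun t ht => hav _ (by have := le_max_left m m'; omega) p hp t (hsubset ht))
      have h1 := hγ0 (K * k + i) (by omega)
      have h2 := hr (Nat.lt_succ_self (K * k + i))
      simp only [Nat.succ_eq_add_one] at h2
      linarith
    have hri := hstep k i hi.le
    have hri1 := hstep k (i + 1) hi
    rw [← add_assoc] at hri1
    push_cast at hri1
    set ρ := r (K * k + i + 1) with hρ
    have hρ1 : ρ < 1 := hr1 _
    have hρk : r (K * k) ≤ ρ := hr.monotone (by omega)
    have hek := he k
    have hyp : e k / 2 ≤ ‖y - (ρ : ℂ) • p‖ := by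
      refine le_of_sq_le_sq ?_ (norm_nonneg _)
      rw [norm_sub_smul_sq hpn, hy]
      have h1 : (inner ℂ p y).re ≤ ρ - e k ^ 2 / 2 := by linarith
      nlinarith [sq_nonneg (e k)]
    have hthick : ρ - r (K * k) ≤ e k / 8 := by
      have h1 : ((i : ℝ) + 1) ≤ K := by exact_mod_cast hi
      have h2 : ((i : ℝ) + 1) * e k ≤ 1 / 8 :=
        (mul_le_mul_of_nonneg_right h1 hek.le).trans (heK k)
      nlinarith
    have hxp : ‖x - (ρ : ℂ) • p‖ ≤ e k / 4 := by
      have h1 : x - (ρ : ℂ) • p = (r (K * k) : ℂ) • (u - p) - ((ρ - r (K * k) : ℝ) : ℂ) • p := by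
        rw [hxu]
        push_cast
        module
      rw [h1]
      refine (norm_sub_le _ _).trans ?_
      rw [norm_smul, norm_smul, hpn, mul_one, Complex.norm_real, Complex.norm_real,
        Real.norm_of_nonneg hrpos.le, Real.norm_of_nonneg (by linarith)]
      nlinarith [norm_nonneg (u - p)]
    have h2 : y - (ρ : ℂ) • p = (y - x) + (x - (ρ : ℂ) • p) := by abel
    rw [h2] at hyp
    rw [dist_eq_norm]
    linarith [norm_add_le (y - x) (x - (ρ : ℂ) • p)]
  by_contra htop
  refine hes ((summable_nat_add_iff M).1 ?_)
  refine summable_of_sum_range_le (c := 4 * (eVariationOn γ (Ico 0 1)).toReal)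
    (fun k => (he _).le) fun N => ?_
  let T : ℕ → ℝ := fun k => τ (K * (k + M))
  have hMle : ∀ k, M ≤ K * (k + M) := fun k =>
    (Nat.le_add_left M k).trans (Nat.le_mul_of_pos_left _ hK)
  have hTmem : ∀ k, T k ∈ Ico (0 : ℝ) 1 := fun k => (hτ _ (hMle k)).1
  have hT : Monotone T := fun a b hab => hτmono _ _ (hMle a) (by gcongr)
  have hpiece : ∀ k, ENNReal.ofReal (e (k + M) / 4) ≤
      eVariationOn γ (Ico 0 1 ∩ Icc (T k) (T (k + 1))) := by
    intro k
    obtain ⟨l, hl1, hl2, hl⟩ := hmove (k + M) (Nat.le_add_left _ _)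
    have hMl : M ≤ l := (hMle k).trans hl1
    have h1 : T k ≤ τ l := hτmono _ _ (hMle k) hl1
    have h2 : τ l ≤ T (k + 1) := hτmono _ _ hMl (by rwa [show k + 1 + M = k + M + 1 by ring])
    refine le_trans ?_ (eVariationOn.edist_le γ (x := τ l) (y := T k)
      ⟨(hτ l hMl).1, h1, h2⟩ ⟨hTmem k, le_rfl, hT (Nat.le_succ k)⟩)
    rw [edist_dist]
    exact ENNReal.ofReal_le_ofReal hl
  have hsum : ∑ k ∈ Finset.range N, ENNReal.ofReal (e (k + M) / 4) ≤ eVariationOn γ (Ico 0 1) :=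
    calc ∑ k ∈ Finset.range N, ENNReal.ofReal (e (k + M) / 4)
        ≤ ∑ k ∈ Finset.range N, eVariationOn γ (Ico 0 1 ∩ Icc (T k) (T (k + 1))) :=
          Finset.sum_le_sum fun k _ => hpiece k
      _ = eVariationOn γ (Ico 0 1 ∩ Icc (T 0) (T N)) :=
          eVariationOn.sum γ hT fun k _ _ => hTmem k
      _ ≤ _ := eVariationOn.mono γ inter_subset_left
  rw [← ENNReal.ofReal_sum_of_nonneg fun k _ => by linarith [he (k + M)],
    ENNReal.ofReal_le_iff_le_toReal htop, ← Finset.sum_div] at hsum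
  linarith

/-- There is a labyrinth in the unit ball of `ℂⁿ`: a sequence of finite layers of separated slices
such that divergent paths avoiding all but finitely many layers have infinite length. -/
theorem exists_labyrinth_s12 (n : ℕ) (hn : 0 < n) :
    ∃ (r s : ℕ → ℝ) (P : ℕ → Finset (EuclideanSpace ℂ (Fin n))), Monotone r ∧
      (∀ x < 1, ∃ l, x < r l) ∧ (∀ l, r l < s l) ∧
      (∀ l, ∀ p ∈ P l, ‖p‖ = 1) ∧
      (∀ l, ∀ p ∈ P l, ∀ q ∈ P l, p ≠ q →
        ∀ z ∈ slice q (s l) (r (l + 1)), (inner ℂ p z).re < s l) ∧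
      ∀ γ : ℝ → EuclideanSpace ℂ (Fin n), DivergentPathIn (ball 0 1) γ →
        (∃ m, ∀ l ≥ m, ∀ p ∈ P l, ∀ t ∈ Ico (0 : ℝ) 1, γ t ∉ slice p (s l) (r (l + 1))) →
        eVariationOn γ (Ico 0 1) = ⊤ := by
  obtain ⟨K, hK, hnet⟩ := exists_coloured_nets_of_unitSphere n hn
  obtain ⟨R, e, he, heK, hR0, hRstep, hR1, hRlim, hes⟩ := exists_radii K hK
  choose Q hQ hQsep hQcover using fun k => hnet (e k / 8) (div_pos (he k) (by norm_num))
  let P : ℕ → Finset (EuclideanSpace ℂ (Fin n)) := fun l => Q (l / K) ⟨l % K, Nat.mod_lt l hK⟩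
  let r : ℕ → ℝ := fun l => R (l / K) + (l % K : ℕ) * e (l / K) ^ 2
  have hdiv : ∀ k i, i < K → (K * k + i) / K = k := fun k i hi => by
    rw [Nat.mul_add_div hK, Nat.div_eq_of_lt hi, add_zero]
  have hmod : ∀ k i, i < K → (K * k + i) % K = i := fun k i hi => by
    rw [Nat.mul_add_mod, Nat.mod_eq_of_lt hi]
  have hPQ : ∀ k (i : Fin K), P (K * k + i) = Q k i := fun k i => by
    have h : ∀ a b (hb : b < K), a = k → b = i → Q a ⟨b, hb⟩ = Q k i := by
      rintro _ _ _ rfl rfl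
      rfl
    exact h _ _ _ (hdiv k i i.2) (hmod k i i.2)
  have hrR : ∀ k, r (K * k) = R k := fun k => by
    simp [r, Nat.mul_div_cancel_left k hK]
  have hri : ∀ k, ∀ i ≤ K, r (K * k + i) = R k + i * e k ^ 2 := by
    intro k i hi
    rcases hi.lt_or_eq with hi | rfl
    · simp only [r]
      rw [hdiv k i hi, hmod k i hi]
    · rw [← hRstep, ← hrR, mul_add, mul_one]
  have hrsucc : ∀ l, r (l + 1) = r l + e (l / K) ^ 2 := by
    intro l
    have h1 := hri (l / K) (l % K) (Nat.mod_lt l hK).le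
    have h2 := hri (l / K) (l % K + 1) (Nat.mod_lt l hK)
    rw [← add_assoc] at h2
    rw [Nat.div_add_mod] at h1 h2
    rw [h1, h2]
    push_cast
    ring
  have hmono : StrictMono r := strictMono_nat_of_lt_succ fun l => by
    rw [hrsucc]
    linarith [pow_pos (he (l / K)) 2]
  have hr0 : ∀ l, 1 / 2 ≤ r l := fun l => by
    have h1 := hR0 (l / K)
    have h2 : 0 ≤ ((l % K : ℕ) : ℝ) * e (l / K) ^ 2 := by positivity
    simp only [r]
    linarith
  have hr1 : ∀ l, r l < 1 := fun l =>
    calc r l ≤ r (K * l) := hmono.monotone (Nat.le_mul_of_pos_left l hK)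
      _ = R l := hrR l
      _ < 1 := hR1 l
  have hrlim : ∀ x < 1, ∃ l, x < r l := fun x hx => by
    obtain ⟨k, hk⟩ := hRlim x hx
    exact ⟨K * k, by rwa [hrR]⟩
  refine ⟨r, fun l => (r l + r (l + 1)) / 2, P, hmono.monotone, hrlim, fun l => ?_,
    fun l => hQ _ _, fun l p hp q hq hpq z hz => ?_, fun γ hγ ⟨m, hm⟩ => ?_⟩
  · linarith [hmono (Nat.lt_succ_self l)]
  · refine re_inner_lt_of_mem_slice (hQ _ _ p hp) (hQ _ _ q hq) (he (l / K)) ?_ ?_ (hr1 _).le ?_ hz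
    · have := hQsep _ _ p hp q hq hpq
      linarith
    · linarith [hr0 l, hr0 (l + 1)]
    · have := hrsucc l
      dsimp only
      linarith
  · refine eVariationOn_eq_top_of_avoids_slices hK hmono (hr0 0) hr1 hrlim he heK hes
      (fun k i hi => by rw [hri k i hi, hrR]) (fun l => hQ _ _) (fun k u hu => ?_) hγ hm
    obtain ⟨i, p, hp, hup⟩ := hQcover k u hu
    refine ⟨i, i.2, p, ?_, hup⟩
    rw [← hPQ k i] at hp
    exact hp
/-- Globevnik: there is a holomorphic function on 𝔹ₙ (`n ≥ 2`) one of whose level sets is a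
nonempty smooth complete closed complex hypersurface of 𝔹ₙ. -/
theorem globevnik_complete_hypersurface_in_ball (n : ℕ) (hn : 2 ≤ n) :
    ∃ (f : EuclideanSpace ℂ (Fin n) → ℂ) (c : ℂ),
      DifferentiableOn ℂ f (Metric.ball (0 : EuclideanSpace ℂ (Fin n)) 1) ∧
      (∃ z ∈ Metric.ball (0 : EuclideanSpace ℂ (Fin n)) 1, f z = c) ∧
      (∀ z ∈ Metric.ball (0 : EuclideanSpace ℂ (Fin n)) 1, f z = c → fderiv ℂ f z ≠ 0) ∧
      (∀ γ : ℝ → EuclideanSpace ℂ (Fin n),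
        DivergentPathIn (Metric.ball (0 : EuclideanSpace ℂ (Fin n)) 1) γ →
        (∀ t ∈ Set.Ico (0 : ℝ) 1, f (γ t) = c) →
        eVariationOn γ (Set.Ico 0 1) = ⊤) := by
  have : NeZero n := ⟨by omega⟩
  obtain ⟨r, s, P, hr, hrlim, hrs, hP, hsep, hpath⟩ := exists_labyrinth_s12 n (by omega)
  obtain ⟨f, hf, hfP⟩ := exists_contDiffOn_large_on_slices hr hrlim hrs P hP hsep
  obtain ⟨a, c, ha, hne, hreg⟩ := exists_regular_level_of_linear_perturbation hf
  have hfd : DifferentiableOn ℂ f (ball 0 1) := hf.differentiableOn (by norm_num)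
  refine ⟨fun z => f z - a z, c, hfd.sub a.differentiable.differentiableOn, hne,
    fun z hz hzc => ?_, fun γ hγ hγc => hpath γ hγ ?_⟩
  · rw [fderiv_fun_sub (hfd.differentiableAt (isOpen_ball.mem_nhds hz)) a.differentiableAt,
      a.fderiv]
    exact sub_ne_zero.2 (hreg z hz hzc)
  · obtain ⟨m, hm⟩ := exists_nat_gt (‖c‖ + 1)
    refine ⟨m, fun l hl p hp t ht hmem => ?_⟩
    have h1 := hfP l p hp _ hmem
    have h2 : ‖a (γ t)‖ ≤ 1 := by
      have h3 : ‖γ t‖ < 1 := by simpa using hγ.2.1 t ht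
      exact (a.le_opNorm _).trans (mul_le_one₀ ha.le (norm_nonneg _) h3.le)
    have h4 : f (γ t) = c + a (γ t) := by rw [← hγc t ht]; ring
    have h5 : (m : ℝ) ≤ l := by exact_mod_cast hl
    rw [h4] at h1
    linarith [norm_add_le c (a (γ t))]
end
end

section
/- Let n and q be integers with 1 ≤ q < n. There exists a holomorphic map f : 𝔹ₙ → ℂ^q whose derivative Df(z) : ℂⁿ → ℂ^q is surjective at every point z ∈ 𝔹ₙ (a holomorphic submersion), such that every fibre of f is complete: every divergent path γ : [0,1) → 𝔹ₙ along which f is constant has infinite length. (Alarcón: a nonsingular holomorphic submersion foliation of 𝔹ₙ by complete closed complex submanifolds of codimension q.) -/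
open Set Metric
open scoped ENNReal

noncomputable section

/-- `f` tends to infinity along every cone avoiding the kernel of `ℓ`. -/
def GrowsAlong {E : Type*} [NormedAddCommGroup E] [NormedSpace ℂ E] (f : E → ℂ) (ℓ : E →L[ℂ] ℂ) :
    Prop :=
  ∀ R δ : ℝ, 0 < δ → ∃ T : ℝ, ∀ z : E, T ≤ ‖z‖ → δ * ‖z‖ ≤ ‖ℓ z‖ → R ≤ ‖f z‖

/-- A volume preserving entire map whose coordinate `p` grows along some nonzero functional. -/
def IsGrowingMap {E : Type*} [NormedAddCommGroup E] [NormedSpace ℂ E] (p : E →L[ℂ] ℂ)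
    (Φ : E → E) : Prop :=
  Differentiable ℂ Φ ∧ (∀ z, (fderiv ℂ Φ z).det = 1) ∧
    ∃ ℓ : E →L[ℂ] ℂ, ℓ ≠ 0 ∧ GrowsAlong (fun z => p (Φ z)) ℓ

/-- Every growing map can be modified into a growing map which is arbitrarily close to it on `K`
and whose coordinate `p` is arbitrarily large on `L`. -/
def Pushable {E : Type*} [NormedAddCommGroup E] [NormedSpace ℂ E] (p : E →L[ℂ] ℂ)
    (K L : Set E) : Prop :=
  ∀ Φ : E → E, IsGrowingMap p Φ → ∀ ε R : ℝ, 0 < ε → ∃ Ψ : E → E, IsGrowingMap p Ψ ∧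
    (∀ z ∈ K, ‖Ψ z - Φ z‖ ≤ ε) ∧ ∀ z ∈ L, R ≤ ‖p (Ψ z)‖

lemma exists_entire_small_large (c c' r η M : ℝ) (hc : c < c') (hη : 0 < η) :
    ∃ g : ℂ → ℂ, Differentiable ℂ g ∧
      (∀ ζ, ‖ζ‖ ≤ r → ζ.re ≤ c → ‖g ζ‖ ≤ η) ∧
      (∀ ζ, c' ≤ ζ.re → M ≤ ‖g ζ‖) ∧
      ∀ Q : ℝ, ∃ T : ℝ, ∀ ζ, T ≤ ‖ζ‖ → Q * ‖ζ‖ ≤ ‖g ζ‖ := by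
  obtain ⟨m, hm1, hm2⟩ := exists_between hc
  obtain ⟨m', hm1', hm2'⟩ := exists_between hm2
  -- `B` is so large that the disc of centre `-B` and radius `B + m` contains the compact part
  obtain ⟨B, hB0, hBc, hB⟩ : ∃ B : ℝ, 0 < B ∧ 0 < B + c ∧ r ^ 2 + 1 + m ^ 2 ≤ 2 * B * (m - c) := by
    refine ⟨max (max 1 (1 - c)) ((r ^ 2 + 1 + m ^ 2) / (2 * (m - c))), ?_, ?_, ?_⟩
    · exact lt_max_of_lt_left (lt_max_of_lt_left one_pos)
    · have : 1 - c ≤ max (max 1 (1 - c)) ((r ^ 2 + 1 + m ^ 2) / (2 * (m - c))) :=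
        (le_max_right _ _).trans (le_max_left _ _)
      linarith
    · have := le_max_right (max 1 (1 - c)) ((r ^ 2 + 1 + m ^ 2) / (2 * (m - c)))
      rw [div_le_iff₀ (by linarith)] at this
      linarith
  set C : ℝ := B + m' with hC
  have hC0 : 0 < C := by linarith
  have h1 : (B + m) / C < 1 := by rw [div_lt_one hC0]; linarith
  have h2 : 1 < (B + c') / C := by rw [one_lt_div hC0]; linarith
  obtain ⟨N1, hN1⟩ := exists_pow_lt_of_lt_one hη h1
  obtain ⟨N2, hN2⟩ := pow_unbounded_of_one_lt M h2
  set N := max 2 (max N1 N2) with hN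
  have hnorm : ∀ ζ : ℂ, ‖((ζ + B) / C) ^ N‖ = (‖ζ + B‖ / C) ^ N := by
    intro ζ
    rw [norm_pow, norm_div, Complex.norm_real, Real.norm_of_nonneg hC0.le]
  have hBm : 0 ≤ (B + m) / C := div_nonneg (by linarith) hC0.le
  refine ⟨fun ζ => ((ζ + B) / C) ^ N, by fun_prop, ?_, ?_, ?_⟩
  · intro ζ hr hre
    rw [hnorm]
    have h3 : ‖ζ + B‖ ≤ B + m := by
      apply le_of_sq_le_sq _ (by linarith)
      have e1 : ‖ζ + B‖ ^ 2 = ‖ζ‖ ^ 2 + 2 * B * ζ.re + B ^ 2 := by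
        rw [← Complex.normSq_eq_norm_sq, ← Complex.normSq_eq_norm_sq, Complex.normSq_apply,
          Complex.normSq_apply]
        simp
        ring
      have e2 : ‖ζ‖ ^ 2 ≤ r ^ 2 := by gcongr
      have e3 : 2 * B * ζ.re ≤ 2 * B * c := by gcongr
      nlinarith
    calc (‖ζ + B‖ / C) ^ N ≤ ((B + m) / C) ^ N := by gcongr
      _ ≤ ((B + m) / C) ^ N1 := pow_le_pow_of_le_one hBm h1.le (by omega)
      _ ≤ η := hN1.le
  · intro ζ hre
    rw [hnorm]
    have h3 : B + c' ≤ ‖ζ + B‖ := by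
      refine le_trans ?_ (Complex.re_le_norm _)
      simp; linarith
    calc M ≤ ((B + c') / C) ^ N2 := hN2.le
      _ ≤ ((B + c') / C) ^ N := pow_le_pow_right₀ h2.le (by omega)
      _ ≤ (‖ζ + B‖ / C) ^ N := by
        have : 0 ≤ (B + c') / C := by linarith
        gcongr
  · intro Q
    refine ⟨max (2 * B) (max (2 * C) (4 * C ^ 2 * Q)), fun ζ hζ => ?_⟩
    have t1 := (le_max_left _ _).trans hζ
    have t2 := ((le_max_left _ _).trans (le_max_right _ _)).trans hζ
    have t3 := ((le_max_right _ _).trans (le_max_right _ _)).trans hζ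
    rw [hnorm]
    have h3 : ‖ζ‖ / 2 ≤ ‖ζ + B‖ := by
      have := norm_sub_le (ζ + B) (B : ℂ)
      rw [add_sub_cancel_right, Complex.norm_real, Real.norm_of_nonneg hB0.le] at this
      linarith
    have h4 : 1 ≤ ‖ζ‖ / 2 / C := by
      rw [le_div_iff₀ hC0]; linarith
    calc Q * ‖ζ‖ = (4 * C ^ 2 * Q) * ‖ζ‖ / (4 * C ^ 2) := by field_simp
      _ ≤ ‖ζ‖ * ‖ζ‖ / (4 * C ^ 2) := by gcongr
      _ = (‖ζ‖ / 2 / C) ^ 2 := by field_simp; norm_num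
      _ ≤ (‖ζ‖ / 2 / C) ^ N := pow_le_pow_right₀ h4 (by omega)
      _ ≤ (‖ζ + B‖ / C) ^ N := by gcongr

section Shear

variable {E : Type*} [NormedAddCommGroup E] [NormedSpace ℂ E]

lemma GrowsAlong.exists_le_norm_add_smul {f : E → ℂ} {ℓ : E →L[ℂ] ℂ} (hf : GrowsAlong f ℓ) {v : E}
    (hv : ℓ v ≠ 0) (R : ℝ) :
    ∃ Q T : ℝ, 0 < Q ∧ ∀ (z : E) (η : ℂ), Q * ‖z‖ ≤ ‖η‖ → T ≤ ‖η‖ → R ≤ ‖f (z + η • v)‖ := by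
  have hω : 0 < ‖ℓ v‖ := norm_pos_iff.2 hv
  have hv0 : 0 < ‖v‖ := norm_pos_iff.2 (by rintro rfl; simp at hv)
  set ω := ‖ℓ v‖
  set δ := ω / (2 * (1 + ‖v‖)) with hδ
  have hδ0 : 0 < δ := by positivity
  have hδv : δ * ‖v‖ ≤ ω / 2 := by
    rw [hδ, div_mul_eq_mul_div, div_le_div_iff₀ (by positivity) (by positivity)]
    nlinarith
  obtain ⟨T, hT⟩ := hf R δ hδ0
  refine ⟨max (2 * (‖ℓ‖ + δ) / ω) (2 / ‖v‖), 2 * T / ‖v‖, lt_max_of_lt_right (by positivity), ?_⟩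
  intro z η h1 h2
  have h3 : 2 * (‖ℓ‖ + δ) / ω * ‖z‖ ≤ ‖η‖ :=
    (mul_le_mul_of_nonneg_right (le_max_left _ _) (norm_nonneg _)).trans h1
  have h4 : 2 / ‖v‖ * ‖z‖ ≤ ‖η‖ :=
    (mul_le_mul_of_nonneg_right (le_max_right _ _) (norm_nonneg _)).trans h1
  rw [div_mul_eq_mul_div, div_le_iff₀ hω] at h3
  rw [div_mul_eq_mul_div, div_le_iff₀ hv0] at h4
  rw [div_le_iff₀ hv0] at h2
  have h5 : ‖η‖ * ‖v‖ - ‖z‖ ≤ ‖z + η • v‖ := by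
    have := norm_sub_le (z + η • v) z
    rw [add_sub_cancel_left, norm_smul] at this
    linarith
  have h6 : ‖z + η • v‖ ≤ ‖z‖ + ‖η‖ * ‖v‖ := by
    rw [← norm_smul]; exact norm_add_le _ _
  apply hT
  · linarith
  · have h7 : ‖η‖ * ω - ‖ℓ‖ * ‖z‖ ≤ ‖ℓ (z + η • v)‖ := by
      have := norm_sub_le (ℓ (z + η • v)) (ℓ z)
      rw [← map_sub, add_sub_cancel_left, map_smul, norm_smul] at this
      have := ℓ.le_opNorm z
      linarith
    have h8 : δ * ‖z + η • v‖ ≤ δ * (‖z‖ + ‖η‖ * ‖v‖) := by gcongr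
    have h9 : ‖η‖ * (δ * ‖v‖) ≤ ‖η‖ * (ω / 2) := by gcongr
    nlinarith

lemma GrowsAlong.comp_shear {f : E → ℂ} {ℓ : E →L[ℂ] ℂ} (hf : GrowsAlong f ℓ) {v : E}
    (hv : ℓ v ≠ 0) (ℓ' : E →L[ℂ] ℂ) {g : ℂ → ℂ}
    (hg : ∀ Q : ℝ, ∃ T : ℝ, ∀ ζ, T ≤ ‖ζ‖ → Q * ‖ζ‖ ≤ ‖g ζ‖) :
    GrowsAlong (fun z => f (z + g (ℓ' z) • v)) ℓ' := by
  intro R δ hδ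
  obtain ⟨Q, T, hQ, hQT⟩ := hf.exists_le_norm_add_smul hv R
  obtain ⟨T', hT'⟩ := hg (Q / δ)
  refine ⟨max (T' / δ) (T / Q), fun z hz hδz => hQT z _ ?_ ?_⟩
  all_goals
    have h1 := (le_max_left _ _).trans hz
    have h2 := (le_max_right _ _).trans hz
    rw [div_le_iff₀ hδ] at h1
    rw [div_le_iff₀ hQ] at h2
    have h3 : Q * ‖z‖ ≤ ‖g (ℓ' z)‖ := by
      refine le_trans ?_ (hT' (ℓ' z) (by linarith))
      calc Q * ‖z‖ = Q / δ * (δ * ‖z‖) := by field_simp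
        _ ≤ Q / δ * ‖ℓ' z‖ := by gcongr
    linarith

lemma det_fderiv_shear [FiniteDimensional ℂ E] {ℓ : E →L[ℂ] ℂ} {v : E} (hv : ℓ v = 0) {g : ℂ → ℂ}
    (hg : Differentiable ℂ g) (z : E) :
    (fderiv ℂ (fun z => z + g (ℓ z) • v) z).det = 1 := by
  have h : HasFDerivAt (fun z => z + g (ℓ z) • v)
      (ContinuousLinearMap.id ℂ E + (deriv g (ℓ z) • ℓ).smulRight v) z :=
    (hasFDerivAt_id z).add
      (((hg (ℓ z)).hasDerivAt.comp_hasFDerivAt z ℓ.hasFDerivAt).smul_const v)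
  rw [h.fderiv, ContinuousLinearMap.det]
  have : ((ContinuousLinearMap.id ℂ E + (deriv g (ℓ z) • ℓ).smulRight v : E →L[ℂ] E) :
      E →ₗ[ℂ] E) = LinearMap.transvection ((deriv g (ℓ z) • ℓ : E →L[ℂ] ℂ) : E →ₗ[ℂ] ℂ) v := by
    ext x
    simp [LinearMap.transvection.apply]
  rw [this, LinearMap.transvection.det]
  simp [hv]

/-- A nonzero functional can be perturbed so that its kernel is not contained in that of `ℓ`. -/
lemma exists_functional_near [FiniteDimensional ℂ E] (hE : 1 < Module.finrank ℂ E)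
    {ℓ ℓ₁ : E →L[ℂ] ℂ} (hℓ : ℓ ≠ 0) (hℓ₁ : ℓ₁ ≠ 0) {ε : ℝ} (hε : 0 < ε) :
    ∃ (ℓ' : E →L[ℂ] ℂ) (v : E), ℓ' ≠ 0 ∧ ‖ℓ' - ℓ₁‖ ≤ ε ∧ ℓ' v = 0 ∧ ℓ v ≠ 0 := by
  by_cases h : ∃ v, ℓ₁ v = 0 ∧ ℓ v ≠ 0
  · obtain ⟨v, h1, h2⟩ := h
    exact ⟨ℓ₁, v, hℓ₁, by simpa using hε.le, h1, h2⟩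
  push Not at h
  obtain ⟨a, ha⟩ : ∃ a, ℓ a ≠ 0 := by
    by_contra! h'
    exact hℓ (ContinuousLinearMap.ext h')
  obtain ⟨b, hb, hb0⟩ : ∃ b, ℓ₁ b = 0 ∧ b ≠ 0 := by
    have := LinearMap.ker_ne_bot_of_finrank_lt (f := (ℓ₁ : E →ₗ[ℂ] ℂ)) (by simpa using hE)
    obtain ⟨b, hb, hb0⟩ := Submodule.exists_mem_ne_zero_of_ne_bot this
    exact ⟨b, by simpa using hb, hb0⟩
  have hℓb := h b hb
  obtain ⟨m, hm1, hm⟩ := exists_dual_vector ℂ b (norm_ne_zero_iff.2 hb0)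
  have hmb : m b ≠ 0 := by rw [hm]; simpa using hb0
  refine ⟨ℓ₁ + (ε : ℂ) • m, a - ((ℓ₁ a + ε * m a) / (ε * m b)) • b, ?_, ?_, ?_, ?_⟩
  · intro h0
    have := congrArg (fun L : E →L[ℂ] ℂ => L b) h0
    simp [hb, hmb, hε.ne'] at this
  · rw [add_sub_cancel_left, norm_smul, hm1]
    simp [abs_of_pos hε]
  · have : (ε : ℂ) ≠ 0 := by exact_mod_cast hε.ne'
    simp [hb]
    field_simp
    ring
  · simpa [hℓb] using ha

lemma pushable_of_separated [FiniteDimensional ℂ E] (hE : 1 < Module.finrank ℂ E)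
    {p : E →L[ℂ] ℂ} {K L : Set E} (hK : IsCompact K) (hL : IsCompact L) {ℓ₁ : E →L[ℂ] ℂ}
    (hℓ₁ : ℓ₁ ≠ 0) {c c' : ℝ} (hc : c < c') (hKc : ∀ z ∈ K, (ℓ₁ z).re ≤ c)
    (hLc : ∀ z ∈ L, c' ≤ (ℓ₁ z).re) : Pushable p K L := by
  rintro Φ ⟨hΦ, hdet, ℓ, hℓ, hgrow⟩ ε R hε
  obtain ⟨r, hr0, hr⟩ : ∃ r : ℝ, 0 < r ∧ ∀ z ∈ K ∪ L, ‖z‖ ≤ r := by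
    obtain ⟨r, hr0, hr⟩ := (hK.union hL).isBounded.exists_pos_norm_le
    exact ⟨r, hr0, hr⟩
  obtain ⟨ℓ', v, hℓ', hnear, hv', hv⟩ :=
    exists_functional_near hE hℓ hℓ₁ (ε := (c' - c) / (4 * r)) (by
      have : 0 < c' - c := by linarith
      positivity)
  have hre : ∀ z ∈ K ∪ L, |(ℓ' z).re - (ℓ₁ z).re| ≤ (c' - c) / 4 := by
    intro z hz
    calc |(ℓ' z).re - (ℓ₁ z).re| = |((ℓ' - ℓ₁) z).re| := by simp
      _ ≤ ‖(ℓ' - ℓ₁) z‖ := Complex.abs_re_le_norm _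
      _ ≤ ‖ℓ' - ℓ₁‖ * ‖z‖ := ContinuousLinearMap.le_opNorm _ _
      _ ≤ (c' - c) / (4 * r) * r :=
        mul_le_mul hnear (hr z hz) (norm_nonneg _) ((norm_nonneg _).trans hnear)
      _ = (c' - c) / 4 := by field_simp
  obtain ⟨Q, T, hQ, hQT⟩ := hgrow.exists_le_norm_add_smul hv R
  obtain ⟨δ, hδ, hδΦ⟩ : ∃ δ > 0, ∀ z ∈ K, ∀ w, ‖w - z‖ < δ → ‖Φ w - Φ z‖ < ε := by
    have := hK.uniformContinuousAt_of_continuousAt Φ (fun z _ => hΦ.continuous.continuousAt)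
      (Metric.dist_mem_uniformity hε)
    obtain ⟨δ, hδ, h⟩ := Metric.mem_uniformity_dist.1 this
    refine ⟨δ, hδ, fun z hz w hw => ?_⟩
    have := h (a := z) (b := w) (by rwa [dist_comm, dist_eq_norm]) hz
    rwa [← dist_eq_norm, dist_comm]
  have hv0 : 0 < ‖v‖ := norm_pos_iff.2 (by rintro rfl; simp at hv)
  obtain ⟨g, hg, hgK, hgL, hgrow'⟩ := exists_entire_small_large (c + (c' - c) / 4)
    (c' - (c' - c) / 4) (‖ℓ'‖ * r) (δ / (2 * ‖v‖)) (max T (Q * r)) (by linarith) (by positivity)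
  refine ⟨fun z => Φ (z + g (ℓ' z) • v), ⟨by fun_prop, fun z => ?_, ℓ', hℓ',
    hgrow.comp_shear hv ℓ' hgrow'⟩, fun z hz => ?_, fun z hz => ?_⟩
  · have h1 : DifferentiableAt ℂ (fun z => z + g (ℓ' z) • v) z := by fun_prop
    have := fderiv_comp z (hΦ (z + g (ℓ' z) • v)) h1
    simp only [Function.comp_def] at this
    rw [this, ContinuousLinearMap.det, ContinuousLinearMap.toLinearMap_comp, LinearMap.det_comp]
    have h2 := hdet (z + g (ℓ' z) • v)
    have h3 := det_fderiv_shear hv' hg z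
    rw [ContinuousLinearMap.det] at h2 h3
    rw [h2, h3, one_mul]
  · refine (hδΦ z hz _ ?_).le
    rw [add_sub_cancel_left, norm_smul]
    have h1 := hgK (ℓ' z) ((ℓ'.le_opNorm z).trans (by gcongr; exact hr z (Or.inl hz))) (by
      have := abs_le.1 (hre z (Or.inl hz))
      have := hKc z hz
      linarith)
    calc ‖g (ℓ' z)‖ * ‖v‖ ≤ δ / (2 * ‖v‖) * ‖v‖ := by gcongr
      _ = δ / 2 := by field_simp
      _ < δ := by linarith
  · have h1 := hgL (ℓ' z) (by
      have := abs_le.1 (hre z (Or.inr hz))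
      have := hLc z hz
      linarith)
    refine hQT z _ ?_ ((le_max_left _ _).trans h1)
    refine le_trans ?_ ((le_max_right _ _).trans h1)
    gcongr
    exact hr z (Or.inr hz)

lemma Pushable.mono {p : E →L[ℂ] ℂ} {K K' L : Set E} (h : Pushable p K' L) (hK : K ⊆ K') :
    Pushable p K L := by
  intro Φ hΦ ε R hε
  obtain ⟨Ψ, h1, h2, h3⟩ := h Φ hΦ ε R hε
  exact ⟨Ψ, h1, fun z hz => h2 z (hK hz), h3⟩

lemma pushable_empty (p : E →L[ℂ] ℂ) (K : Set E) : Pushable p K ∅ :=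
  fun Φ hΦ ε _ hε => ⟨Φ, hΦ, by simp [hε.le], by simp⟩

lemma Pushable.union {p : E →L[ℂ] ℂ} {K L L' : Set E} (h : Pushable p K L)
    (h' : Pushable p (K ∪ L) L') : Pushable p K (L ∪ L') := by
  intro Φ hΦ ε R hε
  obtain ⟨Φ₁, h1, h2, h3⟩ := h Φ hΦ (ε / 2) (R + ‖p‖ * (ε / 2)) (by linarith)
  obtain ⟨Φ₂, h1', h2', h3'⟩ := h' Φ₁ h1 (ε / 2) R (by linarith)
  refine ⟨Φ₂, h1', fun z hz => ?_, ?_⟩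
  · have := norm_sub_le_norm_sub_add_norm_sub (Φ₂ z) (Φ₁ z) (Φ z)
    linarith [h2 z hz, h2' z (Or.inl hz)]
  · rintro z (hz | hz)
    · have e1 := h3 z hz
      have e2 : ‖p (Φ₂ z - Φ₁ z)‖ ≤ ‖p‖ * (ε / 2) :=
        (p.le_opNorm _).trans (by gcongr; exact h2' z (Or.inr hz))
      have e3 := norm_sub_norm_le (p (Φ₁ z)) (p (Φ₂ z))
      rw [map_sub, norm_sub_rev] at e2
      linarith
    · exact h3' z hz

lemma isGrowingMap_id {p : E →L[ℂ] ℂ} (hp : p ≠ 0) : IsGrowingMap p (fun z => z) := by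
  refine ⟨differentiable_id, fun z => ?_, p, hp, fun R δ hδ => ⟨R / δ, fun z h1 h2 => ?_⟩⟩
  · rw [fderiv_fun_id, ContinuousLinearMap.det]
    simp
  · rw [div_le_iff₀ hδ] at h1
    linarith

end Shear

section Nets

variable {E : Type*} [NormedAddCommGroup E]

lemma exists_separated_subset (T : Finset E) (δ : ℝ) :
    ∃ X ⊆ T, (∀ u ∈ X, ∀ u' ∈ X, u ≠ u' → δ ≤ ‖u - u'‖) ∧
      ∀ x ∈ T, ∃ u ∈ X, u = x ∨ ‖x - u‖ ≤ δ := by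
  classical
  induction T using Finset.induction_on with
  | empty => exact ⟨∅, by simp⟩
  | insert t T ht ih =>
    obtain ⟨X, hXT, hsep, hcov⟩ := ih
    by_cases h : ∃ u ∈ X, ‖t - u‖ ≤ δ
    · refine ⟨X, hXT.trans (Finset.subset_insert _ _), hsep, fun x hx => ?_⟩
      rcases Finset.mem_insert.1 hx with rfl | hx
      · obtain ⟨u, hu, hu'⟩ := h
        exact ⟨u, hu, Or.inr hu'⟩
      · exact hcov x hx
    · push Not at h
      refine ⟨insert t X, Finset.insert_subset_insert _ hXT, ?_, fun x hx => ?_⟩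
      · intro u hu u' hu' hne
        rcases Finset.mem_insert.1 hu with h₁ | h₁ <;>
          rcases Finset.mem_insert.1 hu' with h₂ | h₂
        · exact absurd (h₁.trans h₂.symm) hne
        · rw [h₁]; exact (h u' h₂).le
        · rw [h₂, norm_sub_rev]; exact (h u h₁).le
        · exact hsep u h₁ u' h₂ hne
      · rcases Finset.mem_insert.1 hx with rfl | hx
        · exact ⟨x, Finset.mem_insert_self _ _, Or.inl rfl⟩
        · obtain ⟨u, hu, hu'⟩ := hcov x hx
          exact ⟨u, Finset.mem_insert_of_mem hu, hu'⟩

lemma exists_finite_net {S : Set E} (hS : IsCompact S) {δ : ℝ} (hδ : 0 < δ) :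
    ∃ T : Finset E, (∀ u ∈ T, u ∈ S) ∧ ∀ x ∈ S, ∃ u ∈ T, ‖x - u‖ ≤ δ := by
  obtain ⟨t, htS, htf, hcov⟩ := hS.finite_cover_balls hδ
  refine ⟨htf.toFinset, fun u hu => htS (by simpa using hu), fun x hx => ?_⟩
  obtain ⟨u, hu, hxu⟩ := Set.mem_iUnion₂.1 (hcov hx)
  rw [mem_ball_iff_norm] at hxu
  exact ⟨u, by simpa using hu, hxu.le⟩

/-- At every scale `σ`, the unit sphere has a net made of `m` separated families of points, where
`m` does not depend on the scale. -/
lemma exists_separated_nets [NormedSpace ℂ E] [FiniteDimensional ℂ E] :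
    ∃ m : ℕ, 0 < m ∧ ∀ σ : ℝ, 0 < σ → ∃ X : ℕ → Finset E,
      (∀ j, ∀ u ∈ X j, ‖u‖ = 1) ∧
      (∀ j, ∀ u ∈ X j, ∀ u' ∈ X j, u ≠ u' → 5 * σ ≤ ‖u - u'‖) ∧
      ∀ x : E, ‖x‖ = 1 → ∃ j < m, ∃ u ∈ X j, ‖x - u‖ ≤ σ / 4 := by
  classical
  have : ProperSpace E := FiniteDimensional.proper ℂ E
  obtain ⟨W, -, hW⟩ := exists_finite_net (isCompact_closedBall (0 : E) 2)
    (show (0 : ℝ) < 1 / 48 by norm_num)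
  obtain ⟨w, hw⟩ : ∃ w : ℕ → E, ∀ y ∈ W, ∃ j < W.card, w j = y := by
    refine ⟨fun j => if h : j < W.card then (W.equivFin.symm ⟨j, h⟩ : E) else 0, fun y hy => ?_⟩
    refine ⟨W.equivFin ⟨y, hy⟩, (W.equivFin ⟨y, hy⟩).2, ?_⟩
    simp
  refine ⟨W.card, ?_, fun σ hσ => ?_⟩
  · obtain ⟨u, hu, -⟩ := hW 0 (by simp)
    exact Finset.card_pos.2 ⟨u, hu⟩
  obtain ⟨T, hTS, hT⟩ := exists_finite_net (isCompact_sphere (0 : E) 1)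
    (show (0 : ℝ) < 6 * σ by linarith)
  obtain ⟨X₀, hX₀T, hsep, hcov⟩ := exists_separated_subset T (6 * σ)
  set P : ℕ → E → E → Prop :=
    fun j u x => ‖x‖ = 1 ∧ ‖x - (u + ((6 * σ : ℝ) : ℂ) • w j)‖ ≤ σ / 8
  have hex : ∀ j u, ∃ x, (∃ x', P j u x') → P j u x := by
    intro j u
    by_cases h : ∃ x', P j u x'
    · obtain ⟨x, hx⟩ := h
      exact ⟨x, fun _ => hx⟩
    · exact ⟨0, fun h' => absurd h' h⟩
  choose F hF using hex
  refine ⟨fun j => (X₀.filter (fun u => ∃ x', P j u x')).image (F j), ?_, ?_, ?_⟩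
  · intro j u hu
    obtain ⟨u₀, hu₀, rfl⟩ := Finset.mem_image.1 hu
    exact (hF j u₀ (Finset.mem_filter.1 hu₀).2).1
  · intro j x₁ hx₁ x₂ hx₂ hne
    obtain ⟨u₁, hu₁, rfl⟩ := Finset.mem_image.1 hx₁
    obtain ⟨u₂, hu₂, rfl⟩ := Finset.mem_image.1 hx₂
    obtain ⟨hu₁, h₁⟩ := Finset.mem_filter.1 hu₁
    obtain ⟨hu₂, h₂⟩ := Finset.mem_filter.1 hu₂
    have h3 := hsep u₁ hu₁ u₂ hu₂ (fun h => hne (by rw [h]))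
    have e1 := (hF j u₁ h₁).2
    have e2 := (hF j u₂ h₂).2
    set v := ((6 * σ : ℝ) : ℂ) • w j
    have e3 : ‖u₁ - u₂‖ ≤ ‖F j u₁ - F j u₂‖ + ‖F j u₂ - (u₂ + v)‖ + ‖F j u₁ - (u₁ + v)‖ := by
      have : u₁ - u₂ = (F j u₁ - F j u₂) + (F j u₂ - (u₂ + v)) - (F j u₁ - (u₁ + v)) := by abel
      rw [this]
      exact (norm_sub_le _ _).trans (by gcongr; exact norm_add_le _ _)
    linarith
  · intro x hx
    obtain ⟨t, ht, hxt⟩ := hT x (by simpa using hx)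
    obtain ⟨u, hu, htu⟩ := hcov t ht
    have hxu : ‖x - u‖ ≤ 12 * σ := by
      rcases htu with rfl | htu
      · linarith
      · linarith [norm_sub_le_norm_sub_add_norm_sub x t u]
    have hσ' : ((6 * σ : ℝ) : ℂ) ≠ 0 := by
      exact_mod_cast (by linarith : (6 * σ : ℝ) ≠ 0)
    have hnσ : ‖((6 * σ : ℝ) : ℂ)‖ = 6 * σ := by
      rw [Complex.norm_real, Real.norm_of_nonneg (by linarith)]
    obtain ⟨y, hy, hxy⟩ := hW ((((6 * σ : ℝ) : ℂ))⁻¹ • (x - u)) (by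
      rw [mem_closedBall_zero_iff, norm_smul, norm_inv, hnσ, inv_mul_le_iff₀ (by linarith)]
      linarith)
    obtain ⟨j, hj, rfl⟩ := hw y hy
    have hPx : P j u x := by
      refine ⟨hx, ?_⟩
      have : x - (u + ((6 * σ : ℝ) : ℂ) • w j) =
          ((6 * σ : ℝ) : ℂ) • ((((6 * σ : ℝ) : ℂ))⁻¹ • (x - u) - w j) := by
        rw [smul_sub, smul_smul, mul_inv_cancel₀ hσ', one_smul]
        abel
      rw [this, norm_smul, hnσ]
      calc 6 * σ * _ ≤ 6 * σ * (1 / 48) := by gcongr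
        _ = σ / 8 := by ring
    refine ⟨j, hj, F j u, Finset.mem_image_of_mem _ (Finset.mem_filter.2 ⟨hu, x, hPx⟩), ?_⟩
    have e1 := (hF j u ⟨x, hPx⟩).2
    have e2 := hPx.2
    have e3 := norm_sub_le_norm_sub_add_norm_sub x (u + ((6 * σ : ℝ) : ℂ) • w j) (F j u)
    rw [norm_sub_rev (u + _) (F j u)] at e3
    linarith

end Nets

section Discs

variable {E : Type*} [NormedAddCommGroup E] [InnerProductSpace ℂ E]

/-- The closed disc of radius `σ` and centre `s • u` in the affine real hyperplane which is tangent
at that point to the sphere of radius `s`. -/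
def tangentDisc (u : E) (s σ : ℝ) : Set E :=
  {z | (inner ℂ u z).re = s ∧ ‖z - (s : ℂ) • u‖ ≤ σ}

lemma norm_sub_real_smul_sq {u : E} (hu : ‖u‖ = 1) (s : ℝ) (z : E) :
    ‖z - (s : ℂ) • u‖ ^ 2 = ‖z‖ ^ 2 - 2 * s * (inner ℂ u z).re + s ^ 2 := by
  have h := norm_sub_sq (𝕜 := ℂ) z ((s : ℂ) • u)
  rw [norm_smul, hu, Complex.norm_real, Real.norm_eq_abs, mul_one, sq_abs, inner_smul_right] at h
  have h' : (inner ℂ z u).re = (inner ℂ u z).re := inner_re_symm (𝕜 := ℂ) z u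
  rw [h, ← h']
  simp
  ring

lemma norm_sq_of_mem_tangentDisc {u : E} (hu : ‖u‖ = 1) {s σ : ℝ} {z : E}
    (hz : z ∈ tangentDisc u s σ) : ‖z‖ ^ 2 = s ^ 2 + ‖z - (s : ℂ) • u‖ ^ 2 := by
  rw [norm_sub_real_smul_sq hu, hz.1]
  ring

lemma isCompact_tangentDisc [FiniteDimensional ℂ E] (u : E) (s σ : ℝ) :
    IsCompact (tangentDisc u s σ) := by
  have : ProperSpace E := FiniteDimensional.proper ℂ E
  refine (isCompact_closedBall ((s : ℂ) • u) σ).of_isClosed_subset ?_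
    fun z hz => mem_closedBall_iff_norm.2 hz.2
  have h1 : Continuous fun z : E => (inner ℂ u z).re := by fun_prop
  have h2 : Continuous fun z : E => ‖z - (s : ℂ) • u‖ := by fun_prop
  exact (isClosed_eq h1 continuous_const).inter (isClosed_le h2 continuous_const)

lemma pushable_layer [FiniteDimensional ℂ E] (hE : 1 < Module.finrank ℂ E) (p : E →L[ℂ] ℂ)
    {r s σ : ℝ} (hσ : 0 < σ) (hs : 1 / 2 ≤ s) (hs1 : s ≤ 1) (hr : r ≤ s - σ ^ 2) (X : Finset E)
    (hX : ∀ u ∈ X, ‖u‖ = 1) (hsep : ∀ u ∈ X, ∀ u' ∈ X, u ≠ u' → 5 * σ ≤ ‖u - u'‖) :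
    Pushable p (closedBall 0 r) (⋃ u ∈ X, tangentDisc u s σ) := by
  classical
  have : ProperSpace E := FiniteDimensional.proper ℂ E
  induction X using Finset.induction_on with
  | empty => simpa using pushable_empty p _
  | insert u X huX ih =>
    rw [Finset.set_biUnion_insert, Set.union_comm]
    refine (ih (fun u hu => hX u (Finset.mem_insert_of_mem hu)) (fun u hu u' hu' =>
      hsep u (Finset.mem_insert_of_mem hu) u' (Finset.mem_insert_of_mem hu'))).union ?_
    have hu1 := hX u (Finset.mem_insert_self _ _)
    refine pushable_of_separated hE (ℓ₁ := innerSL ℂ u) (c := s - σ ^ 2 / 2) (c' := s)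
      ((isCompact_closedBall _ _).union
        (X.isCompact_biUnion fun u' _ => isCompact_tangentDisc u' s σ))
      (isCompact_tangentDisc u s σ) ?_ (by linarith [sq_pos_of_pos hσ]) ?_ ?_
    · intro h
      have := congrArg (fun L : E →L[ℂ] ℂ => L u) h
      simp [hu1] at this
    · rintro z (hz | hz)
      · rw [mem_closedBall_zero_iff] at hz
        have h1 : (inner ℂ u z).re ≤ ‖u‖ * ‖z‖ :=
          (Complex.re_le_norm _).trans (norm_inner_le_norm _ _)
        rw [hu1, one_mul] at h1
        rw [innerSL_apply_apply]
        linarith [sq_pos_of_pos hσ]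
      · obtain ⟨u', hu', hz⟩ := Set.mem_iUnion₂.1 hz
        have hu'1 := hX u' (Finset.mem_insert_of_mem hu')
        have h1 := hsep u (Finset.mem_insert_self _ _) u' (Finset.mem_insert_of_mem hu')
          (fun h => huX (h ▸ hu'))
        have h2 := norm_sq_of_mem_tangentDisc hu'1 hz
        have h3 := norm_sub_real_smul_sq hu1 s z
        have h4 : s * ‖u - u'‖ ≤ ‖z - (s : ℂ) • u‖ + ‖z - (s : ℂ) • u'‖ := by
          have : s * ‖u - u'‖ = ‖(z - (s : ℂ) • u') - (z - (s : ℂ) • u)‖ := by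
            rw [sub_sub_sub_cancel_left, ← smul_sub, norm_smul, Complex.norm_real,
              Real.norm_of_nonneg (by linarith)]
          rw [this, add_comm]
          exact norm_sub_le _ _
        have h5 := hz.2
        have h6 : 3 / 2 * σ ≤ ‖z - (s : ℂ) • u‖ := by nlinarith
        have h7 : (3 / 2 * σ) ^ 2 ≤ ‖z - (s : ℂ) • u‖ ^ 2 := by gcongr
        have h8 : ‖z - (s : ℂ) • u'‖ ^ 2 ≤ σ ^ 2 := by gcongr
        rw [innerSL_apply_apply]
        by_contra! h9
        nlinarith [mul_lt_mul_of_pos_left h9 (show 0 < 2 * s by linarith), sq_nonneg σ]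
    · intro z hz
      rw [innerSL_apply_apply, hz.1]

lemma norm_le_of_mem_tangentDisc {u : E} (hu : ‖u‖ = 1) {s σ τ : ℝ} (hs : 1 / 2 ≤ s)
    (hτ0 : 0 < τ) (hτ : 2 * σ ^ 2 ≤ τ) {z : E} (hz : z ∈ tangentDisc u s σ) :
    ‖z‖ ≤ s + τ / 2 := by
  have h1 := norm_sq_of_mem_tangentDisc hu hz
  have h2 : ‖z - (s : ℂ) • u‖ ^ 2 ≤ σ ^ 2 := by
    have := hz.2
    gcongr
  apply le_of_sq_le_sq _ (by linarith)
  nlinarith [mul_le_mul_of_nonneg_right hs hτ0.le]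

lemma iUnion_tangentDisc_subset {a σ τ : ℝ} (ha : 1 / 2 ≤ a) (hτ0 : 0 < τ) (hτ : 2 * σ ^ 2 ≤ τ)
    {X : ℕ → Finset E} (hX : ∀ j, ∀ u ∈ X j, ‖u‖ = 1) (k : ℕ) :
    (⋃ j < k, ⋃ u ∈ X j, tangentDisc u (a + j * τ + τ / 2) σ) ⊆ closedBall 0 (a + k * τ) := by
  intro z hz
  simp only [Set.mem_iUnion] at hz
  obtain ⟨j, hj, u, hu, hz⟩ := hz
  have h0 : 0 ≤ j * τ := by positivity
  have h1 := norm_le_of_mem_tangentDisc (hX j u hu) (by linarith) hτ0 hτ hz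
  have h2 : ((j : ℝ) + 1) * τ ≤ k * τ := by
    gcongr
    exact_mod_cast hj
  rw [mem_closedBall_zero_iff]
  linarith

lemma pushable_layers [FiniteDimensional ℂ E] (hE : 1 < Module.finrank ℂ E) (p : E →L[ℂ] ℂ)
    {a σ τ : ℝ} (hσ : 0 < σ) (ha : 1 / 2 ≤ a) (hτ0 : 0 < τ) (hτ : 2 * σ ^ 2 ≤ τ)
    {X : ℕ → Finset E} (hX : ∀ j, ∀ u ∈ X j, ‖u‖ = 1)
    (hsep : ∀ j, ∀ u ∈ X j, ∀ u' ∈ X j, u ≠ u' → 5 * σ ≤ ‖u - u'‖) (k : ℕ)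
    (hk : a + k * τ ≤ 1) :
    Pushable p (closedBall 0 a) (⋃ j < k, ⋃ u ∈ X j, tangentDisc u (a + j * τ + τ / 2) σ) := by
  induction k with
  | zero => simpa using pushable_empty p _
  | succ k ih =>
    push_cast at hk
    have h0 : 0 ≤ k * τ := by positivity
    rw [Set.biUnion_lt_succ]
    refine (ih (by linarith)).union ?_
    refine (pushable_layer hE p (r := a + k * τ) hσ (by linarith) (by linarith) (by linarith)
      (X k) (hX k) (hsep k)).mono ?_
    refine Set.union_subset (closedBall_subset_closedBall (by linarith)) ?_
    exact iUnion_tangentDisc_subset ha hτ0 hτ hX k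

/-- A path crossing all the layers while avoiding the discs moves away from its starting point. -/
lemma exists_le_norm_sub_of_crossing {a σ τ : ℝ} {m : ℕ} (hσ : 0 < σ) (ha : 1 / 2 ≤ a)
    (ha1 : a ≤ 1) (hτ0 : 0 < τ) (hτ : 2 * σ ^ 2 ≤ τ) (hm : m * τ ≤ σ / 4)
    {X : ℕ → Finset E} (hX : ∀ j, ∀ u ∈ X j, ‖u‖ = 1)
    (hcov : ∀ x : E, ‖x‖ = 1 → ∃ j < m, ∃ u ∈ X j, ‖x - u‖ ≤ σ / 4)
    {γ : ℝ → E} {t₀ t₁ : ℝ} (ht : t₀ ≤ t₁) (hγ : ContinuousOn γ (Icc t₀ t₁))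
    (h₀ : ‖γ t₀‖ = a) (h₁ : ‖γ t₁‖ = a + m * τ)
    (havoid : ∀ t ∈ Icc t₀ t₁,
      γ t ∉ ⋃ j < m, ⋃ u ∈ X j, tangentDisc u (a + j * τ + τ / 2) σ) :
    ∃ t ∈ Icc t₀ t₁, σ / 4 ≤ ‖γ t - γ t₀‖ := by
  by_contra! hlt
  have ha0 : 0 < a := by linarith
  have hac : (a : ℂ) ≠ 0 := by exact_mod_cast ha0.ne'
  have hna : ‖(a : ℂ)‖ = a := by rw [Complex.norm_real, Real.norm_of_nonneg ha0.le]
  obtain ⟨j, hj, u, hu, hxu⟩ := hcov ((a : ℂ)⁻¹ • γ t₀) (by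
    rw [norm_smul, norm_inv, hna, h₀, inv_mul_cancel₀ ha0.ne'])
  have hu1 := hX j u hu
  set s := a + j * τ + τ / 2 with hs
  have hj0 : 0 ≤ j * τ := by positivity
  have hjm : ((j : ℝ) + 1) * τ ≤ m * τ := by
    gcongr
    exact_mod_cast hj
  have hdist : ∀ t ∈ Icc t₀ t₁, ‖γ t - (s : ℂ) • u‖ ≤ σ := by
    intro t ht
    have e1 : ‖γ t₀ - (a : ℂ) • u‖ ≤ σ / 4 := by
      have : γ t₀ - (a : ℂ) • u = (a : ℂ) • ((a : ℂ)⁻¹ • γ t₀ - u) := by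
        rw [smul_sub, smul_smul, mul_inv_cancel₀ hac, one_smul]
      rw [this, norm_smul, hna]
      nlinarith [norm_nonneg ((a : ℂ)⁻¹ • γ t₀ - u)]
    have e2 : ‖(a : ℂ) • u - (s : ℂ) • u‖ = s - a := by
      rw [← sub_smul, norm_smul, hu1, mul_one, norm_sub_rev, ← Complex.ofReal_sub,
        Complex.norm_real, Real.norm_of_nonneg (by linarith)]
    have e3 := norm_sub_le_norm_sub_add_norm_sub (γ t) (γ t₀) ((s : ℂ) • u)
    have e4 := norm_sub_le_norm_sub_add_norm_sub (γ t₀) ((a : ℂ) • u) ((s : ℂ) • u)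
    linarith [hlt t ht]
  have hcont : ContinuousOn (fun t => (inner ℂ u (γ t)).re) (Icc t₀ t₁) := by
    fun_prop
  obtain ⟨t, ht', hts⟩ := intermediate_value_Icc ht hcont (show s ∈ Icc _ _ by
    constructor
    · have h2 : (inner ℂ u (γ t₀)).re ≤ ‖u‖ * ‖γ t₀‖ :=
        (Complex.re_le_norm _).trans (norm_inner_le_norm _ _)
      rw [hu1, h₀] at h2
      linarith
    · have h2 := norm_sub_real_smul_sq hu1 s (γ t₁)
      have h3 : ‖γ t₁ - (s : ℂ) • u‖ ^ 2 ≤ σ ^ 2 := by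
        have := hdist t₁ (right_mem_Icc.2 ht)
        gcongr
      have h4 : (s + τ / 2) ^ 2 ≤ ‖γ t₁‖ ^ 2 := by
        rw [h₁]
        exact pow_le_pow_left₀ (by linarith) (by linarith) 2
      by_contra! h5
      nlinarith [mul_lt_mul_of_pos_left h5 (show 0 < 2 * s by linarith)])
  refine havoid t ht' ?_
  simp only [Set.mem_iUnion]
  exact ⟨j, hj, u, hu, hts, hdist t ht'⟩

end Discs

section Labyrinth

/-- In an increasing sequence of spherical shells exhausting the unit ball there are pushable
obstacles `D g` such that every path which crosses the `g`-th shell and avoids `D g` has length at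
least `κ g`, where `∑ κ g` diverges. -/
lemma exists_labyrinth_s13 {E : Type*} [NormedAddCommGroup E] [InnerProductSpace ℂ E]
    [FiniteDimensional ℂ E] (hE : 1 < Module.finrank ℂ E) (p : E →L[ℂ] ℂ) :
    ∃ (a κ : ℕ → ℝ) (D : ℕ → Set E), StrictMono a ∧ (∀ g, a g < 1) ∧
      Filter.Tendsto a Filter.atTop (nhds 1) ∧ (∀ g, 0 ≤ κ g) ∧ ¬ Summable κ ∧
      (∀ g, Pushable p (closedBall 0 (a g)) (D g)) ∧
      (∀ g, D g ⊆ closedBall 0 (a (g + 1))) ∧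
      ∀ (g : ℕ) (γ : ℝ → E) (t₀ t₁ : ℝ), t₀ ≤ t₁ → ContinuousOn γ (Icc t₀ t₁) → ‖γ t₀‖ = a g →
        ‖γ t₁‖ = a (g + 1) → (∀ t ∈ Icc t₀ t₁, γ t ∉ D g) →
        ∃ t ∈ Icc t₀ t₁, κ g ≤ ‖γ t - γ t₀‖ := by
  obtain ⟨m, hm, hnets⟩ := exists_separated_nets (E := E)
  have hm' : (1 : ℝ) ≤ m := by exact_mod_cast hm
  have hm0 : (0 : ℝ) < m := by linarith
  set a : ℕ → ℝ := fun g => 1 - 1 / (32 * m * (g + 1)) with ha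
  set σ : ℕ → ℝ := fun g => 1 / (8 * m * (g + 2)) with hσ
  set τ : ℕ → ℝ := fun g => 1 / (32 * m ^ 2 * (g + 1) * (g + 2)) with hτ
  have hσ0 : ∀ g, 0 < σ g := fun g => by simp only [hσ]; positivity
  have hτ0 : ∀ g, 0 < τ g := fun g => by simp only [hτ]; positivity
  have hστ : ∀ g, 2 * σ g ^ 2 ≤ τ g := fun g => by
    have : 2 * σ g ^ 2 = 1 / (32 * m ^ 2 * (g + 2) * (g + 2)) := by
      simp only [hσ]
      field_simp
      norm_num
    rw [this]
    simp only [hτ]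
    gcongr
    norm_num
  have hmτ : ∀ g, m * τ g ≤ σ g / 4 := fun g => by
    have e1 : m * τ g = 1 / (32 * m * (g + 2)) / (g + 1) := by
      simp only [hτ]
      field_simp
    have e2 : σ g / 4 = 1 / (32 * m * (g + 2)) := by
      simp only [hσ]
      field_simp
      norm_num
    rw [e1, e2]
    exact div_le_self (by positivity) (by linarith [(Nat.cast_nonneg g : (0 : ℝ) ≤ g)])
  have ha_succ : ∀ g, a (g + 1) = a g + m * τ g := fun g => by
    simp only [ha, hτ]
    push_cast
    field_simp
    ring
  have ha1 : ∀ g, a g < 1 := fun g => by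
    have : (0 : ℝ) < 1 / (32 * m * (g + 1)) := by positivity
    simp only [ha]
    linarith
  have ha2 : ∀ g, 1 / 2 ≤ a g := fun g => by
    have : (1 : ℝ) / (32 * m * (g + 1)) ≤ 1 / 2 := by
      apply one_div_le_one_div_of_le two_pos
      have : (0 : ℝ) ≤ m * g := by positivity
      nlinarith
    simp only [ha]
    linarith
  choose X hX hsep hcov using fun g => hnets (σ g) (hσ0 g)
  refine ⟨a, fun g => σ g / 4,
    fun g => ⋃ j < m, ⋃ u ∈ X g j, tangentDisc u (a g + j * τ g + τ g / 2) (σ g),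
    strictMono_nat_of_lt_succ fun g => ?_, ha1, ?_, fun g => by linarith [hσ0 g], ?_,
    fun g => ?_, fun g => ?_, ?_⟩
  · rw [ha_succ]
    have := mul_pos hm0 (hτ0 g)
    linarith
  · have h1 := (tendsto_one_div_add_atTop_nhds_zero_nat (𝕜 := ℝ)).const_mul (1 / (32 * (m : ℝ)))
    have h2 := h1.const_sub 1
    simp only [mul_zero, sub_zero] at h2
    refine h2.congr fun g => ?_
    simp only [ha]
    field_simp
  · intro h
    have h1 := h.mul_left (32 * (m : ℝ))
    have h2 : (fun g : ℕ => 32 * (m : ℝ) * (σ g / 4)) = fun g : ℕ => 1 / ((g + 2 : ℕ) : ℝ) := by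
      ext g
      simp only [hσ]
      push_cast
      field_simp
      norm_num
    rw [h2, summable_nat_add_iff 2 (f := fun g : ℕ => 1 / (g : ℝ))] at h1
    exact Real.not_summable_one_div_natCast h1
  · refine pushable_layers hE p (hσ0 g) (ha2 g) (hτ0 g) (hστ g) (hX g) (hsep g) m ?_
    rw [← ha_succ]
    exact (ha1 _).le
  · rw [ha_succ]
    exact iUnion_tangentDisc_subset (ha2 g) (hτ0 g) (hστ g) (hX g) m
  · intro g γ t₀ t₁ ht hγ h₀ h₁ havoid
    rw [ha_succ] at h₁
    exact exists_le_norm_sub_of_crossing (hσ0 g) (ha2 g) (ha1 g).le (hτ0 g) (hστ g) (hmτ g)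
      (hX g) (hcov g) ht hγ h₀ h₁ havoid

/-- A divergent path in the unit ball which avoids almost all obstacles of a labyrinth has infinite
length. -/
lemma eVariationOn_eq_top_of_avoids {E : Type*} [NormedAddCommGroup E] [ProperSpace E]
    {a κ : ℕ → ℝ} {D : ℕ → Set E} (ha : StrictMono a) (ha1 : ∀ g, a g < 1)
    (hκ : ∀ g, 0 ≤ κ g) (hκs : ¬ Summable κ)
    (hcross : ∀ (g : ℕ) (γ : ℝ → E) (t₀ t₁ : ℝ), t₀ ≤ t₁ → ContinuousOn γ (Icc t₀ t₁) →
      ‖γ t₀‖ = a g → ‖γ t₁‖ = a (g + 1) → (∀ t ∈ Icc t₀ t₁, γ t ∉ D g) →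
      ∃ t ∈ Icc t₀ t₁, κ g ≤ ‖γ t - γ t₀‖)
    {γ : ℝ → E} (hγ : DivergentPathIn (ball (0 : E) 1) γ) (g₀ : ℕ) (hg₀ : ‖γ 0‖ ≤ a g₀)
    (havoid : ∀ g ≥ g₀, ∀ t ∈ Ico (0 : ℝ) 1, γ t ∉ D g) :
    eVariationOn γ (Ico 0 1) = ⊤ := by
  obtain ⟨hc, -, hdiv⟩ := hγ
  -- from any point with smaller norm, the path reaches the sphere of radius `a g`
  have hreach : ∀ t ∈ Ico (0 : ℝ) 1, ∀ g, ‖γ t‖ ≤ a g →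
      ∃ t' ∈ Ico (0 : ℝ) 1, t ≤ t' ∧ ‖γ t'‖ = a g := by
    intro t ht g hg
    obtain ⟨T, hT, hout⟩ := hdiv (closedBall 0 (a g)) (closedBall_subset_ball (ha1 g))
      (isCompact_closedBall _ _)
    have hmax : max t T ∈ Ico (0 : ℝ) 1 := ⟨le_max_of_le_left ht.1, max_lt ht.2 hT.2⟩
    have h1 := hout (max t T) ⟨le_max_right _ _, hmax.2⟩
    rw [mem_closedBall_zero_iff, not_le] at h1
    have hsub : Icc t (max t T) ⊆ Ico 0 1 := fun x hx => ⟨ht.1.trans hx.1, hx.2.trans_lt hmax.2⟩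
    obtain ⟨t', ht', h2⟩ := intermediate_value_Icc (le_max_left t T) (hc.norm.mono hsub)
      ⟨hg, h1.le⟩
    exact ⟨t', hsub ht', ht'.1, h2⟩
  have key : ∀ k : ℕ, ∃ t ∈ Ico (0 : ℝ) 1, ‖γ t‖ = a (g₀ + k) ∧
      ENNReal.ofReal (∑ i ∈ Finset.range k, κ (g₀ + i)) ≤ eVariationOn γ (Icc 0 t) := by
    intro k
    induction k with
    | zero =>
      obtain ⟨t, ht, -, h⟩ := hreach 0 (by simp) g₀ hg₀
      exact ⟨t, ht, by simpa using h, by simp⟩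
    | succ k ih =>
      obtain ⟨t, ht, hnorm, hsum⟩ := ih
      obtain ⟨t', ht', htt', hnorm'⟩ := hreach t ht (g₀ + (k + 1)) (by
        rw [hnorm]; exact ha.monotone (by omega))
      have hsub : Icc t t' ⊆ Ico 0 1 := fun x hx => ⟨ht.1.trans hx.1, hx.2.trans_lt ht'.2⟩
      obtain ⟨x, hx, hκx⟩ := hcross (g₀ + k) γ t t' htt' (hc.mono hsub) hnorm hnorm'
        fun x hx => havoid _ (by omega) x (hsub hx)
      refine ⟨t', ht', hnorm', ?_⟩
      have h1 := eVariationOn.Icc_add_Icc γ (s := univ) ht.1 htt' (mem_univ t)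
      simp only [univ_inter] at h1
      rw [Finset.sum_range_succ, ENNReal.ofReal_add (Finset.sum_nonneg fun i _ => hκ _) (hκ _),
        ← h1]
      refine add_le_add hsum ?_
      refine le_trans ?_ (eVariationOn.edist_le γ hx (left_mem_Icc.2 htt'))
      rw [edist_dist, dist_eq_norm]
      exact ENNReal.ofReal_le_ofReal hκx
  have hκs' : ¬ Summable fun i => κ (g₀ + i) := by
    simpa only [add_comm g₀, summable_nat_add_iff g₀] using hκs
  have htend := (not_summable_iff_tendsto_nat_atTop_of_nonneg fun i => hκ (g₀ + i)).1 hκs'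
  refine ENNReal.eq_top_of_forall_nnreal_le fun r => ?_
  obtain ⟨k, hk⟩ := (htend.eventually_ge_atTop (r : ℝ)).exists
  obtain ⟨t, ht, -, hsum⟩ := key k
  calc (r : ℝ≥0∞) = ENNReal.ofReal (r : ℝ) := (ENNReal.ofReal_coe_nnreal).symm
    _ ≤ ENNReal.ofReal (∑ i ∈ Finset.range k, κ (g₀ + i)) := ENNReal.ofReal_le_ofReal hk
    _ ≤ eVariationOn γ (Icc 0 t) := hsum
    _ ≤ eVariationOn γ (Ico 0 1) :=
      eVariationOn.mono γ fun x hx => ⟨hx.1, hx.2.trans_lt ht.2⟩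

end Labyrinth

section Limit

/-- A uniform limit of entire maps on a ball is differentiable at the centre, and the derivatives
there converge. -/
lemma differentiableAt_and_tendsto_fderiv {E F : Type*} [NormedAddCommGroup E] [NormedSpace ℂ E]
    [NormedAddCommGroup F] [NormedSpace ℂ F] [CompleteSpace F] {f : ℕ → E → F} {f₀ : E → F} {x : E}
    {r : ℝ} (hr : 0 < r) (hf : ∀ n, Differentiable ℂ (f n))
    (hlim : TendstoUniformlyOn f f₀ Filter.atTop (ball x (2 * r))) :
    DifferentiableAt ℂ f₀ x ∧
      Filter.Tendsto (fun n => fderiv ℂ (f n) x) Filter.atTop (nhds (fderiv ℂ f₀ x)) := by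
  have hsub : ∀ y ∈ ball x r, ball y r ⊆ ball x (2 * r) := fun y hy =>
    ball_subset_ball' (by rw [mem_ball] at hy; linarith)
  have hcauchy : UniformCauchySeqOn (fun n => fderiv ℂ (f n)) Filter.atTop (ball x r) := by
    rw [Metric.uniformCauchySeqOn_iff]
    intro ε hε
    obtain ⟨N, hN⟩ := Metric.uniformCauchySeqOn_iff.1 hlim.uniformCauchySeqOn (ε * r / 4)
      (by positivity)
    refine ⟨N, fun m hm n hn y hy => ?_⟩
    have h1 : ∀ z ∈ ball y r, ‖(f m - f n) z‖ ≤ ε * r / 4 := fun z hz => by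
      have := (hN m hm n hn z (hsub y hy hz)).le
      rwa [dist_eq_norm] at this
    have h2 : MapsTo (f m - f n) (ball y r) (closedBall ((f m - f n) y) (ε * r / 2)) := by
      intro z hz
      rw [mem_closedBall_iff_norm]
      have := norm_sub_le ((f m - f n) z) ((f m - f n) y)
      have := h1 z hz
      have := h1 y (mem_ball_self hr)
      linarith
    have h3 := Complex.norm_fderiv_le_div_of_mapsTo_ball
      ((hf m).sub (hf n)).differentiableOn h2 hr
    rw [fderiv_sub (hf m y) (hf n y)] at h3
    rw [dist_eq_norm]
    refine h3.trans_lt ?_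
    rw [div_lt_iff₀ hr]
    nlinarith [mul_pos hε hr]
  have hpt : ∀ y ∈ ball x r, ∃ L, Filter.Tendsto (fun n => fderiv ℂ (f n) y) Filter.atTop
      (nhds L) := fun y hy => cauchySeq_tendsto_of_complete (hcauchy.cauchySeq hy)
  choose! G hG using hpt
  have h1 := hasFDerivAt_of_tendstoUniformlyOn isOpen_ball
    (hcauchy.tendstoUniformlyOn_of_tendsto hG) (fun n y _ => (hf n y).hasFDerivAt)
    (fun y hy => hlim.tendsto_at (ball_subset_ball (by linarith) hy)) (x := x) (mem_ball_self hr)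
  refine ⟨h1.differentiableAt, ?_⟩
  rw [h1.fderiv]
  exact hG x (mem_ball_self hr)

lemma exists_volume_preserving_complete_coordinate {E : Type*} [NormedAddCommGroup E]
    [InnerProductSpace ℂ E] [FiniteDimensional ℂ E] (hE : 1 < Module.finrank ℂ E) {p : E →L[ℂ] ℂ}
    (hp : p ≠ 0) :
    ∃ Φ : E → E, (∀ z ∈ ball (0 : E) 1, DifferentiableAt ℂ Φ z ∧ (fderiv ℂ Φ z).det = 1) ∧
      ∀ γ : ℝ → E, DivergentPathIn (ball (0 : E) 1) γ → ∀ c : ℂ,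
        (∀ t ∈ Ico (0 : ℝ) 1, p (Φ (γ t)) = c) → eVariationOn γ (Ico 0 1) = ⊤ := by
  have : ProperSpace E := FiniteDimensional.proper ℂ E
  obtain ⟨a, κ, D, ha, ha1, halim, hκ, hκs, hpush, hD, hcross⟩ := exists_labyrinth_s13 hE p
  have hstep : ∀ (g : ℕ) (Φ : {Φ : E → E // IsGrowingMap p Φ}),
      ∃ Ψ : {Φ : E → E // IsGrowingMap p Φ},
        (∀ z ∈ closedBall (0 : E) (a g), ‖Ψ.1 z - Φ.1 z‖ ≤ (1 / 2) ^ g) ∧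
          ∀ z ∈ D g, (g : ℝ) ≤ ‖p (Ψ.1 z)‖ := by
    intro g Φ
    obtain ⟨Ψ, h1, h2, h3⟩ := hpush g Φ.1 Φ.2 ((1 / 2) ^ g) g (by positivity)
    exact ⟨⟨Ψ, h1⟩, h2, h3⟩
  choose S hS hSD using hstep
  set G : ℕ → {Φ : E → E // IsGrowingMap p Φ} :=
    fun k => Nat.rec ⟨fun z => z, isGrowingMap_id hp⟩ S k with hG
  have hGsucc : ∀ k, G (k + 1) = S k (G k) := fun k => rfl
  have hclose : ∀ g k, ∀ z ∈ closedBall (0 : E) (a g),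
      dist ((G (g + k)).1 z) ((G (g + (k + 1))).1 z) ≤ (1 / 2) ^ g * (1 / 2) ^ k := by
    intro g k z hz
    rw [dist_comm, dist_eq_norm, ← pow_add, ← add_assoc, hGsucc]
    exact hS (g + k) _ z (closedBall_subset_closedBall (ha.monotone (by omega)) hz)
  have hball : ∀ r < 1, ∃ g₀, ∀ g ≥ g₀, r < a g := fun r hr => by
    simpa [Filter.eventually_atTop] using halim.eventually (lt_mem_nhds hr)
  have hex : ∀ z ∈ ball (0 : E) 1, ∃ w, Filter.Tendsto (fun k => (G k).1 z) Filter.atTop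
      (nhds w) := by
    intro z hz
    rw [mem_ball_zero_iff] at hz
    obtain ⟨g, hg⟩ := hball _ hz
    have h1 := cauchySeq_of_le_geometric (1 / 2) ((1 / 2) ^ g) (by norm_num)
      (fun k => hclose g k z (mem_closedBall_zero_iff.2 (hg g le_rfl).le))
    obtain ⟨w, hw⟩ := cauchySeq_tendsto_of_complete h1
    refine ⟨w, (Filter.tendsto_add_atTop_iff_nat g).1 ?_⟩
    simpa only [add_comm] using hw
  choose! Φ hΦ using hex
  have hdist : ∀ g, ∀ z ∈ closedBall (0 : E) (a g), dist ((G g).1 z) (Φ z) ≤ 2 * (1 / 2) ^ g := by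
    intro g z hz
    have h1 : Filter.Tendsto (fun k => (G (g + k)).1 z) Filter.atTop (nhds (Φ z)) := by
      have := (Filter.tendsto_add_atTop_iff_nat g).2 (hΦ z (closedBall_subset_ball (ha1 g) hz))
      simpa only [add_comm] using this
    have h2 := dist_le_of_le_geometric_of_tendsto₀ (1 / 2) ((1 / 2) ^ g) (by norm_num)
      (fun k => hclose g k z hz) h1
    simp only [add_zero] at h2
    exact h2.trans_eq (by norm_num; ring)
  refine ⟨Φ, fun z hz => ?_, fun γ hγ c hc => ?_⟩
  · rw [mem_ball_zero_iff] at hz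
    have hr : 0 < (1 - ‖z‖) / 4 := by linarith
    obtain ⟨g₀, hg₀⟩ := hball ((1 + ‖z‖) / 2) (by linarith)
    have hlim : TendstoUniformlyOn (fun k => (G k).1) Φ Filter.atTop
        (ball z (2 * ((1 - ‖z‖) / 4))) := by
      rw [Metric.tendstoUniformlyOn_iff]
      intro ε hε
      obtain ⟨N, hN⟩ := exists_pow_lt_of_lt_one (show 0 < ε / 2 by linarith)
        (show (1 / 2 : ℝ) < 1 by norm_num)
      filter_upwards [Filter.eventually_ge_atTop (max g₀ N)] with g hg w hw
      rw [dist_comm]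
      refine (hdist g w ?_).trans_lt ?_
      · rw [mem_ball_iff_norm] at hw
        rw [mem_closedBall_zero_iff]
        have := hg₀ g ((le_max_left _ _).trans hg)
        have := norm_sub_norm_le w z
        linarith
      · have : (1 / 2 : ℝ) ^ g ≤ (1 / 2) ^ N :=
          pow_le_pow_of_le_one (by norm_num) (by norm_num) ((le_max_right _ _).trans hg)
        linarith
    obtain ⟨h1, h2⟩ := differentiableAt_and_tendsto_fderiv hr (fun k => (G k).2.1) hlim
    refine ⟨h1, ?_⟩
    have h3 := (ContinuousLinearMap.continuous_det.tendsto _).comp h2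
    refine tendsto_nhds_unique h3 (tendsto_const_nhds.congr fun k => ?_)
    exact ((G k).2.2.1 z).symm
  · have hlarge : ∀ g, ∀ z ∈ D g, (g : ℝ) - 2 * ‖p‖ ≤ ‖p (Φ z)‖ := by
      intro g z hz
      have h1 : (g : ℝ) ≤ ‖p ((G (g + 1)).1 z)‖ := hSD g (G g) z hz
      have h2 := hdist (g + 1) z (hD g hz)
      have h3 : (1 / 2 : ℝ) ^ (g + 1) ≤ 1 := pow_le_one₀ (by norm_num) (by norm_num)
      rw [dist_eq_norm] at h2
      have h4 := p.le_opNorm ((G (g + 1)).1 z - Φ z)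
      rw [map_sub] at h4
      have h5 := norm_sub_norm_le (p ((G (g + 1)).1 z)) (p (Φ z))
      have h6 : ‖p‖ * ‖(G (g + 1)).1 z - Φ z‖ ≤ ‖p‖ * 2 := by
        gcongr
        linarith
      linarith
    have h0 := hγ.2.1 0 (by simp)
    rw [mem_ball_zero_iff] at h0
    obtain ⟨g₁, hg₁⟩ := hball _ h0
    obtain ⟨g₂, hg₂⟩ := exists_nat_gt (‖c‖ + 2 * ‖p‖)
    refine eVariationOn_eq_top_of_avoids ha ha1 hκ hκs hcross hγ (max g₁ g₂)
      (hg₁ _ (le_max_left _ _)).le fun g hg t ht hmem => ?_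
    have h1 := hlarge g _ hmem
    rw [hc t ht] at h1
    have h2 : (g₂ : ℝ) ≤ g := by exact_mod_cast (le_max_right _ _).trans hg
    linarith

end Limit

/-- Alarcón: a nonsingular holomorphic submersion foliation of 𝔹ₙ by complete closed complex
submanifolds of codimension `q`, for any `1 ≤ q < n`. -/
theorem alarcon_submersion_foliation_complete_fibres (n q : ℕ) (hq : 1 ≤ q) (hqn : q < n) :
    ∃ f : EuclideanSpace ℂ (Fin n) → EuclideanSpace ℂ (Fin q),
      DifferentiableOn ℂ f (Metric.ball (0 : EuclideanSpace ℂ (Fin n)) 1) ∧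
      (∀ z ∈ Metric.ball (0 : EuclideanSpace ℂ (Fin n)) 1,
        Function.Surjective (fderiv ℂ f z)) ∧
      (∀ γ : ℝ → EuclideanSpace ℂ (Fin n),
        DivergentPathIn (Metric.ball (0 : EuclideanSpace ℂ (Fin n)) 1) γ →
        (∃ c : EuclideanSpace ℂ (Fin q), ∀ t ∈ Set.Ico (0 : ℝ) 1, f (γ t) = c) →
        eVariationOn γ (Set.Ico 0 1) = ⊤) := by
  have hn : 0 < n := by omega
  set p : EuclideanSpace ℂ (Fin n) →L[ℂ] ℂ := EuclideanSpace.proj ⟨0, hn⟩ with hp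
  have hp0 : p ≠ 0 := by
    intro h
    have := congrArg (fun L : EuclideanSpace ℂ (Fin n) →L[ℂ] ℂ =>
      L (EuclideanSpace.single ⟨0, hn⟩ 1)) h
    simp [hp] at this
  obtain ⟨Φ, hΦ, hpath⟩ := exists_volume_preserving_complete_coordinate
    (E := EuclideanSpace ℂ (Fin n)) (by simp; omega) hp0
  set P : EuclideanSpace ℂ (Fin n) →L[ℂ] EuclideanSpace ℂ (Fin q) :=
    ((EuclideanSpace.equiv (Fin q) ℂ).symm : (Fin q → ℂ) →L[ℂ] EuclideanSpace ℂ (Fin q)).comp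
      (ContinuousLinearMap.pi fun i => EuclideanSpace.proj (Fin.castLE hqn.le i))
  have hPapply : ∀ z i, P z i = z (Fin.castLE hqn.le i) := fun z i => rfl
  have hPsurj : Function.Surjective P := by
    intro y
    refine ⟨WithLp.toLp 2 fun j => if h : (j : ℕ) < q then y ⟨j, h⟩ else 0, ?_⟩
    ext i
    rw [hPapply]
    simp
  refine ⟨fun z => P (Φ z), fun z hz => ?_, fun z hz => ?_, fun γ hγ => ?_⟩
  · exact (P.differentiableAt.comp z (hΦ z hz).1).differentiableWithinAt
  · have h1 : fderiv ℂ (fun z => P (Φ z)) z = P.comp (fderiv ℂ Φ z) :=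
      (P.hasFDerivAt.comp z (hΦ z hz).1.hasFDerivAt).fderiv
    rw [h1, ContinuousLinearMap.coe_comp]
    refine hPsurj.comp ?_
    have h2 := (hΦ z hz).2
    rw [ContinuousLinearMap.det] at h2
    have h3 : IsUnit (LinearMap.det (fderiv ℂ Φ z : EuclideanSpace ℂ (Fin n) →ₗ[ℂ] _)) := by
      rw [h2]; exact isUnit_one
    intro y
    obtain ⟨x, hx⟩ := (LinearMap.equivOfIsUnitDet h3).surjective y
    exact ⟨x, (LinearMap.equivOfIsUnitDet_apply h3 x).symm.trans hx⟩
  · rintro ⟨c, hc⟩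
    exact hpath γ hγ (c ⟨0, hq⟩) fun t ht => by rw [← hc t ht]; rfl
end
end
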